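/- Let E be a rank two vector bundle on P^8 with H^3_*(E) = 0 and H^4_*(E) = 0. Then E is a direct sum of two line bundles. -/

import Mathlib

/-!
Background setup (the paper works on projective space `ℙⁿ` over a field `K`):
we encode a coherent sheaf on `ℙⁿ_K` by a module `M` over the homogeneous coordinate
ring `S = K[X₀,…,Xₙ]` (namely `M = Γ_*` of the sheaf), and the intermediate cohomology
module `H^i_*(F) = ⊕_ν H^i(ℙⁿ, F(ν))` (for `i ≥ 1`) by the local cohomology module
`H^{i+1}_𝔪(M)` at the irrelevant maximal ideal `𝔪 = (X₀,…,Xₙ)`, to which it is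
canonically isomorphic.
-/

open CategoryTheory TensorProduct

noncomputable section

/-- The homogeneous coordinate ring `S = K[X₀,…,Xₙ]` of `ℙⁿ`. -/
abbrev PolyS (K : Type) [Field K] (n : ℕ) : Type := MvPolynomial (Fin (n+1)) K

variable (K : Type) [Field K] (n : ℕ)

/-- The irrelevant maximal ideal `𝔪 = (X₀,…,Xₙ)` of `S`. -/
def irrel : Ideal (PolyS K n) := Ideal.span (Set.range MvPolynomial.X)

/-- `H^i_*` of the sheaf on `ℙⁿ` associated to the `S`-module `M`, encoded (for `i ≥ 1`)
as the local cohomology module `H^{i+1}_𝔪(M)`. -/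
def Hstar (i : ℕ) (M : Type) [AddCommGroup M] [Module (PolyS K n) M] :
    ModuleCat (PolyS K n) :=
  (localCohomology (irrel K n) (i+1)).obj (ModuleCat.of (PolyS K n) M)

/-- `M` is (the module of sections `Γ_*` of) an algebraic vector bundle on `ℙⁿ`:
finitely generated, depth `≥ 2` at `𝔪` (i.e. `H⁰_𝔪(M) = H¹_𝔪(M) = 0`, so `M = Γ_*(M̃)`),
and locally free at every prime other than the irrelevant ideal. -/
structure IsBundleModule (M : Type) [AddCommGroup M] [Module (PolyS K n) M] : Prop where
  finite : Module.Finite (PolyS K n) M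
  h0 : Subsingleton ((localCohomology (irrel K n) 0).obj (ModuleCat.of (PolyS K n) M))
  h1 : Subsingleton ((localCohomology (irrel K n) 1).obj (ModuleCat.of (PolyS K n) M))
  locFree : ∀ p : PrimeSpectrum (PolyS K n), p.asIdeal ≠ irrel K n →
    Module.Free (Localization.AtPrime p.asIdeal) (LocalizedModule p.asIdeal.primeCompl M)

/-- `M` represents a vector bundle of rank two on `ℙⁿ`. -/
structure IsRankTwoBundleModule (M : Type) [AddCommGroup M] [Module (PolyS K n) M]
    extends IsBundleModule K n M : Prop where
  rank2 : ∀ p : PrimeSpectrum (PolyS K n), p.asIdeal ≠ irrel K n →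
    Module.rank (Localization.AtPrime p.asIdeal) (LocalizedModule p.asIdeal.primeCompl M) = 2

/-- A finite length module which is moreover supported at the irrelevant ideal: the
(ungraded avatar of the) notion of a *graded* `S`-module of finite length. -/
def IsGradedFiniteLength (N : Type) [AddCommGroup N] [Module (PolyS K n) N] : Prop :=
  IsFiniteLength (PolyS K n) N ∧
    ∃ c : ℕ, (irrel K n) ^ c ≤ Module.annihilator (PolyS K n) N

section helperLemmas

section partA1
/-- finite free resolutions of length `n` -/
def FR (R : Type) [CommRing R] : ℕ → ∀ (M : Type) [AddCommGroup M] [Module R M], Prop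
  | 0, M, _, _ => Module.Free R M ∧ Module.Finite R M
  | n + 1, M, _, _ => ∃ (L F : Type) (_ : AddCommGroup L) (_ : Module R L) (_ : AddCommGroup F)
      (_ : Module R F) (i : L →ₗ[R] F) (p : F →ₗ[R] M),
      FR R n L ∧ Module.Free R F ∧ Module.Finite R F ∧ Function.Injective i ∧
        Function.Exact i p ∧ Function.Surjective p

namespace FR
variable {R : Type} [CommRing R]
variable {A B C M N : Type} [AddCommGroup A] [Module R A] [AddCommGroup B] [Module R B]
  [AddCommGroup C] [Module R C] [AddCommGroup M] [Module R M] [AddCommGroup N] [Module R N]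

lemma iso {n : ℕ} (h : FR R n M) (e : M ≃ₗ[R] N) : FR R n N := by
  cases n with
  | zero =>
    obtain ⟨h1, h2⟩ := h
    exact ⟨Module.Free.of_equiv e, Module.Finite.equiv e⟩
  | succ n =>
    obtain ⟨L, F, _, _, _, _, i, p, hL, hF, hF', hi, hip, hp⟩ := h
    refine ⟨L, F, _, _, _, _, i, e.toLinearMap ∘ₗ p, hL, hF, hF', hi, ?_, e.surjective.comp hp⟩
    intro x
    simpa using hip x

lemma succ {n : ℕ} : ∀ {M : Type} [AddCommGroup M] [Module R M], FR R n M → FR R (n+1) M := by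
  induction n with
  | zero =>
    intro M _ _ h
    obtain ⟨h1, h2⟩ := h
    refine ⟨PUnit, M, inferInstance, inferInstance, inferInstance, inferInstance, 0, LinearMap.id,
      ⟨inferInstance, inferInstance⟩, h1, h2, Function.injective_of_subsingleton _, ?_,
      Function.surjective_id⟩
    intro x
    simp [eq_comm]
  | succ n ih =>
    intro M _ _ h
    obtain ⟨L, F, _, _, _, _, i, p, hL, h⟩ := h
    exact ⟨L, F, _, _, _, _, i, p, ih hL, h⟩

lemma mono {n m : ℕ} (h : FR R n M) (hnm : n ≤ m) : FR R m M := by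
  induction hnm with
  | refl => exact h
  | step _ ih => exact ih.succ

lemma ext {n : ℕ} : ∀ {A B C : Type} [AddCommGroup A] [Module R A] [AddCommGroup B] [Module R B]
    [AddCommGroup C] [Module R C] (f : A →ₗ[R] B) (g : B →ₗ[R] C), Function.Injective f →
    Function.Exact f g → Function.Surjective g → FR R n A → FR R n C → FR R n B := by
  induction n with
  | zero =>
    intro A B C _ _ _ _ _ _ f g hf hfg hg hA hC
    obtain ⟨_, _⟩ := hA
    obtain ⟨_, _⟩ := hC
    obtain ⟨s, hs⟩ := Module.projective_lifting_property g LinearMap.id hg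
    have e := ((Function.Exact.splitSurjectiveEquiv hfg hf) ⟨s, hs⟩).1
    exact ⟨Module.Free.of_equiv e.symm, Module.Finite.equiv e.symm⟩
  | succ n ih =>
    intro A B C _ _ _ _ _ _ f g hf hfg hg hA hC
    obtain ⟨LA, FA, _, _, _, _, iA, pA, hLA, _, _, hiA, hipA, hpA⟩ := hA
    obtain ⟨LC, FC, _, _, _, _, iC, pC, hLC, _, _, hiC, hipC, hpC⟩ := hC
    obtain ⟨s, hs⟩ := Module.projective_lifting_property g pC hg
    have hs' : ∀ x, g (s x) = pC x := fun x => LinearMap.congr_fun hs x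
    have hgf : ∀ x, g (f x) = 0 := fun x => (hfg _).2 ⟨x, rfl⟩
    let q : FA × FC →ₗ[R] B := (f ∘ₗ pA).coprod s
    have hq : ∀ x y, q (x, y) = f (pA x) + s y := fun x y => by simp [q]
    have hqs : Function.Surjective q := by
      intro b
      obtain ⟨c, hc⟩ := hpC (g b)
      obtain ⟨a, ha⟩ := (hfg (b - s c)).1 (by simp [hs', hc])
      obtain ⟨a', rfl⟩ := hpA a
      exact ⟨(a', c), by rw [hq, ha]; abel⟩
    let u : LA →ₗ[R] LinearMap.ker q := LinearMap.codRestrict _ (LinearMap.inl R FA FC ∘ₗ iA) (by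
      intro c
      have : pA (iA c) = 0 := (hipA _).2 ⟨c, rfl⟩
      simp [hq, this])
    have hv : ∀ z : LinearMap.ker q, z.1.2 ∈ LinearMap.range iC := by
      rintro ⟨⟨x, y⟩, hz⟩
      rw [LinearMap.mem_ker, hq] at hz
      apply (hipC y).1
      have := congrArg g hz
      rwa [map_add, hgf, zero_add, hs', map_zero] at this
    let v : LinearMap.ker q →ₗ[R] LC :=
      (LinearEquiv.ofInjective iC hiC).symm.toLinearMap ∘ₗ
        LinearMap.codRestrict (LinearMap.range iC)
          (LinearMap.snd R FA FC ∘ₗ (LinearMap.ker q).subtype) hv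
    have hv' : ∀ z, iC (v z) = z.1.2 := by
      intro z
      have := LinearEquiv.apply_symm_apply (LinearEquiv.ofInjective iC hiC) ⟨z.1.2, hv z⟩
      exact congrArg Subtype.val this
    refine ⟨LinearMap.ker q, FA × FC, _, _, _, _, (LinearMap.ker q).subtype, q, ?_, inferInstance,
      inferInstance, Subtype.val_injective, ?_, hqs⟩
    · refine ih u v ?_ ?_ ?_ hLA hLC
      · intro x y hxy
        have := congrArg (fun z => z.1.1) hxy
        exact hiA this
      · rintro ⟨⟨x, y⟩, hz⟩
        constructor
        · intro h
          have h2 : y = 0 := by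
            have := hv' ⟨⟨x, y⟩, hz⟩
            rw [h] at this
            simpa using this.symm
          subst h2
          rw [LinearMap.mem_ker, hq, map_zero, add_zero] at hz
          have : pA x = 0 := hf (by simpa using hz)
          obtain ⟨a, rfl⟩ := (hipA x).1 this
          exact ⟨a, rfl⟩
        · rintro ⟨a, ha⟩
          apply hiC
          rw [hv', ← ha, map_zero]
          rfl
      · intro c
        have h0 : g (s (iC c)) = 0 := by rw [hs']; exact (hipC _).2 ⟨c, rfl⟩
        obtain ⟨a, ha⟩ := (hfg _).1 h0
        obtain ⟨a', rfl⟩ := hpA a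
        refine ⟨⟨(-a', iC c), ?_⟩, ?_⟩
        · rw [LinearMap.mem_ker, hq, map_neg, map_neg, ha]; simp
        · apply hiC; rw [hv']
    · intro x; simp

lemma quot {n : ℕ} (f : A →ₗ[R] B) (g : B →ₗ[R] C) (hf : Function.Injective f)
    (hfg : Function.Exact f g) (hg : Function.Surjective g) (hA : FR R n A) (hB : FR R (n+1) B) :
    FR R (n+1) C := by
  obtain ⟨L, F, _, _, _, _, i, p, hL, _, _, hi, hip, hp⟩ := hB
  have hgf : ∀ x, g (f x) = 0 := fun x => (hfg _).2 ⟨x, rfl⟩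
  have hpi : ∀ x, p (i x) = 0 := fun x => (hip _).2 ⟨x, rfl⟩
  let q := g ∘ₗ p
  have hq : ∀ x, q x = g (p x) := fun _ => rfl
  let u : L →ₗ[R] LinearMap.ker q := LinearMap.codRestrict _ i (by intro c; simp [hq, hpi])
  have hv : ∀ z : LinearMap.ker q, p z.1 ∈ LinearMap.range f := by
    rintro ⟨x, hz⟩
    exact (hfg _).1 hz
  let v : LinearMap.ker q →ₗ[R] A :=
      (LinearEquiv.ofInjective f hf).symm.toLinearMap ∘ₗ
        LinearMap.codRestrict (LinearMap.range f) (p ∘ₗ (LinearMap.ker q).subtype) hv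
  have hv' : ∀ z, f (v z) = p z.1 := by
      intro z
      have := LinearEquiv.apply_symm_apply (LinearEquiv.ofInjective f hf) ⟨p z.1, hv z⟩
      exact congrArg Subtype.val this
  refine ⟨LinearMap.ker q, F, _, _, _, _, (LinearMap.ker q).subtype, q, ?_, inferInstance,
      inferInstance, Subtype.val_injective, ?_, hg.comp hp⟩
  · refine ext u v ?_ ?_ ?_ hL hA
    · intro x y hxy
      exact hi (congrArg Subtype.val hxy)
    · rintro ⟨x, hz⟩
      constructor
      · intro h
        have := hv' ⟨x, hz⟩
        rw [h, map_zero] at this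
        obtain ⟨a, rfl⟩ := (hip x).1 this.symm
        exact ⟨a, rfl⟩
      · rintro ⟨a, ha⟩
        apply hf
        rw [hv', ← ha]
        simp [u, hpi]
    · intro a
      obtain ⟨x, hx⟩ := hp (f a)
      exact ⟨⟨x, by simp [hq, hx, hgf]⟩, hf (by rw [hv', hx])⟩
  · intro x; simp

end FR
end partA1

section partA2
lemma FR.baseChange {A B : Type} [CommRing A] [CommRing B] [Algebra A B] [Module.Flat A B] {n : ℕ} :
    ∀ {L : Type} [AddCommGroup L] [Module A L], FR A n L → FR B n (B ⊗[A] L) := by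
  induction n with
  | zero =>
    intro L _ _ h
    obtain ⟨_, _⟩ := h
    exact ⟨inferInstance, inferInstance⟩
  | succ n ih =>
    intro L _ _ h
    obtain ⟨K, F, _, _, _, _, i, p, hK, _, _, hi, hip, hp⟩ := h
    refine ⟨B ⊗[A] K, B ⊗[A] F, _, _, _, _, i.baseChange B, p.baseChange B, ih hK, inferInstance,
      inferInstance, ?_, ?_, ?_⟩
    · exact Module.Flat.lTensor_preserves_injective_linearMap i hi
    · exact lTensor_exact B hip hp
    · exact LinearMap.lTensor_surjective B hp

/-- every finite module has a finite free resolution of length `n` -/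
def GLD (R : Type) [CommRing R] (n : ℕ) : Prop :=
  ∀ (M : Type) [AddCommGroup M] [Module R M], Module.Finite R M → FR R n M

lemma free_finite_ringEquiv {R R' : Type} [CommRing R] [CommRing R'] (e : R ≃+* R')
    {M : Type} [AddCommGroup M] [Module R M] [Module R' M] (he : ∀ (r : R) (m : M), e r • m = r • m) :
    (Module.Free R M → Module.Free R' M) ∧ (Module.Finite R M → Module.Finite R' M) := by
  constructor
  · intro h1
    have := RingHomInvPair.of_ringEquiv e
    have := RingHomInvPair.symm (e : R →+* R') (e.symm : R' →+* R)
    let e2 : M ≃ₛₗ[(e : R →+* R')] M :=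
      { AddEquiv.refl M with
        map_smul' := fun r m => (he r m).symm }
    exact Module.Free.of_equiv e2
  · intro h2
    obtain ⟨s, hs⟩ := h2.fg_top
    refine ⟨⟨s, ?_⟩⟩
    rw [eq_top_iff]
    rintro x -
    have hx : x ∈ Submodule.span R (s : Set M) := by rw [hs]; trivial
    induction hx using Submodule.span_induction with
    | mem x h => exact Submodule.subset_span h
    | zero => exact zero_mem _
    | add x y _ _ h1 h2 => exact add_mem h1 h2
    | smul a x _ h => rw [← he]; exact Submodule.smul_mem _ _ h

lemma FR.ringEquiv {R R' : Type} [CommRing R] [CommRing R'] (e : R ≃+* R') {n : ℕ} :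
    ∀ {M : Type} [AddCommGroup M] [Module R M] [Module R' M], (∀ (r : R) (m : M), e r • m = r • m) →
    FR R n M → FR R' n M := by
  induction n with
  | zero =>
    intro M _ _ _ he h
    exact ⟨(free_finite_ringEquiv e he).1 h.1, (free_finite_ringEquiv e he).2 h.2⟩
  | succ n ih =>
    intro M _ _ _ he h
    obtain ⟨K, F, _, _, _, _, i, p, hK, h1, h2, hi, hip, hp⟩ := h
    let m1 : Module R' K := Module.compHom K e.symm.toRingHom
    let m2 : Module R' F := Module.compHom F e.symm.toRingHom
    have e1 : ∀ (r : R) (m : K), e r • m = r • m := fun r m => by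
      change e.symm (e r) • m = _; simp
    have e2 : ∀ (r : R) (m : F), e r • m = r • m := fun r m => by
      change e.symm (e r) • m = _; simp
    let i' : K →ₗ[R'] F :=
      { i with
        map_smul' := fun r m => by
          obtain ⟨r, rfl⟩ := e.surjective r
          simp [e1, e2] }
    let p' : F →ₗ[R'] M :=
      { p with
        map_smul' := fun r m => by
          obtain ⟨r, rfl⟩ := e.surjective r
          simp [he, e2] }
    exact ⟨K, F, _, m1, _, m2, i', p', ih e1 hK, (free_finite_ringEquiv e e2).1 h1,
      (free_finite_ringEquiv e e2).2 h2, hi, hip, hp⟩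

lemma GLD.ringEquiv {R R' : Type} [CommRing R] [CommRing R'] (e : R ≃+* R') {n : ℕ}
    (h : GLD R n) : GLD R' n := by
  intro M _ _ hM
  let _ : Module R M := Module.compHom M e.toRingHom
  have he : ∀ (r : R) (m : M), e r • m = r • m := fun r m => rfl
  have he' : ∀ (r : R') (m : M), e.symm r • m = r • m := fun r m => by rw [← he]; simp
  exact FR.ringEquiv e he (h M ((free_finite_ringEquiv e.symm he').2 hM))

section poly
open Polynomial
variable {A : Type} [CommRing A] {M : Type} [AddCommGroup M] [Module A M] [Module A[X] M]
  [IsScalarTower A A[X] M]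

/-- multiplication by `X` as an `A`-linear map -/
noncomputable def mulX (A M : Type) [CommRing A] [AddCommGroup M] [Module A M] [Module A[X] M]
    [IsScalarTower A A[X] M] : M →ₗ[A] M where
  toFun m := (X : A[X]) • m
  map_add' := smul_add _
  map_smul' r m := by
    simp only [RingHom.id_apply]
    rw [← IsScalarTower.algebraMap_smul A[X] r m, ← IsScalarTower.algebraMap_smul A[X] r (_ • m),
      smul_smul, smul_smul, mul_comm]

/-- the filtration `∑_{i<d} X^i M₀` -/
noncomputable def filt (M₀ : Submodule A M) : ℕ → Submodule A M
  | 0 => ⊥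
  | d + 1 => M₀ ⊔ (filt M₀ d).map (mulX A M)

lemma filt_fg (M₀ : Submodule A M) (h : M₀.FG) (d : ℕ) : (filt M₀ d).FG := by
  induction d with
  | zero => exact Submodule.fg_bot
  | succ d ih => exact h.sup (ih.map _)

lemma filt_le_succ (M₀ : Submodule A M) (d : ℕ) : filt M₀ d ≤ filt M₀ (d+1) := by
  induction d with
  | zero => exact bot_le
  | succ d ih => exact sup_le_sup le_rfl (Submodule.map_mono ih)

lemma filt_mono (M₀ : Submodule A M) : Monotone (filt M₀) :=
  monotone_nat_of_le_succ (filt_le_succ M₀)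

lemma filt_succ' (M₀ : Submodule A M) (d : ℕ) :
    filt M₀ (d+1) = filt M₀ d ⊔ M₀.map ((mulX A M)^d) := by
  induction d with
  | zero => simp [filt, Module.End.one_eq_id]
  | succ d ih =>
    conv_lhs => rw [filt, ih, Submodule.map_sup, ← sup_assoc]
    rw [filt]
    congr 1
    rw [pow_succ', Module.End.mul_eq_comp, Submodule.map_comp]

lemma exists_stable [IsNoetherianRing A] (M₀ : Submodule A M) (h : M₀.FG) :
    ∃ N, ∀ d ≥ N, ∀ y ∈ filt M₀ (d+1), mulX A M y ∈ filt M₀ (d+1) → y ∈ filt M₀ d := by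
  have : IsNoetherian A M₀ := isNoetherian_of_fg_of_noetherian M₀ h
  let Kd : ℕ → Submodule A M₀ := fun d => (filt M₀ d).comap (((mulX A M)^d : Module.End A M) ∘ₗ M₀.subtype)
  have hK : Monotone Kd := by
    refine monotone_nat_of_le_succ fun d x hx => ?_
    change ((mulX A M)^(d+1)) x.1 ∈ filt M₀ (d+1)
    rw [pow_succ']
    exact Submodule.mem_sup_right (Submodule.mem_map_of_mem hx)
  obtain ⟨N, hN⟩ := WellFoundedGT.monotone_chain_condition ⟨Kd, hK⟩
  refine ⟨N, fun d hd y hy hxy => ?_⟩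
  rw [filt_succ'] at hy
  obtain ⟨m', hm', z, hz, rfl⟩ := Submodule.mem_sup.1 hy
  obtain ⟨m0, hm0, rfl⟩ := hz
  refine add_mem hm' ?_
  have h1 : (⟨m0, hm0⟩ : M₀) ∈ Kd (d+1) := by
    change ((mulX A M)^(d+1)) m0 ∈ filt M₀ (d+1)
    rw [pow_succ']
    rw [map_add] at hxy
    exact (Submodule.add_mem_iff_right _
      (Submodule.mem_sup_right (Submodule.mem_map_of_mem hm'))).1 hxy
  have h2 : Kd (d+1) = Kd d := (hN _ (by omega)).symm.trans (hN _ hd)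
  rw [h2] at h1
  exact h1

lemma exists_pair [IsNoetherianRing A] (hM : Module.Finite A[X] M) :
    ∃ L' L : Submodule A M, L'.FG ∧ L.FG ∧ L' ≤ L ∧ (∀ y ∈ L', mulX A M y ∈ L) ∧
      (∀ y, mulX A M y ∈ L → y ∈ L') ∧ Submodule.span A[X] (L : Set M) = ⊤ := by
  obtain ⟨s, hs⟩ := hM.fg_top
  let M₀ := Submodule.span A (s : Set M)
  have hM₀ : M₀.FG := ⟨s, rfl⟩
  obtain ⟨N, hN⟩ := exists_stable M₀ hM₀
  have hle : M₀ ≤ filt M₀ (N+1) := le_sup_left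
  have hX : ∀ d, ∀ y ∈ filt M₀ d, mulX A M y ∈ filt M₀ (d+1) := fun d y hy =>
    Submodule.mem_sup_right (Submodule.mem_map_of_mem hy)
  have hall : ∀ y : M, ∃ d, y ∈ filt M₀ d := by
    intro y
    have hy : y ∈ Submodule.span A[X] (s : Set M) := by rw [hs]; trivial
    induction hy using Submodule.span_induction with
    | mem x h => exact ⟨N+1, hle (Submodule.subset_span h)⟩
    | zero => exact ⟨0, zero_mem _⟩
    | add x y _ _ h1 h2 =>
      obtain ⟨d1, h1⟩ := h1
      obtain ⟨d2, h2⟩ := h2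
      exact ⟨max d1 d2, add_mem (filt_mono M₀ (le_max_left _ _) h1)
        (filt_mono M₀ (le_max_right _ _) h2)⟩
    | smul p x _ h =>
      induction p using Polynomial.induction_on with
      | C a =>
        obtain ⟨d, h⟩ := h
        refine ⟨d, ?_⟩
        have : C a • x = a • x := IsScalarTower.algebraMap_smul A[X] a x
        rw [this]
        exact Submodule.smul_mem _ _ h
      | add p q hp hq =>
        obtain ⟨d1, h1⟩ := hp
        obtain ⟨d2, h2⟩ := hq
        exact ⟨max d1 d2, by
          rw [add_smul]
          exact add_mem (filt_mono M₀ (le_max_left _ _) h1) (filt_mono M₀ (le_max_right _ _) h2)⟩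
      | monomial n a hh =>
        obtain ⟨d, hh⟩ := hh
        refine ⟨d+1, ?_⟩
        have := hX d _ hh
        rw [pow_succ, ← mul_assoc, mul_comm, mul_smul]
        exact this
  refine ⟨filt M₀ N, filt M₀ (N+1), filt_fg _ hM₀ _, filt_fg _ hM₀ _, filt_le_succ _ _, hX N,
    ?_, ?_⟩
  · intro y hy
    obtain ⟨d, hd⟩ := hall y
    have key : ∀ k, y ∈ filt M₀ (N + k) → y ∈ filt M₀ N := by
      intro k
      induction k with
      | zero => exact id
      | succ k ih =>
        intro h
        exact ih (hN (N+k) (by omega) y h (filt_mono M₀ (by omega) hy))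
    exact key d (filt_mono M₀ (by omega) hd)
  · rw [eq_top_iff, ← hs]
    exact Submodule.span_mono fun x hx => hle (Submodule.subset_span hx)


lemma coeff_X_smul {L : Type} [AddCommGroup L] [Module A L] (q : PolynomialModule A L) (n : ℕ) :
    ((X : A[X]) • q).coeff n = if 1 ≤ n then q.coeff (n - 1) else 0 := by
  rw [← monomial_one_one_eq_X, PolynomialModule.monomial_smul_apply]
  simp

lemma exists_poly_resolution (L' L : Submodule A M)
    (hle : L' ≤ L)
    (h1 : ∀ y ∈ L', mulX A M y ∈ L) (h2 : ∀ y, mulX A M y ∈ L → y ∈ L')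
    (h3 : Submodule.span A[X] (L : Set M) = ⊤) :
    ∃ (f : PolynomialModule A L' →ₗ[A[X]] PolynomialModule A L)
      (g : PolynomialModule A L →ₗ[A[X]] M), Function.Injective f ∧ Function.Exact f g ∧
        Function.Surjective g := by
  let x' : L' →ₗ[A] L := (mulX A M).restrict h1
  let mp (u : L' →ₗ[A] L) : PolynomialModule A L' →ₗ[A[X]] PolynomialModule A L :=
    { PolynomialModule.map A u with
      map_smul' := fun p q => by
        have := PolynomialModule.map_smul (R' := A) u p q
        simpa using this }
  have hmp : ∀ u q n, (mp u q).coeff n = u (q.coeff n) := fun u q n => rfl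
  let f : PolynomialModule A L' →ₗ[A[X]] PolynomialModule A L :=
    (X : A[X]) • mp (Submodule.inclusion hle) - mp x'
  have hf : ∀ q, f q = (X : A[X]) • mp (Submodule.inclusion hle) q - mp x' q := fun q => rfl
  let g : PolynomialModule A L →ₗ[A[X]] M :=
    (LinearMap.liftBaseChange A[X] L.subtype) ∘ₗ
      (PolynomialModule.polynomialTensorProductLEquivPolynomialModule (R := A) (M := L)).symm.toLinearMap
  have hg0 : ∀ m : L, g (PolynomialModule.single A 0 m) = m := by
    intro m
    have : (PolynomialModule.polynomialTensorProductLEquivPolynomialModule (R := A) (M := L)).symm (PolynomialModule.single A 0 m)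
        = 1 ⊗ₜ m := by
      rw [LinearEquiv.symm_apply_eq]
      exact ((LinearMap.liftBaseChange_tmul A[X] (PolynomialModule.lsingle A 0) 1 m).trans
        (one_smul _ _)).symm
    simp [g, this]
  have hsub : ∀ q r : PolynomialModule A L, ∀ n, (q - r).coeff n = q.coeff n - r.coeff n :=
    fun q r n => rfl
  have hfs : ∀ l : L', f (PolynomialModule.single A 0 l) =
      (X : A[X]) • PolynomialModule.single A 0 (Submodule.inclusion hle l) -
        PolynomialModule.single A 0 (x' l) := by
    intro l
    have e : ∀ u : L' →ₗ[A] L, mp u (PolynomialModule.single A 0 l) =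
      PolynomialModule.single A 0 (u l) := fun u => PolynomialModule.map_single A u 0 l
    rw [hf, e, e]
  refine ⟨f, g, ?_, ?_, ?_⟩
  · rw [injective_iff_map_eq_zero]
    intro q hq
    rw [hf] at hq
    have hc : ∀ n, Submodule.inclusion hle (q.coeff n) = x' (q.coeff (n+1)) := by
      intro n
      have := congrArg (fun z => z.coeff (n+1)) hq
      simp only [hsub, coeff_X_smul, hmp] at this
      simpa [sub_eq_zero] using this
    have : ∀ k n, q.coeff n ≠ 0 → q.coeff (n+k) ≠ 0 := by
      intro k n hn
      induction k with
      | zero => exact hn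
      | succ k ih =>
        intro h0
        apply ih
        have := hc (n+k)
        rw [show n + k + 1 = n + (k+1) by omega, h0, map_zero] at this
        exact Submodule.inclusion_injective hle (by simpa using this)
    by_contra hne
    have : ∃ n, q.coeff n ≠ 0 := by
      by_contra hh
      push Not at hh
      exact hne (PolynomialModule.coeff_injective (Finsupp.ext hh))
    obtain ⟨n, hn⟩ := this
    have hinf : ∀ k, n + k ∈ q.coeff.support := fun k => Finsupp.mem_support_iff.2 (this k n hn)
    have h9 := Finset.le_sup (f := id) (hinf (q.coeff.support.sup id + 1))
    simp only [id] at h9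
    omega
  · intro q
    constructor
    · intro hq
      have key : ∀ N, ∀ q : PolynomialModule A L, (∀ n, N < n → q.coeff n = 0) → g q = 0 →
          ∃ r, f r = q := by
        intro N
        induction N with
        | zero =>
          intro q hq hgq
          have : q = PolynomialModule.single A 0 (q.coeff 0) := by
            apply PolynomialModule.coeff_injective
            ext n
            rcases Nat.eq_zero_or_pos n with rfl | hn
            · simp
            · rw [hq n hn]; simp [hn.ne]
          rw [this, hg0] at hgq
          refine ⟨0, ?_⟩
          rw [this, (Subtype.ext hgq : q.coeff 0 = 0)]
          simp
        | succ N ih =>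
          intro q hq hgq
          let s : PolynomialModule A L := PolynomialModule.ofCoeff A
            (q.coeff.comapDomain Nat.succ Nat.succ_injective.injOn)
          have hs : ∀ n, s.coeff n = q.coeff (n+1) := fun n => rfl
          have hqs : q = (X : A[X]) • s + PolynomialModule.single A 0 (q.coeff 0) := by
            apply PolynomialModule.coeff_injective
            ext n
            rw [PolynomialModule.coeff_add, Finsupp.add_apply, coeff_X_smul]
            rcases Nat.eq_zero_or_pos n with rfl | hn
            · simp
            · rw [if_pos (show 1 ≤ n from hn), hs, Nat.sub_add_cancel hn]; simp [hn.ne]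
          have hx : mulX A M (g s) = - (q.coeff 0 : M) := by
            have h := hgq
            rw [hqs, map_add, hg0, map_smul] at h
            exact eq_neg_of_add_eq_zero_left h
          have hl : g s ∈ L' := h2 _ (by rw [hx]; exact neg_mem (q.coeff 0).2)
          obtain ⟨r, hr⟩ := ih (s - PolynomialModule.single A 0 ⟨g s, hle hl⟩) (by
            intro n hn
            have hn' : 0 ≠ n := by omega
            rw [hsub, hs, hq _ (by omega)]
            simp [hn']) (by rw [map_sub, hg0]; simp)
          refine ⟨(X : A[X]) • r + PolynomialModule.single A 0 ⟨g s, hl⟩, ?_⟩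
          rw [map_add, map_smul, hr, hfs]
          conv_rhs => rw [hqs]
          have : x' ⟨g s, hl⟩ = - q.coeff 0 := Subtype.ext hx
          rw [this, smul_sub]
          have e2 : PolynomialModule.single A 0 (-q.coeff 0) =
            - PolynomialModule.single A 0 (q.coeff 0) :=
            map_neg (PolynomialModule.lsingle A 0) _
          rw [e2]
          have e3 : Submodule.inclusion hle ⟨g s, hl⟩ = ⟨g s, hle hl⟩ := rfl
          rw [e3]
          abel
      refine key (q.coeff.support.sup id) q (fun n hn => ?_) hq
      by_contra hne
      have := Finset.le_sup (f := id) (Finsupp.mem_support_iff.2 hne)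
      simp only [id] at this
      omega
    · rintro ⟨r, rfl⟩
      induction r using PolynomialModule.induction_linear with
      | zero => simp
      | add p q hp hq => rw [map_add, map_add, hp, hq, add_zero]
      | single i m =>
        have : PolynomialModule.single A i m =
            (monomial i (1 : A)) • PolynomialModule.single A 0 m := by
          rw [PolynomialModule.monomial_smul_single]; simp
        rw [this, map_smul, map_smul, hfs, map_sub, map_smul, hg0, hg0]
        have : (X : A[X]) • ((Submodule.inclusion hle m : L) : M) - (x' m : M) = 0 := sub_self _
        rw [this, smul_zero]
  · rw [← LinearMap.range_eq_top, eq_top_iff, ← h3, Submodule.span_le]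
    intro m hm
    exact ⟨_, hg0 ⟨m, hm⟩⟩

lemma GLD.polynomial [IsNoetherianRing A] {n : ℕ} (h : GLD A n) : GLD A[X] (n+1) := by
  intro M _ _ hM
  let _ : Module A M := Module.compHom M (algebraMap A A[X])
  have : IsScalarTower A A[X] M := IsScalarTower.of_algebraMap_smul fun _ _ => rfl
  obtain ⟨L', L, f1, f2, hle, h1, h2, h3⟩ := exists_pair (A := A) hM
  obtain ⟨f, g, hf, hfg, hg⟩ := exists_poly_resolution L' L hle h1 h2 h3
  have a1 : FR A[X] n (PolynomialModule A L') :=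
    ((h L' (Module.Finite.iff_fg.2 f1)).baseChange (B := A[X])).iso
      (PolynomialModule.polynomialTensorProductLEquivPolynomialModule (R := A) (M := L'))
  have a2 : FR A[X] n (PolynomialModule A L) :=
    ((h L (Module.Finite.iff_fg.2 f2)).baseChange (B := A[X])).iso
      (PolynomialModule.polynomialTensorProductLEquivPolynomialModule (R := A) (M := L))
  exact FR.quot f g hf hfg hg a1 a2.succ

end poly

lemma GLD.mvPolynomial (K : Type) [Field K] (n : ℕ) : GLD (MvPolynomial (Fin n) K) n := by
  induction n with
  | zero =>
    refine GLD.ringEquiv (MvPolynomial.isEmptyAlgEquiv K (Fin 0)).symm.toRingEquiv ?_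
    intro M _ _ h
    exact ⟨inferInstance, h⟩
  | succ n ih =>
    exact GLD.ringEquiv (MvPolynomial.finSuccEquiv K n).symm.toRingEquiv ih.polynomial

lemma FR.stablyFree {R : Type} [CommRing R] {n : ℕ} : ∀ {M : Type} [AddCommGroup M] [Module R M],
    FR R n M → Module.Projective R M → ∃ (a b : ℕ), Nonempty ((M × (Fin a → R)) ≃ₗ[R] (Fin b → R)) := by
  induction n with
  | zero =>
    intro M _ _ h _
    obtain ⟨_, _⟩ := h
    rcases subsingleton_or_nontrivial R with hR | hR
    · have := Module.subsingleton R M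
      exact ⟨0, 0, ⟨LinearEquiv.ofSubsingleton _ _⟩⟩
    · refine ⟨0, Module.finrank R M, ⟨?_⟩⟩
      exact LinearEquiv.prodUnique ≪≫ₗ (Module.finBasis R M).equivFun
  | succ n ih =>
    intro M _ _ h _
    obtain ⟨L, F, _, _, _, _, i, p, hL, _, _, hi, hip, hp⟩ := h
    obtain ⟨s, hs⟩ := Module.projective_lifting_property p LinearMap.id hp
    have e := ((Function.Exact.splitSurjectiveEquiv hip hi) ⟨s, hs⟩).1
    have hLp : Module.Projective R L := by
      have : Module.Projective R (L × M) := Module.Projective.of_equiv e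
      exact Module.Projective.of_split (LinearMap.inl R L M) (LinearMap.fst R L M) (by ext; simp)
    obtain ⟨a, b, ⟨e2⟩⟩ := ih hL hLp
    rcases subsingleton_or_nontrivial R with hR | hR
    · have := Module.subsingleton R M
      exact ⟨0, 0, ⟨LinearEquiv.ofSubsingleton _ _⟩⟩
    -- M × R^b ≃ M × (L × R^a) ≃ F × R^a
    let c := Module.finrank R (F × (Fin a → R))
    refine ⟨b, c, ⟨?_⟩⟩
    exact (LinearEquiv.refl R M).prodCongr e2.symm ≪≫ₗ (LinearEquiv.prodAssoc R M L _).symm ≪≫ₗ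
      ((LinearEquiv.prodComm R M L ≪≫ₗ e.symm).prodCongr (LinearEquiv.refl R _)) ≪≫ₗ
      (Module.finBasis R (F × (Fin a → R))).equivFun
end partA2

section partB0
section noeth
open Polynomial MvPolynomial Ideal Nat RingHom List

variable {k : Type*} [Field k] {n : ℕ} (f : MvPolynomial (Fin (n + 1)) k)
variable (v w : Fin (n + 1) →₀ ℕ)

namespace NoethN




variable {f v} in
lemma lt_up (vlt : ∀ i, v i < (2 + f.totalDegree)) : ∀ l ∈ ofFn v, l < (2 + f.totalDegree) := by
  grind


noncomputable abbrev T1 (c : k) :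
    MvPolynomial (Fin (n + 1)) k →ₐ[k] MvPolynomial (Fin (n + 1)) k :=
  aeval fun i ↦ if i = 0 then X 0 else X i + c • X 0 ^ (2 + f.totalDegree) ^ (i).1

lemma t1_comp_t1_neg (c : k) : (T1 f c).comp (T1 f (-c)) = AlgHom.id _ _ := by
  rw [comp_aeval, ← MvPolynomial.aeval_X_left]
  ext i v
  cases i using Fin.cases <;> simp

noncomputable abbrev T := AlgEquiv.ofAlgHom (T1 f 1) (T1 f (-1))
  (t1_comp_t1_neg f 1) (by simpa using t1_comp_t1_neg f (-1))

lemma sum_r_mul_ne (vlt : ∀ i, v i < (2 + f.totalDegree)) (wlt : ∀ i, w i < (2 + f.totalDegree)) (ne : v ≠ w) :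
    ∑ x : Fin (n + 1), (2 + f.totalDegree) ^ (x).1 * v x ≠ ∑ x : Fin (n + 1), (2 + f.totalDegree) ^ (x).1 * w x := by
  intro h
  refine ne <| Finsupp.ext <| congrFun <| ofFn_inj.mp ?_
  apply ofDigits_inj_of_len_eq (Nat.lt_add_right f.totalDegree one_lt_two)
    (by simp) (lt_up vlt) (lt_up wlt)
  simpa only [ofDigits_eq_sum_mapIdx, mapIdx_eq_ofFn, get_ofFn, length_ofFn,
    Fin.val_cast, mul_comm, sum_ofFn] using! h

lemma degreeOf_zero_t {a : k} (ha : a ≠ 0) : ((T f) (monomial v a)).degreeOf 0 =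
    ∑ i : Fin (n + 1), ((2 + f.totalDegree) ^ (i).1) * v i := by
  rw [← natDegree_finSuccEquiv, monomial_eq, Finsupp.prod_pow v fun a ↦ X a]
  simp only [Fin.prod_univ_succ, Fin.sum_univ_succ, map_mul, map_prod, map_pow,
    AlgEquiv.ofAlgHom_apply, MvPolynomial.aeval_C, MvPolynomial.aeval_X, if_pos, Fin.succ_ne_zero,
    ite_false, one_smul, map_add, finSuccEquiv_X_zero, finSuccEquiv_X_succ, algebraMap_eq]
  have h (i : Fin n) :
      (Polynomial.C (X (R := k) i) + Polynomial.X ^ (2 + f.totalDegree) ^ (i.succ).1) ^ v i.succ ≠ 0 :=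
    pow_ne_zero (v i.succ) (leadingCoeff_ne_zero.mp <| by simp [add_comm, leadingCoeff_X_pow_add_C])
  rw [natDegree_mul (by simp [ha]) (mul_ne_zero (by simp) (Finset.prod_ne_zero_iff.mpr
    (fun i _ ↦ h i))), natDegree_mul (by simp) (Finset.prod_ne_zero_iff.mpr (fun i _ ↦ h i)),
    natDegree_prod _ _ (fun i _ ↦ h i), natDegree_finSuccEquiv, degreeOf_C]
  simpa only [natDegree_pow, zero_add, natDegree_X, mul_one, Fin.val_zero, pow_zero, one_mul,
    add_right_inj] using Finset.sum_congr rfl (fun i _ ↦ by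
    rw [add_comm (Polynomial.C _), natDegree_X_pow_add_C, mul_comm])

lemma degreeOf_t_ne_of_ne (hv : v ∈ f.support) (hw : w ∈ f.support) (ne : v ≠ w) :
    (T f <| monomial v <| coeff v f).degreeOf 0 ≠
    (T f <| monomial w <| coeff w f).degreeOf 0 := by
  rw [degreeOf_zero_t _ _ <| mem_support_iff.mp hv, degreeOf_zero_t _ _ <| mem_support_iff.mp hw]
  refine sum_r_mul_ne f v w (fun i ↦ ?_) (fun i ↦ ?_) ne <;>
  exact lt_of_le_of_lt ((monomial_le_degreeOf i ‹_›).trans (degreeOf_le_totalDegree f i))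
    (by lia)

lemma leadingCoeff_finSuccEquiv_t :
    (finSuccEquiv k n ((T f) ((monomial v) (coeff v f)))).leadingCoeff =
    algebraMap k _ (coeff v f) := by
  rw [monomial_eq, Finsupp.prod_fintype]
  · simp only [map_mul, map_prod, leadingCoeff_mul, leadingCoeff_prod]
    rw [AlgEquiv.ofAlgHom_apply, algHom_C, algebraMap_eq, finSuccEquiv_apply,
      eval₂Hom_C, coe_comp]
    simp only [AlgEquiv.ofAlgHom_apply, Function.comp_apply, leadingCoeff_C, map_pow,
      leadingCoeff_pow, algebraMap_eq]
    have : ∀ j, ((finSuccEquiv k n) ((T1 f) 1 (X j))).leadingCoeff = 1 := fun j ↦ by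
      by_cases h : j = 0
      · simp [h, finSuccEquiv_apply]
      · simp only [aeval_eq_bind₁, bind₁_X_right, if_neg h, one_smul, map_add, map_pow]
        obtain ⟨i, rfl⟩ := Fin.exists_succ_eq.mpr h
        simp [finSuccEquiv_X_succ, finSuccEquiv_X_zero, add_comm]
    simp only [this, one_pow, Finset.prod_const_one, mul_one]
  exact fun i ↦ pow_zero _

lemma T_leadingcoeff_isUnit (fne : f ≠ 0) :
    IsUnit (finSuccEquiv k n (T f f)).leadingCoeff := by
  obtain ⟨v, vin, vs⟩ := Finset.exists_max_image f.support
    (fun v ↦ (T f ((monomial v) (coeff v f))).degreeOf 0) (support_nonempty.mpr fne)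
  set h := fun w ↦ (MvPolynomial.monomial w) (coeff w f)
  simp only [← natDegree_finSuccEquiv] at vs
  replace vs : ∀ x ∈ f.support \ {v}, (finSuccEquiv k n ((T f) (h x))).degree <
      (finSuccEquiv k n ((T f) (h v))).degree := by
    intro x hx
    obtain ⟨h1, h2⟩ := Finset.mem_sdiff.mp hx
    apply degree_lt_degree <| lt_of_le_of_ne (vs x h1) ?_
    simpa only [natDegree_finSuccEquiv]
      using degreeOf_t_ne_of_ne f _ _ h1 vin <| ne_of_not_mem_cons h2
  have coeff : (finSuccEquiv k n ((T f) (h v + ∑ x ∈ f.support \ {v}, h x))).leadingCoeff =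
      (finSuccEquiv k n ((T f) (h v))).leadingCoeff := by
    simp only [map_add, map_sum]
    rw [add_comm]
    apply leadingCoeff_add_of_degree_lt <| (lt_of_le_of_lt <| degree_sum_le _ _) ?_
    have h2 : h v ≠ 0 := by simpa [h] using mem_support_iff.mp vin
    replace h2 : (finSuccEquiv k n ((T f) (h v))) ≠ 0 := fun eq ↦ h2 <|
      by simpa only [map_eq_zero_iff _ (AlgEquiv.injective _)] using eq
    exact (Finset.sup_lt_iff <| Ne.bot_lt (fun x ↦ h2 <| degree_eq_bot.mp x)).mpr vs
  nth_rw 2 [← f.support_sum_monomial_coeff]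
  rw [Finset.sum_eq_add_sum_sdiff_singleton_of_mem vin h]
  rw [leadingCoeff_finSuccEquiv_t] at coeff
  simpa only [coeff, algebraMap_eq] using (mem_support_iff.mp vin).isUnit.map MvPolynomial.C

end NoethN
end noeth

lemma exists_monic_change (K : Type) [Field K] (n : ℕ) (f : MvPolynomial (Fin (n+1)) K) (hf : f ≠ 0) :
    ∃ e : MvPolynomial (Fin (n+1)) K ≃+* Polynomial (MvPolynomial (Fin n) K),
      IsUnit (e f).leadingCoeff :=
  ⟨((NoethN.T f).trans (MvPolynomial.finSuccEquiv K n)).toRingEquiv,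
    NoethN.T_leadingcoeff_isUnit f hf⟩
end partB0

section partB1
/-- equivalence of vectors under invertible matrices -/
def VRel {R : Type} [CommRing R] {b : ℕ} (f g : Fin b → R) : Prop :=
  ∃ A : (Matrix (Fin b) (Fin b) R)ˣ, A.1.mulVec f = g

namespace VRel
variable {R R' : Type} [CommRing R] [CommRing R'] {b : ℕ} {f g h : Fin b → R}

lemma refl (f : Fin b → R) : VRel f f := ⟨1, by simp⟩
lemma symm (h : VRel f g) : VRel g f := by
  obtain ⟨A, rfl⟩ := h
  exact ⟨A⁻¹, by rw [Matrix.mulVec_mulVec, A.inv_mul, Matrix.one_mulVec]⟩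
lemma trans (h1 : VRel f g) (h2 : VRel g h) : VRel f h := by
  obtain ⟨A, rfl⟩ := h1
  obtain ⟨B, rfl⟩ := h2
  exact ⟨B * A, by rw [Matrix.mulVec_mulVec]; rfl⟩

lemma map (φ : R →+* R') (h : VRel f g) : VRel (fun i => φ (f i)) (fun i => φ (g i)) := by
  obtain ⟨A, rfl⟩ := h
  refine ⟨Units.map (φ.mapMatrix).toMonoidHom A, ?_⟩
  ext i
  simp [Matrix.mulVec, dotProduct]

lemma of_inv (A B : Matrix (Fin b) (Fin b) R) (h1 : A * B = 1) (h2 : A.mulVec f = g) : VRel f g :=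
  ⟨⟨A, B, h1, mul_eq_one_comm.1 h1⟩, h2⟩

lemma update_add (f : Fin b → R) {i j : Fin b} (hij : i ≠ j) (c : R) :
    VRel f (Function.update f i (f i + c * f j)) := by
  refine of_inv (Matrix.transvection i j c) (Matrix.transvection i j (-c)) ?_ ?_
  · rw [Matrix.transvection_mul_transvection_same _ _ hij, add_neg_cancel, Matrix.transvection_zero]
  · ext k
    rw [Matrix.transvection, Matrix.add_mulVec, Matrix.one_mulVec]
    rcases eq_or_ne k i with rfl | hk
    · simp [Matrix.single_mulVec]
    · simp [Matrix.single_mulVec, hk]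

lemma unit_smul (f : Fin b → R) (u : Rˣ) : VRel f (fun i => u * f i) := by
  refine of_inv (Matrix.diagonal fun _ => (u : R)) (Matrix.diagonal fun _ => ((u⁻¹ : Rˣ) : R))
    ?_ ?_
  · rw [Matrix.diagonal_mul_diagonal]; simp
  · ext k; simp [Matrix.mulVec_diagonal]

lemma perm (f : Fin b → R) (s : Equiv.Perm (Fin b)) : VRel f (f ∘ s) := by
  refine of_inv (Equiv.toPEquiv s).toMatrix (Equiv.toPEquiv s.symm).toMatrix ?_ ?_
  · rw [← PEquiv.toMatrix_trans, ← Equiv.toPEquiv_trans]; simp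
  · exact PEquiv.toMatrix_toPEquiv_mulVec s f

/-- clear several entries at once -/
lemma update_all (f : Fin b → R) (j : Fin b) (c : Fin b → R) :
    VRel f (fun i => if i = j then f j else f i + c i * f j) := by
  classical
  have key : ∀ s : Finset (Fin b), j ∉ s → VRel f (fun i => if i ∈ s then f i + c i * f j else f i) := by
    intro s
    induction s using Finset.induction_on with
    | empty => intro _; simpa using refl f
    | insert a s ha ih =>
      intro hj
      simp only [Finset.mem_insert, not_or] at hj
      refine (ih hj.2).trans ?_
      have := update_add (fun i => if i ∈ s then f i + c i * f j else f i) (i := a) (j := j)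
        (Ne.symm hj.1) (c a)
      convert this using 1
      ext i
      rcases eq_or_ne i a with rfl | hi
      · simp [ha, hj.2]
      · simp [hi]
  have := key (Finset.univ.erase j) (by simp)
  convert this using 1
  ext i
  rcases eq_or_ne i j with rfl | hi <;> simp_all

lemma single_single (i j : Fin b) : VRel (Pi.single i 1 : Fin b → R) (Pi.single j 1) := by
  have := perm (Pi.single i 1 : Fin b → R) (Equiv.swap i j)
  convert this using 1
  ext k
  simp only [Pi.single_apply, Function.comp]
  by_cases hk : k = j
  · subst hk; simp
  · by_cases h2 : k = i
    · subst h2; simp [hk, Ne.symm hk]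
    · simp [Equiv.swap_apply_of_ne_of_ne h2 hk, hk, h2]

lemma of_isUnit (f : Fin b → R) (i : Fin b) (h : IsUnit (f i)) : VRel f (Pi.single i 1) := by
  obtain ⟨u, hu⟩ := h
  refine (unit_smul f u⁻¹).trans ?_
  have hu' : ((u⁻¹ : Rˣ) : R) * f i = 1 := by rw [← hu]; simp
  have := update_all (fun k => (u⁻¹ : Rˣ) * f k) i (fun k => - ((u⁻¹ : Rˣ) * f k))
  refine this.trans ?_
  convert refl _ using 1
  ext k
  by_cases hk : k = i
  · subst hk; simp [hu']
  · simp [hk, hu']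

end VRel

/-- unimodular -/
def Uni {R : Type} [CommRing R] {b : ℕ} (f : Fin b → R) : Prop := ∃ c : Fin b → R, ∑ i, c i * f i = 1

lemma Uni.map {R R' : Type} [CommRing R] [CommRing R'] {b : ℕ} {f : Fin b → R} (φ : R →+* R')
    (h : Uni f) : Uni (fun i => φ (f i)) := by
  obtain ⟨c, hc⟩ := h
  exact ⟨fun i => φ (c i), by rw [← φ.map_one, ← hc]; simp⟩

lemma Uni.rel {R : Type} [CommRing R] {b : ℕ} {f g : Fin b → R} (h : Uni f) (r : VRel f g) :
    Uni g := by
  obtain ⟨A, hA⟩ := r.symm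
  obtain ⟨c, hc⟩ := h
  refine ⟨Matrix.vecMul c A.1, ?_⟩
  have := Matrix.dotProduct_mulVec c A.1 g
  rw [hA] at this
  exact this.symm.trans hc

section horrocks
open Polynomial
variable {R : Type} [CommRing R]

lemma degree_C_mul_lt' (c : R) (p : R[X]) (n : ℕ) (h : p.degree < n) : (C c * p).degree < n := by
  rw [degree_lt_iff_coeff_zero] at h ⊢
  intro m hm
  rw [coeff_C_mul, h m hm, mul_zero]

lemma exists_lead (f₁ f₂ : R[X]) (d : ℕ) (h1 : f₁.Monic) (hd : f₁.natDegree = d + 1)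
    (h2 : f₂.degree < (d + 1 : ℕ)) (k : ℕ) (hk : IsUnit (f₂.coeff k)) :
    ∃ a b : R[X], (a * f₁ + b * f₂).degree < (d + 1 : ℕ) ∧ (a * f₁ + b * f₂).coeff d = 1 := by
  have key : ∀ j, ∀ g : R[X], (∃ a b, g = a * f₁ + b * f₂) → g.degree < (d + 1 : ℕ) → j ≤ d →
      ∃ h, (∃ a b, h = a * f₁ + b * f₂) ∧ h.degree < (d + 1 : ℕ) ∧ h.coeff d = g.coeff (d - j) := by
    intro j
    induction j with
    | zero => intro g hg hgd _; exact ⟨g, hg, hgd, by simp⟩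
    | succ j ih =>
      intro g hg hgd hj
      obtain ⟨a, b, hab⟩ := hg
      have hdeg : (X * g - C (g.coeff d) * f₁).degree < ((d + 1 : ℕ) : WithBot ℕ) := by
        rw [degree_lt_iff_coeff_zero] at hgd ⊢
        intro m hm
        rw [coeff_sub, coeff_C_mul]
        obtain ⟨m, rfl⟩ : ∃ m', m = m' + 1 := ⟨m - 1, by omega⟩
        rw [coeff_X_mul]
        rcases eq_or_lt_of_le hm with h | h
        · have : m = d := by omega
          subst this
          have : f₁.coeff (m + 1) = 1 := by rw [← hd]; exact h1
          rw [this]; ring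
        · rw [hgd m (by omega), coeff_eq_zero_of_natDegree_lt (p := f₁) (by omega)]; ring
      obtain ⟨h, ⟨a', b', hab'⟩, hh2, hh3⟩ := ih (X * g - C (g.coeff d) * f₁)
        ⟨X * a - C (g.coeff d), X * b, by rw [hab]; ring⟩ hdeg (by omega)
      refine ⟨h + C (f₁.coeff (d - j)) * g, ⟨a' + C (f₁.coeff (d - j)) * a,
          b' + C (f₁.coeff (d - j)) * b, by rw [hab', hab]; ring⟩, ?_, ?_⟩
      · refine (degree_add_le _ _).trans_lt (max_lt hh2 ?_)
        exact degree_C_mul_lt' _ _ _ hgd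
      · rw [coeff_add, hh3, coeff_sub, coeff_C_mul, coeff_C_mul,
          show d - j = (d - (j + 1)) + 1 by omega, coeff_X_mul]
        ring
  rcases subsingleton_or_nontrivial R with hR | hR
  · refine ⟨0, 0, ?_, Subsingleton.elim _ _⟩
    rw [Subsingleton.elim (0 * f₁ + 0 * f₂) 0, degree_zero]
    exact bot_lt_iff_ne_bot.2 (by simp)
  have hkd : k ≤ d := by
    by_contra hk'
    rw [degree_lt_iff_coeff_zero] at h2
    rw [h2 k (by omega)] at hk
    exact not_isUnit_zero hk
  obtain ⟨h, ⟨a, b, hab⟩, hh2, hh3⟩ := key (d - k) f₂ ⟨0, 1, by ring⟩ h2 (by omega)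
  obtain ⟨u, hu⟩ := hk
  refine ⟨C ((u⁻¹ : Rˣ) : R) * a, C ((u⁻¹ : Rˣ) : R) * b, ?_⟩
  rw [mul_assoc, mul_assoc, ← mul_add, ← hab]
  refine ⟨degree_C_mul_lt' _ _ _ hh2, ?_⟩
  rw [coeff_C_mul, hh3, show d - (d - k) = k by omega, ← hu]
  simp

theorem horrocks [IsLocalRing R] {b : ℕ} (hb : 3 ≤ b) (d : ℕ) : ∀ (f : Fin b → R[X]), Uni f →
    (∃ i, (f i).Monic ∧ (f i).natDegree = d) → ∃ i, VRel f (Pi.single i 1) := by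
  induction d with
  | zero =>
    rintro f - ⟨i, hi, hd⟩
    refine ⟨i, VRel.of_isUnit f i ?_⟩
    rw [hi.natDegree_eq_zero.1 hd]
    exact isUnit_one
  | succ d ih =>
    intro f hf ⟨i, hi, hd⟩
    let f' : Fin b → R[X] := fun k => if k = i then f i else f k + (-(f k /ₘ f i)) * f i
    have hff' : VRel f f' := VRel.update_all f i _
    have hf'i : f' i = f i := by simp [f']
    have hf'k : ∀ k ≠ i, (f' k).degree < (d + 1 : ℕ) := by
      intro k hk
      have : f' k = f k %ₘ f i := by
        simp only [f', if_neg hk]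
        rw [eq_comm, modByMonic_eq_sub_mul_div _ (f i)]; ring
      rw [this, ← hd, ← degree_eq_natDegree hi.ne_zero]
      exact degree_modByMonic_lt _ hi
    have : ∃ k ≠ i, ∃ m, IsUnit ((f' k).coeff m) := by
      by_contra hcon
      push Not at hcon
      obtain ⟨c, hc⟩ := (hf.rel hff').map (mapRingHom (IsLocalRing.residue R))
      have h0 : ∀ k ≠ i, mapRingHom (IsLocalRing.residue R) (f' k) = 0 := by
        intro k hk
        ext m
        have := hcon k hk m
        simp only [coe_mapRingHom, coeff_map, coeff_zero]
        exact (IsLocalRing.residue_eq_zero_iff _).2 this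
      beta_reduce at hc
      rw [Finset.sum_eq_single i (fun k _ hk => by rw [h0 k hk, mul_zero]) (by simp), hf'i] at hc
      have hm : ((f i).map (IsLocalRing.residue R)).Monic := hi.map _
      have hu : IsUnit ((f i).map (IsLocalRing.residue R)) := IsUnit.of_mul_eq_one _ (by rw [mul_comm]; exact hc)
      have h1 := hi.natDegree_map (IsLocalRing.residue R)
      have h2 := natDegree_eq_zero_of_isUnit hu
      omega
    obtain ⟨k, hk, m, hm⟩ := this
    obtain ⟨l, hl⟩ : ∃ l : Fin b, l ≠ i ∧ l ≠ k := by
      have : ∃ l ∈ (Finset.univ : Finset (Fin b)), l ∉ ({i, k} : Finset (Fin b)) := by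
        apply Finset.exists_mem_notMem_of_card_lt_card
        have := Finset.card_le_two (a := i) (b := k)
        simp only [Finset.card_univ, Fintype.card_fin]
        omega
      obtain ⟨l, _, hl⟩ := this
      simp at hl
      exact ⟨l, hl⟩
    obtain ⟨p, q, hpq1, hpq2⟩ := exists_lead (f' i) (f' k) d (by rwa [hf'i]) (by rwa [hf'i])
      (hf'k k hk) m hm
    set g := p * f' i + q * f' k with hg
    let c := 1 - (f' l).coeff d
    let f1 := Function.update f' l (f' l + (C c * p) * f' i)
    let f2 := Function.update f1 l (f1 l + (C c * q) * f1 k)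
    have r1 : VRel f' f1 := VRel.update_add f' hl.1 _
    have r2 : VRel f1 f2 := VRel.update_add f1 hl.2 _
    have hfl : f2 l = f' l + C c * g := by
      simp only [f2, f1, Function.update_self, Function.update_of_ne hl.2.symm, hg]
      ring
    have hdeg : (f2 l).degree < (d+1 : ℕ) := by
      rw [hfl]
      refine (degree_add_le _ _).trans_lt (max_lt (hf'k l hl.1) ?_)
      exact degree_C_mul_lt' _ _ _ hpq1
    have hco : (f2 l).coeff d = 1 := by
      rw [hfl, coeff_add, coeff_C_mul, hpq2]; simp [c]
    have hle : (f2 l).natDegree ≤ d := by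
      rw [natDegree_le_iff_degree_le]
      rw [degree_le_iff_coeff_zero]
      rw [degree_lt_iff_coeff_zero] at hdeg
      intro m hm
      exact hdeg m (by exact_mod_cast hm)
    have hr := (hff'.trans r1).trans r2
    obtain ⟨i0, hi0⟩ := ih f2 (hf.rel hr) ⟨l, monic_of_natDegree_le_of_coeff_eq_one d hle hco,
      le_antisymm hle (le_natDegree_of_ne_zero (by rw [hco]; exact one_ne_zero))⟩
    exact ⟨i0, hr.trans hi0⟩

end horrocks
end partB1

section partB2
section patch
open Polynomial
variable {R : Type} [CommRing R]

/-- the set of `c` with `f(a + c b) ~ f(a)` universally -/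
def patchIdeal {b : ℕ} (f : Fin b → R[X]) : Ideal R where
  carrier := {c | ∀ (B : Type) [CommRing B] [Algebra R B] (x y : B),
    VRel (fun i => aeval (x + c • y) (f i)) (fun i => aeval x (f i))}
  zero_mem' := by
    intro B _ _ x y
    simpa using VRel.refl _
  add_mem' := by
    intro c c' hc hc' B _ _ x y
    have h1 := hc' B (x + c • y) y
    have h2 := hc B x y
    rw [add_smul, ← add_assoc]
    exact h1.trans h2
  smul_mem' := by
    intro r c hc B _ _ x y
    have := hc B x (r • y)
    rwa [smul_comm, smul_smul] at this

lemma patch_of_top {b : ℕ} (f : Fin b → R[X]) (h : patchIdeal f = ⊤) :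
    VRel f (fun i => C ((f i).eval 0)) := by
  have h1 : (1 : R) ∈ patchIdeal f := by rw [h]; trivial
  have := h1 R[X] 0 X
  convert this using 1
  · ext i : 1; simp
  · ext i : 1; simp [aeval_def, eval₂_eq_eval_map, ← coeff_zero_eq_eval_zero]

/-- lifting after scaling the variable -/
lemma lift_scaled {T : Type} [CommRing T] [Algebra R T] (S : Submonoid R) [IsLocalization S T]
    (g : T[X][X]) (h0 : g.coeff 0 ∈ lifts (algebraMap R T)) :
    ∃ c ∈ S, ∀ r : R, g.comp (C (C (algebraMap R T (c * r))) * X) ∈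
      lifts (mapRingHom (algebraMap R T)) := by
  classical
  obtain ⟨c, hc⟩ := IsLocalization.exist_integer_multiples_of_finset S
    (g.support.biUnion fun k => (g.coeff k).support.image fun j => (g.coeff k).coeff j)
  have hc' : ∀ k j, ∃ a : R, algebraMap R T a = algebraMap R T c * (g.coeff k).coeff j := by
    intro k j
    by_cases h : (g.coeff k).coeff j = 0
    · exact ⟨0, by simp [h]⟩
    · obtain ⟨a, ha⟩ := hc ((g.coeff k).coeff j) (by
        simp only [Finset.mem_biUnion, Finset.mem_image, mem_support_iff]
        exact ⟨k, fun hk => h (by rw [hk]; simp), j, h, rfl⟩)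
      exact ⟨a, by rw [ha, Algebra.smul_def]⟩
  refine ⟨c, c.2, fun r => ?_⟩
  rw [lifts_iff_coeff_lifts]
  intro k
  rw [comp_C_mul_X_coeff]
  have hl : ∀ p : T[X], p ∈ Set.range (mapRingHom (algebraMap R T)) ↔ p ∈ lifts (algebraMap R T) :=
    fun p => Iff.rfl
  rw [hl]
  cases k with
  | zero => simpa using h0
  | succ k =>
    rw [lifts_iff_coeff_lifts]
    intro j
    obtain ⟨a, ha⟩ := hc' (k+1) j
    refine ⟨a * r * (c * r) ^ k, ?_⟩
    rw [← C_pow, coeff_mul_C]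
    simp only [map_mul, map_pow, ha]
    ring

lemma lift_scaled_matrix {T : Type} [CommRing T] [Algebra R T] (S : Submonoid R)
    [IsLocalization S T] {b : ℕ} (G : Matrix (Fin b) (Fin b) T[X][X])
    (h0 : ∀ i j, (G i j).coeff 0 ∈ lifts (algebraMap R T)) :
    ∃ c ∈ S, ∀ r : R, ∃ A : Matrix (Fin b) (Fin b) R[X][X],
      A.map (mapRingHom (mapRingHom (algebraMap R T))) =
        G.map (fun g => g.comp (C (C (algebraMap R T (c * r))) * X)) := by
  choose c hcS hc using fun ij : Fin b × Fin b => lift_scaled S (G ij.1 ij.2) (h0 ij.1 ij.2)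
  refine ⟨∏ ij, c ij, prod_mem fun ij _ => hcS ij, fun r => ?_⟩
  have : ∀ i j, ∃ a : R[X][X], mapRingHom (mapRingHom (algebraMap R T)) a =
      (G i j).comp (C (C (algebraMap R T ((∏ ij, c ij) * r))) * X) := by
    intro i j
    have := hc (i, j) ((∏ ij ∈ Finset.univ.erase (i, j), c ij) * r)
    rw [← mul_assoc, Finset.mul_prod_erase _ _ (Finset.mem_univ _)] at this
    exact this
  choose A hA using this
  exact ⟨Matrix.of A, by ext1 i j; simpa using hA i j⟩

lemma patch_local [IsDomain R] {b : ℕ} (f : Fin b → R[X]) (p : Ideal R) [p.IsPrime]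
    (h : VRel (fun i => (f i).map (algebraMap R (Localization.AtPrime p)))
      (fun i => C (((f i).map (algebraMap R (Localization.AtPrime p))).eval 0))) :
    ∃ c ∈ p.primeCompl, c ∈ patchIdeal f := by
  set T := Localization.AtPrime p
  obtain ⟨M, hM⟩ := h
  set F : Fin b → T[X] := fun i => (f i).map (algebraMap R T) with hF
  -- the two substitutions
  let φ₁ : T[X] →+* T[X][X] := C
  let φ₂ : T[X] →+* T[X][X] := eval₂RingHom ((C : T[X] →+* T[X][X]).comp (C : T →+* T[X])) (C X + X : T[X][X])
  let M₁ := Units.map (φ₁.mapMatrix (m := Fin b)).toMonoidHom M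
  let M₂ := Units.map (φ₂.mapMatrix (m := Fin b)).toMonoidHom M
  let ev : T[X][X] →+* T[X] := evalRingHom 0
  have hev1 : ev.comp φ₁ = RingHom.id _ := by ext <;> simp [ev, φ₁]
  have hev2 : ev.comp φ₂ = RingHom.id _ := by ext <;> simp [ev, φ₂]
  have e1 : Units.map (ev.mapMatrix (m := Fin b)).toMonoidHom M₁ = M := by
    exact Units.ext (Matrix.ext fun i j => RingHom.congr_fun hev1 _)
  have e2 : Units.map (ev.mapMatrix (m := Fin b)).toMonoidHom M₂ = M := by
    exact Units.ext (Matrix.ext fun i j => RingHom.congr_fun hev2 _)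
  let G := M₁⁻¹ * M₂
  have eG : Units.map (ev.mapMatrix (m := Fin b)).toMonoidHom G = 1 := by
    rw [map_mul, map_inv, e1, e2, inv_mul_cancel]
  have eG' : Units.map (ev.mapMatrix (m := Fin b)).toMonoidHom G⁻¹ = 1 := by
    rw [map_inv, eG, inv_one]
  have hone : ∀ i j, (1 : Matrix (Fin b) (Fin b) T[X]) i j ∈ lifts (algebraMap R T) := by
    intro i j
    rw [Matrix.one_apply]
    split_ifs
    · exact one_mem _
    · exact zero_mem _
  have hG0 : ∀ i j, (G.1 i j).coeff 0 ∈ lifts (algebraMap R T) := by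
    intro i j
    rw [coeff_zero_eq_eval_zero]
    have := congrArg (fun N => N.1 i j) eG
    change eval 0 (G.1 i j) = (1 : Matrix (Fin b) (Fin b) T[X]) i j at this
    rw [this]; exact hone i j
  have hG0' : ∀ i j, ((G⁻¹).1 i j).coeff 0 ∈ lifts (algebraMap R T) := by
    intro i j
    rw [coeff_zero_eq_eval_zero]
    have := congrArg (fun N => N.1 i j) eG'
    change eval 0 ((G⁻¹).1 i j) = (1 : Matrix (Fin b) (Fin b) T[X]) i j at this
    rw [this]; exact hone i j
  obtain ⟨c₁, hc₁, h₁⟩ := lift_scaled_matrix p.primeCompl G.1 hG0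
  obtain ⟨c₂, hc₂, h₂⟩ := lift_scaled_matrix p.primeCompl (G⁻¹).1 hG0'
  obtain ⟨A, hA⟩ := h₁ c₂
  obtain ⟨A', hA'⟩ := h₂ c₁
  rw [mul_comm c₂ c₁] at hA'
  set c := c₁ * c₂ with hcdef
  let sc : T[X][X] →+* T[X][X] := compRingHom (C (C (algebraMap R T c)) * X)
  let Ψ : R[X][X] →+* T[X][X] := mapRingHom (mapRingHom (algebraMap R T))
  have hinj : Function.Injective (algebraMap R T) :=
    IsLocalization.injective T p.primeCompl_le_nonZeroDivisors
  have hΨ : Function.Injective Ψ := map_injective _ (map_injective _ hinj)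
  have hAA' : A * A' = 1 := by
    apply Matrix.map_injective hΨ
    change (A * A').map Ψ = (1 : Matrix _ _ _).map Ψ
    have h1 : (A * A').map Ψ = A.map Ψ * A'.map Ψ := Matrix.map_mul
    rw [h1]
    change A.map Ψ = G.1.map sc at hA
    change A'.map Ψ = (G⁻¹).1.map sc at hA'
    rw [hA, hA', ← Matrix.map_mul, ← Units.val_mul, mul_inv_cancel]
    simp
  -- f(x+cy)
  have hfx : ∀ i, Ψ (aeval (C X + c • X : R[X][X]) (f i)) = sc (φ₂ (F i)) := by
    intro i
    have : (Ψ : R[X][X] →+* T[X][X]).comp ((aeval (C X + c • X : R[X][X])) : R[X] →ₐ[R] R[X][X]).toRingHom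
      = (sc.comp φ₂).comp (mapRingHom (algebraMap R T)) := by
      ext
      · simp [Ψ, sc, φ₂]
      · simp [Ψ, sc, φ₂, Algebra.smul_def]
    exact RingHom.congr_fun this (f i)
  have hfx0 : ∀ i, Ψ (aeval (C X : R[X][X]) (f i)) = sc (φ₁ (F i)) := by
    intro i
    have : (Ψ : R[X][X] →+* T[X][X]).comp ((aeval (C X : R[X][X])) : R[X] →ₐ[R] R[X][X]).toRingHom
      = (sc.comp φ₁).comp (mapRingHom (algebraMap R T)) := by
      ext
      · simp [Ψ, sc, φ₁]
      · simp [Ψ, sc, φ₁]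
    exact RingHom.congr_fun this (f i)
  have hmv : ∀ (φ : T[X] →+* T[X][X]) , (φ.mapMatrix M.1).mulVec (fun i => φ (F i)) =
      fun i => φ (C ((F i).eval 0)) := by
    intro φ
    ext1 i
    have := congrFun hM i
    rw [← this]
    simp [Matrix.mulVec, dotProduct]
  have hcc : ∀ t : T, φ₁ (C t) = φ₂ (C t) := by intro t; simp [φ₁, φ₂]
  have hGF : G.1.mulVec (fun i => φ₂ (F i)) = fun i => φ₁ (F i) := by
    have h1 := hmv φ₁
    have h2 := hmv φ₂
    have h3 : (M₂.1).mulVec (fun i => φ₂ (F i)) = (M₁.1).mulVec (fun i => φ₁ (F i)) := by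
      change (φ₂.mapMatrix M.1).mulVec _ = (φ₁.mapMatrix M.1).mulVec _
      rw [h1, h2]
      ext1 i
      rw [hcc]
    change (M₁⁻¹.1 * M₂.1).mulVec _ = _
    rw [← Matrix.mulVec_mulVec, h3, Matrix.mulVec_mulVec, Units.inv_mul, Matrix.one_mulVec]
  have hAF : A.mulVec (fun i => aeval (C X + c • X : R[X][X]) (f i)) =
      fun i => aeval (C X : R[X][X]) (f i) := by
    ext1 i
    apply hΨ
    rw [hfx0]
    have := congrArg sc (congrFun hGF i)
    rw [← this]
    simp only [Matrix.mulVec, dotProduct, map_sum, map_mul, hfx]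
    refine Finset.sum_congr rfl fun j _ => ?_
    congr 1
    exact congrFun (congrFun hA i) j
  refine ⟨c, mul_mem hc₁ hc₂, ?_⟩
  intro B _ _ x y
  have hrel : VRel _ _ := VRel.of_inv A A' hAA' hAF
  let θ : R[X][X] →ₐ[R] B :=
    { eval₂RingHom (aeval x : R[X] →ₐ[R] B).toRingHom y with
      commutes' := fun r => by
        change eval₂ _ _ (C (C r)) = _
        simp }
  have hθ1 : θ (C X) = x := by
    change eval₂ _ _ (C X) = _
    simp
  have hθ2 : θ X = y := by
    change eval₂ _ _ X = _
    simp
  have := hrel.map θ.toRingHom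
  convert this using 1
  · ext1 i
    change _ = θ _
    rw [← aeval_algHom_apply, map_add, map_smul, hθ1, hθ2]
  · ext1 i
    change _ = θ _
    rw [← aeval_algHom_apply, hθ1]

end patch
end partB2

section partB3
section QS
open Polynomial

lemma uni_step {A : Type} [CommRing A] [IsDomain A] {b : ℕ} (hb : 3 ≤ b)
    (ih : ∀ f : Fin b → A, Uni f → ∃ i, VRel f (Pi.single i 1))
    (g : Fin b → A[X]) (hgU : Uni g) (i : Fin b) (hgm : (g i).Monic) :
    ∃ j, VRel g (Pi.single j 1) := by
  have hloc : VRel g (fun k => C ((g k).eval 0)) := by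
    apply patch_of_top
    by_contra hne
    obtain ⟨p, hp, hle⟩ := Ideal.exists_le_maximal _ hne
    have := hp.isPrime
    let T := Localization.AtPrime p
    let φ := mapRingHom (algebraMap A T)
    have h1 : Uni (fun k => φ (g k)) := hgU.map φ
    obtain ⟨j, hj⟩ := horrocks (R := T) hb _ (fun k => φ (g k)) h1 ⟨i, hgm.map _, rfl⟩
    have h2 := (hj.map (evalRingHom (0 : T))).map (C : T →+* T[X])
    have h3 : (fun k => C (evalRingHom (0 : T) ((Pi.single j 1 : Fin b → T[X]) k))) =
        (Pi.single j 1 : Fin b → T[X]) := by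
      ext1 k
      by_cases h : k = j
      · subst h; simp
      · simp [h]
    rw [h3] at h2
    obtain ⟨c, hc, hc'⟩ := patch_local g p (hj.trans h2.symm)
    exact hc (hle hc')
  obtain ⟨j, hj⟩ := ih (fun k => (g k).eval 0) (hgU.map (evalRingHom (0 : A)))
  have h2 := hj.map (C : A →+* A[X])
  refine ⟨j, ?_⟩
  convert hloc.trans h2 using 1
  ext1 k
  by_cases h : k = j
  · subst h; simp
  · simp [h]

theorem quillen_suslin_uni (K : Type) [Field K] (n : ℕ) : ∀ {b : ℕ} (_ : 3 ≤ b)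
    (f : Fin b → MvPolynomial (Fin n) K) (_ : Uni f), ∃ i, VRel f (Pi.single i 1) := by
  induction n with
  | zero =>
    intro b hb f ⟨c, hc⟩
    have : ∃ i, f i ≠ 0 := by
      by_contra h
      push Not at h
      simp [h] at hc
    obtain ⟨i, hi⟩ := this
    refine ⟨i, VRel.of_isUnit f i ?_⟩
    have e := MvPolynomial.isEmptyAlgEquiv K (Fin 0)
    rw [← MulEquiv.isUnit_map e]
    exact (IsUnit.mk0 _ (by simpa using hi))
  | succ n ih =>
    intro b hb f hf
    have : ∃ i, f i ≠ 0 := by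
      by_contra h
      push Not at h
      obtain ⟨c, hc⟩ := hf
      simp [h] at hc
    obtain ⟨i, hi⟩ := this
    obtain ⟨e, he⟩ := exists_monic_change K n (f i) hi
    obtain ⟨u, hu⟩ := he
    set A := MvPolynomial (Fin n) K
    let v : A[X]ˣ := Units.map (C : A →+* A[X]).toMonoidHom u⁻¹
    have hv : (v : A[X]) = C ((u⁻¹ : Aˣ) : A) := rfl
    let g : Fin b → A[X] := fun k => v * e (f k)
    have hfg : VRel (fun k => e (f k)) g := VRel.unit_smul _ v
    have hgU : Uni g := (hf.map (e.toRingHom)).rel hfg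
    have hgm : (g i).Monic := by
      change (_ * _ : A[X]).leadingCoeff = 1
      rw [hv, leadingCoeff_mul, leadingCoeff_C, ← hu, Units.inv_mul]
    obtain ⟨j, hj⟩ := uni_step hb (ih hb) g hgU i hgm
    have h3 := (hfg.trans hj).map e.symm.toRingHom
    refine ⟨j, ?_⟩
    convert h3 using 1
    · ext1 k; simp
    · ext1 k
      by_cases h : k = j
      · subst h; simp
      · simp [h]

lemma cancel_one {R : Type} [CommRing R] {M : Type} [AddCommGroup M] [Module R M] {b : ℕ}
    (e : (M × R) ≃ₗ[R] (Fin b → R))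
    (h : ∀ f : Fin b → R, Uni f → ∃ i, VRel f (Pi.single i 1)) : 
    ∃ b', Nonempty (M ≃ₗ[R] (Fin b' → R)) := by
  let f := e (0, 1)
  have hf : Uni f := by
    let l : (Fin b → R) →ₗ[R] R := (LinearMap.snd R M R).comp e.symm.toLinearMap
    have hl : l f = 1 := by simp [l, f]
    refine ⟨fun i => l (Pi.single i 1), ?_⟩
    refine Eq.trans ?_ hl
    rw [LinearMap.pi_apply_eq_sum_univ l f]
    refine Finset.sum_congr rfl fun i _ => ?_
    rw [smul_eq_mul, mul_comm]
    have : (Pi.single i 1 : Fin b → R) = fun j => if i = j then 1 else 0 := by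
      funext j
      by_cases h : i = j
      · subst h; simp
      · simp [h, Ne.symm h]
    simp only [this]
  obtain ⟨i, A, hA⟩ := h f hf
  let a : (Fin b → R) ≃ₗ[R] (Fin b → R) := 
    LinearEquiv.ofLinearMap (Matrix.toLin' A.1) (Matrix.toLin' (A⁻¹).1)
      (by rw [← Matrix.toLin'_mul]; simp) (by rw [← Matrix.toLin'_mul]; simp)
  have ha : a f = Pi.single i 1 := hA
  let e' := e.trans a
  have he' : ∀ r : R, e' (0, r) = Pi.single i r := by
    intro r
    have : ((0, r) : M × R) = r • (0, 1) := by simp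
    rw [this, map_smul]
    change r • a f = _
    rw [ha]
    ext k
    by_cases h : k = i
    · subst h; simp
    · simp [h]
  -- M ≃ functions vanishing at i
  let g : M →ₗ[R] ({k : Fin b // k ≠ i} → R) :=
    (LinearMap.funLeft R R (Subtype.val)).comp (e'.toLinearMap.comp (LinearMap.inl R M R))
  have hg : Function.Bijective g := by
    constructor
    · rw [injective_iff_map_eq_zero]
      intro m hm
      have h1 : e' (m, 0) = e' (0, e' (m, 0) i) := by
        rw [he']
        ext k
        by_cases h : k = i
        · subst h; simp
        · have := congrFun hm ⟨k, h⟩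
          simp only [h, Pi.single_eq_of_ne, ne_eq, not_false_eq_true]
          exact this
      have h2 := e'.injective h1
      exact congrArg Prod.fst h2
    · intro w
      let w' : Fin b → R := fun k => if h : k ≠ i then w ⟨k, h⟩ else 0
      refine ⟨(e'.symm w').1, ?_⟩
      ext ⟨k, hk⟩
      have h1 : (((e'.symm w').1, 0) : M × R) = e'.symm w' - (0, (e'.symm w').2) := by
        ext <;> simp
      change e' ((e'.symm w').1, 0) k = _
      rw [h1, map_sub, he', e'.apply_symm_apply]
      simp [w', hk]
  obtain ⟨b', ⟨s⟩⟩ : ∃ b', Nonempty ({k : Fin b // k ≠ i} ≃ Fin b') := ⟨_, ⟨Fintype.equivFin _⟩⟩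
  exact ⟨b', ⟨(LinearEquiv.ofBijective g hg).trans (LinearEquiv.funCongrLeft R R s.symm)⟩⟩

theorem free_of_projective_rank_two (K : Type) [Field K] (n : ℕ) (M : Type) [AddCommGroup M]
    [Module (MvPolynomial (Fin n) K) M] [Module.Finite (MvPolynomial (Fin n) K) M]
    [Module.Projective (MvPolynomial (Fin n) K) M] 
    (i : (Fin 2 → MvPolynomial (Fin n) K) →ₗ[MvPolynomial (Fin n) K] M)
    (hi : Function.Injective i) : Module.Free (MvPolynomial (Fin n) K) M := by
  set R := MvPolynomial (Fin n) K
  obtain ⟨a, b, ⟨e⟩⟩ := FR.stablyFree (GLD.mvPolynomial K n M inferInstance) inferInstance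
  induction a generalizing b with
  | zero =>
    let e0 : M ≃ₗ[R] M × (Fin 0 → R) := 
      LinearEquiv.ofLinearMap (LinearMap.inl R M (Fin 0 → R)) (LinearMap.fst R M (Fin 0 → R)) 
        (by
          refine LinearMap.ext fun x => Prod.ext rfl (Subsingleton.elim _ _))
        (by ext; simp)
    exact Module.Free.of_equiv (e0.trans e).symm
  | succ a ih =>
    let s : ((Fin (a+1)) → R) ≃ₗ[R] (Fin a → R) × R := 
      (Fin.consLinearEquiv R (fun _ : Fin (a+1) => R)).symm.trans (LinearEquiv.prodComm R _ _)
    let e1 : ((M × (Fin a → R)) × R) ≃ₗ[R] (Fin b → R) :=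
      (LinearEquiv.prodAssoc R M (Fin a → R) R).trans
        ((LinearEquiv.prodCongr (LinearEquiv.refl R M) s.symm).trans e)
    have hb : 3 ≤ b := by
      let j : ((Fin 2 → R) × (Fin (a+1) → R)) →ₗ[R] (Fin b → R) := 
        e.toLinearMap.comp (LinearMap.prodMap i LinearMap.id)
      have hj : Function.Injective j := 
        e.injective.comp (Function.Injective.prodMap hi Function.injective_id)
      let t : (Fin 2 ⊕ Fin (a+1) → R) ≃ₗ[R] (Fin 2 → R) × (Fin (a+1) → R) :=
        LinearEquiv.sumArrowLequivProdArrow _ _ R R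
      have := card_le_of_injective R (j.comp t.toLinearMap) (hj.comp t.injective)
      simp at this
      omega
    obtain ⟨b', ⟨e'⟩⟩ := cancel_one e1 (fun f hf => quillen_suslin_uni K n hb f hf)
    exact ih b' e'
end QS
end partB3

section partD1
section LCdef
open CategoryTheory.Abelian

variable {R : Type} [CommRing R]

/-- a short exact sequence of modules -/
structure SES {R : Type} [CommRing R] {A B C : Type} [AddCommGroup A] [AddCommGroup B] [AddCommGroup C]
    [Module R A] [Module R B] [Module R C] (f : A →ₗ[R] B) (g : B →ₗ[R] C) : Prop where
  inj : Function.Injective f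
  exact : Function.Exact f g
  surj : Function.Surjective g

variable {A B C : Type} [AddCommGroup A] [AddCommGroup B] [AddCommGroup C]
  [Module R A] [Module R B] [Module R C] {f : A →ₗ[R] B} {g : B →ₗ[R] C}

lemma SES.zero (h : SES f g) : ModuleCat.ofHom f ≫ ModuleCat.ofHom g = 0 := by
  rw [← ModuleCat.ofHom_comp, h.exact.linearMap_comp_eq_zero]; rfl

lemma SES.shortExact (h : SES f g) :
    (ShortComplex.mk (ModuleCat.ofHom f) (ModuleCat.ofHom g) h.zero).ShortExact := 
  ModuleCat.shortComplex_shortExact _ h.exact h.inj h.surj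

/-- transition maps -/
def qmap (I : Ideal R) {t t' : ℕ} (h : t ≤ t') : (R ⧸ I ^ t') →ₗ[R] (R ⧸ I ^ t) :=
  Submodule.mapQ _ _ LinearMap.id (Ideal.pow_le_pow_right h)

/-- pull back of classes -/
noncomputable def pb (I : Ideal R) {t t' : ℕ} (h : t ≤ t') {M : Type} [AddCommGroup M] [Module R M] {i : ℕ}
    (α : Ext (ModuleCat.of R (R ⧸ I ^ t)) (ModuleCat.of R M) i) :
    Ext (ModuleCat.of R (R ⧸ I ^ t')) (ModuleCat.of R M) i :=
  (Ext.mk₀ (ModuleCat.ofHom (qmap I h))).comp α (zero_add i)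

lemma qmap_comp (I : Ideal R) {t t' t'' : ℕ} (h : t ≤ t') (h' : t' ≤ t'') :
    (qmap I h).comp (qmap I h') = qmap I (h.trans h') := by
  refine LinearMap.ext fun x => ?_
  obtain ⟨x, rfl⟩ := Submodule.Quotient.mk_surjective _ x
  rfl

lemma pb_pb (I : Ideal R) {t t' t'' : ℕ} (h : t ≤ t') (h' : t' ≤ t'') {M : Type} [AddCommGroup M] [Module R M]
    {i : ℕ} (α : Ext (ModuleCat.of R (R ⧸ I ^ t)) (ModuleCat.of R M) i) :
    pb I h' (pb I h α) = pb I (h.trans h') α := by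
  unfold pb
  rw [Ext.mk₀_comp_mk₀_assoc, ← ModuleCat.ofHom_comp, qmap_comp]

lemma pb_zero (I : Ideal R) {t t' : ℕ} (h : t ≤ t') {M : Type} [AddCommGroup M] [Module R M] {i : ℕ} :
    pb I h (0 : Ext (ModuleCat.of R (R ⧸ I ^ t)) (ModuleCat.of R M) i) = 0 := by
  simp [pb]

lemma pb_comp (I : Ideal R) {t t' : ℕ} (h : t ≤ t') {M N : Type} [AddCommGroup M] [Module R M] 
    [AddCommGroup N] [Module R N] {i j k : ℕ}
    (α : Ext (ModuleCat.of R (R ⧸ I ^ t)) (ModuleCat.of R M) i)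
    (β : Ext (ModuleCat.of R M) (ModuleCat.of R N) j) (hk : i + j = k) :
    pb I h (α.comp β hk) = (pb I h α).comp β hk := by
  unfold pb
  rw [Ext.comp_assoc _ _ _ (zero_add i) hk (by omega)]

/-- vanishing of local cohomology, elementwise -/
def LC (I : Ideal R) (i : ℕ) (M : Type) [AddCommGroup M] [Module R M] : Prop :=
  ∀ (t : ℕ) (α : Ext (ModuleCat.of R (R ⧸ I ^ t)) (ModuleCat.of R M) i),
    ∃ (t' : ℕ) (h : t ≤ t'), pb I h α = 0

variable (I : Ideal R)

lemma LC.mid (h : SES f g) {i : ℕ} (hA : LC I i A) (hC : LC I i C) : LC I i B := by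
  intro t β
  obtain ⟨t', ht, h1⟩ := hC t (β.comp (Ext.mk₀ (ModuleCat.ofHom g)) (add_zero i))
  rw [pb_comp] at h1
  obtain ⟨α, hα⟩ := Ext.covariant_sequence_exact₂ _ h.shortExact _ h1
  obtain ⟨t'', ht', h2⟩ := hA t' α
  refine ⟨t'', ht.trans ht', ?_⟩
  rw [← pb_pb I ht ht', ← hα]
  exact (pb_comp I ht' α _ _).trans (by rw [h2, Ext.zero_comp])

lemma LC.right (h : SES f g) {i : ℕ} (hB : LC I i B) (hA : LC I (i+1) A) : LC I i C := by
  intro t γ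
  obtain ⟨t', ht, h1⟩ := hA t (γ.comp h.shortExact.extClass rfl)
  have h1' : (pb I ht γ).comp h.shortExact.extClass rfl = 0 := by
    rw [← h1]; exact (pb_comp I ht γ _ _).symm
  obtain ⟨β, hβ⟩ := Ext.covariant_sequence_exact₃ _ h.shortExact _ _ h1'
  obtain ⟨t'', ht', h2⟩ := hB t' β
  refine ⟨t'', ht.trans ht', ?_⟩
  rw [← pb_pb I ht ht', ← hβ]
  exact (pb_comp I ht' β _ _).trans (by rw [h2, Ext.zero_comp])

lemma LC.left (h : SES f g) {i : ℕ} (hC : LC I i C) (hB : LC I (i+1) B) : LC I (i+1) A := by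
  intro t α
  obtain ⟨t', ht, h1⟩ := hB t (α.comp (Ext.mk₀ (ModuleCat.ofHom f)) (add_zero _))
  rw [pb_comp] at h1
  obtain ⟨γ, hγ⟩ := Ext.covariant_sequence_exact₁ _ h.shortExact _ h1 rfl
  obtain ⟨t'', ht', h2⟩ := hC t' γ
  refine ⟨t'', ht.trans ht', ?_⟩
  rw [← pb_pb I ht ht', ← hγ]
  exact (pb_comp I ht' γ _ _).trans (by rw [h2, Ext.zero_comp])

lemma LC.retract {i : ℕ} (f : A →ₗ[R] B) (g : B →ₗ[R] A) (h : g.comp f = LinearMap.id) (hB : LC I i B) :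
    LC I i A := by
  intro t α
  obtain ⟨t', ht, h1⟩ := hB t (α.comp (Ext.mk₀ (ModuleCat.ofHom f)) (add_zero _))
  refine ⟨t', ht, ?_⟩
  have : pb I ht α = ((pb I ht α).comp (Ext.mk₀ (ModuleCat.ofHom f)) (add_zero _)).comp
      (Ext.mk₀ (ModuleCat.ofHom g)) (add_zero _) := by
    rw [Ext.comp_assoc_of_second_deg_zero, Ext.mk₀_comp_mk₀, ← ModuleCat.ofHom_comp, h]
    exact (Ext.comp_mk₀_id _).symm
  rw [this, ← pb_comp, h1, Ext.zero_comp]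

lemma LC.iso {i : ℕ} (e : A ≃ₗ[R] B) (hB : LC I i B) : LC I i A :=
  hB.retract I e.toLinearMap e.symm.toLinearMap (by ext; simp)

/-- Torsion elements -/
lemma LC.zero_iff : LC I 0 A ↔ ∀ (c : ℕ) (a : A), (∀ r ∈ I ^ c, r • a = 0) → a = 0 := by
  constructor
  · intro h c a ha
    let φ : (R ⧸ I ^ c) →ₗ[R] A := Submodule.liftQ _ (LinearMap.toSpanSingleton R A a) (by
      intro r hr; simpa using ha r hr)
    obtain ⟨t', ht, h1⟩ := h c (Ext.mk₀ (ModuleCat.ofHom φ))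
    unfold pb at h1
    rw [Ext.mk₀_comp_mk₀, Ext.mk₀_eq_zero_iff, ← ModuleCat.ofHom_comp] at h1
    have h2 : φ.comp (qmap I ht) = 0 := by simpa using congrArg ModuleCat.Hom.hom h1
    have h3 := LinearMap.congr_fun h2 (Submodule.Quotient.mk 1)
    have h4 : φ (qmap I ht (Submodule.Quotient.mk 1)) = (1 : R) • a := rfl
    rw [one_smul] at h4
    rw [← h4]; exact h3
  · intro h t α
    obtain ⟨φ, rfl⟩ := (Ext.mk₀_bijective _ _).2 α
    refine ⟨t, le_rfl, ?_⟩
    have : φ = 0 := by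
      refine ModuleCat.hom_ext (LinearMap.ext fun x => ?_)
      obtain ⟨x, rfl⟩ := Submodule.Quotient.mk_surjective _ x
      refine h t _ fun r hr => ?_
      rw [← map_smul, ← map_zero φ.hom]
      congr 1
      rw [← Submodule.Quotient.mk_smul, Submodule.Quotient.mk_eq_zero]
      exact Ideal.mul_mem_right _ _ hr
    rw [this, Ext.mk₀_zero, pb_zero]

lemma LC.zero_of_inj (f : A →ₗ[R] B) (hf : Function.Injective f) (hB : LC I 0 B) : 
    LC I 0 A := by
  rw [LC.zero_iff] at hB ⊢
  intro c a ha
  apply hf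
  rw [map_zero]
  exact hB c (f a) fun r hr => by rw [← map_smul, ha r hr, map_zero]

end LCdef
end partD1

section partD2
section conv
open CategoryTheory.Abelian Limits Opposite

variable {R : Type} [CommRing R]

lemma op_class_exists (K : ChainComplex (ModuleCat.{0} R)ᵒᵖ ℕ) (n : ℕ) (f : (K.X n).unop)
    (hf : (K.d (n+1) n).unop f = 0) : ∃ c : (K.opcycles n).unop, (K.pOpcycles n).unop c = f := by
  have h := (ShortComplex.exact_of_g_is_cokernel
    (ShortComplex.mk (K.d (n+1) n) (K.pOpcycles n) (K.d_pOpcycles _ _))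
    (K.opcyclesIsCokernel (n+1) n (by simp))).unop
  rw [ShortComplex.moduleCat_exact_iff] at h
  exact h f hf

lemma op_zero (K : ChainComplex (ModuleCat.{0} R)ᵒᵖ ℕ) (n : ℕ) (c : (K.opcycles n).unop)
    (hc : (K.homologyι n).unop c = 0) :
    ∃ g : (K.X ((ComplexShape.down ℕ).next n)).unop, (K.fromOpcycles n _).unop g = c := by
  have h := (ShortComplex.exact_of_f_is_kernel
    (ShortComplex.mk (K.homologyι n) (K.fromOpcycles n _) (K.homologyι_comp_fromOpcycles n _))
    (K.homologyIsKernel n _ rfl)).unop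
  rw [ShortComplex.moduleCat_exact_iff] at h
  exact h c hc

lemma colim_dies (I : Ideal R) (i : ℕ) (M : Type) [AddCommGroup M] [Module R M]
    (h : Subsingleton ((localCohomology I i).obj (ModuleCat.of R M))) (t : ℕ)
    (x : ((_root_.Ext R (ModuleCat.{0} R) i).obj (op (ModuleCat.of R (R ⧸ I ^ t)))).obj (ModuleCat.of R M)) :
    ∃ (t' : ℕ) (h : t ≤ t'), ((_root_.Ext R (ModuleCat.{0} R) i).map
      (ModuleCat.ofHom (qmap I h)).op).app (ModuleCat.of R M) x = 0 := by
  let F := localCohomology.diagram (localCohomology.idealPowersDiagram I) i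
  have : HasColimit F := localCohomology.hasColimitDiagram.{0,0} _ i
  let ev := (evaluation (ModuleCat.{0} R) (ModuleCat.{0} R)).obj (ModuleCat.of R M)
  have hc : IsColimit (ev.mapCocone (colimit.cocone F)) := isColimitOfPreserves ev (colimit.isColimit F)
  have key := Concrete.isColimit_exists_of_rep_eq (F ⋙ ev) hc (i := op (op t)) (j := op (op t)) x 0
    (by
      have : Subsingleton ((ev.mapCocone (colimit.cocone F)).pt) := h
      exact this.elim _ _)
  obtain ⟨k, f, g, hfg⟩ := key
  refine ⟨k.unop.unop, f.unop.unop.down.down, ?_⟩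
  refine (show _ from hfg).trans (map_zero ((F ⋙ ev).map g).hom)

theorem LC.of_localCohomology (I : Ideal R) (i : ℕ) (M : Type) [AddCommGroup M] [Module R M]
    (h : Subsingleton ((localCohomology I i).obj (ModuleCat.of R M))) : LC I i M := by
  intro t α
  let X := ModuleCat.of R (R ⧸ I ^ t)
  let Y := ModuleCat.of R M
  let Q := projectiveResolution X
  obtain ⟨f, hf, rfl⟩ := Q.extMk_surjective α (i+1) rfl
  let F := ((linearYoneda R (ModuleCat.{0} R)).obj Y).rightOp
  let K := (F.mapHomologicalComplex (ComplexShape.down ℕ)).obj Q.complex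
  obtain ⟨c, hc⟩ := op_class_exists K i f hf
  let x := (Q.isoLeftDerivedObj F i).hom.unop ((K.homologyι i).unop c)
  obtain ⟨t', ht, hx⟩ := colim_dies I i M h t x
  refine ⟨t', ht, ?_⟩
  let X' := ModuleCat.of R (R ⧸ I ^ t')
  let q : X' ⟶ X := ModuleCat.ofHom (qmap I ht)
  let P := projectiveResolution X'
  let φ : P.complex ⟶ Q.complex := ProjectiveResolution.lift q P Q
  have hφ : φ ≫ Q.π = P.π ≫ (ChainComplex.single₀ _).map q := ProjectiveResolution.lift_commutes q P Q
  have hφ0 : φ.f 0 ≫ Q.π.f 0 = P.π.f 0 ≫ q := ProjectiveResolution.lift_commutes_zero q P Q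
  let K' := (F.mapHomologicalComplex (ComplexShape.down ℕ)).obj P.complex
  let ψ : K' ⟶ K := (F.mapHomologicalComplex (ComplexShape.down ℕ)).map φ
  have nat := ProjectiveResolution.isoLeftDerivedObj_hom_naturality q P Q φ hφ0 F i
  have hx' : ((F.leftDerived i).map q).unop x = 0 := hx
  have h1 : (HomologicalComplex.homologyMap ψ i ≫ K.homologyι i).unop c = 0 := by
    have : (P.isoLeftDerivedObj F i).hom.unop
        ((HomologicalComplex.homologyMap ψ i ≫ K.homologyι i).unop c) = 0 := by
      rw [← hx']
      have := congrArg (fun w => (w ≫ K.homologyι i).unop c) nat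
      exact this.symm
    have h2 := congrArg ((P.isoLeftDerivedObj F i).inv.unop) this
    have h5 : ∀ y, (P.isoLeftDerivedObj F i).inv.unop ((P.isoLeftDerivedObj F i).hom.unop y) = y := fun y =>
      congrArg (fun w : _ ⟶ _ => (ConcreteCategory.hom (Quiver.Hom.unop w)) y) (P.isoLeftDerivedObj F i).inv_hom_id
    exact (h5 _).symm.trans (h2.trans (map_zero _))
  rw [HomologicalComplex.homologyι_naturality] at h1
  obtain ⟨g, hg⟩ := op_zero K' i ((HomologicalComplex.opcyclesMap ψ i).unop c) h1
  have h3 : (K'.d i _).unop g = (ψ.f i).unop f := by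
    have e1 : (K'.pOpcycles i).unop ((K'.fromOpcycles i ((ComplexShape.down ℕ).next i)).unop g) =
      (K'.d i _).unop g := by
      rw [← ModuleCat.comp_apply, ← unop_comp, HomologicalComplex.p_fromOpcycles]
    rw [← e1, hg, ← ModuleCat.comp_apply, ← unop_comp, HomologicalComplex.p_opcyclesMap, ← hc]
    rfl
  have h4 : P.complex.d i _ ≫ g = φ.f i ≫ f := h3
  unfold pb
  rw [ProjectiveResolution.mk₀_comp_extMk (R := Q) (R' := P) f (i+1) rfl hf (g := q) ⟨φ, HomologicalComplex.congr_hom hφ 0⟩]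
  rcases i with _ | i
  · have : φ.f 0 ≫ f = 0 := by
      rw [← h4]
      rw [P.complex.shape]
      · exact Limits.zero_comp
      · simp
    simp [this]
  · rw [ProjectiveResolution.extMk_eq_zero_iff _ _ _ _ _ i rfl]
    have : (ComplexShape.down ℕ).next (i+1) = i := by simp
    rw [← h4]
    revert g
    rw [this]
    intro g _ _ _ 
    exact ⟨g, rfl⟩
end conv
end partD2

section partD3
section rees
open CategoryTheory.Abelian RingTheory.Sequence

lemma X_list_regular (K : Type) [Field K] (n : ℕ) :
    IsRegular (MvPolynomial (Fin n) K) (List.ofFn (fun i : Fin n => (MvPolynomial.X i : MvPolynomial (Fin n) K))) := by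
  classical
  have hof : ∀ k : ℕ, Ideal.ofList ((List.ofFn (fun i : Fin n => (MvPolynomial.X i : MvPolynomial (Fin n) K))).take k) =
      Ideal.span (Set.image MvPolynomial.X {i : Fin n | (i : ℕ) < k}) := by
    intro k
    unfold Ideal.ofList
    congr 1
    ext r
    simp only [Set.mem_ofPred_eq, List.mem_take_iff_getElem, Set.mem_image]
    constructor
    · rintro ⟨i, hi, rfl⟩
      simp at hi
      exact ⟨⟨i, hi.2⟩, hi.1, by simp⟩
    · rintro ⟨i, hi, rfl⟩
      exact ⟨i, by simpa using hi, by simp⟩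
  refine ⟨⟨?_⟩, ?_⟩
  · intro i hi
    have hin : i < n := by simpa using hi
    rw [isSMulRegular_iff_right_eq_zero_of_smul]
    intro x hx
    obtain ⟨x, rfl⟩ := Submodule.Quotient.mk_surjective _ x
    rw [← Submodule.Quotient.mk_smul, Submodule.Quotient.mk_eq_zero] at hx
    rw [Submodule.Quotient.mk_eq_zero]
    simp only [List.getElem_ofFn] at hx
    rw [hof] at hx ⊢
    rw [smul_eq_mul, Ideal.mul_top, MvPolynomial.mem_ideal_span_X_image] at hx ⊢
    intro m hm
    obtain ⟨j, hj, hj'⟩ := hx (m + Finsupp.single ⟨i, hin⟩ 1) (by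
      rw [MvPolynomial.mem_support_iff] at hm ⊢
      rw [smul_eq_mul, add_comm, MvPolynomial.coeff_X_mul]
      exact hm)
    refine ⟨j, hj, ?_⟩
    have : j ≠ ⟨i, hin⟩ := by
      rintro rfl
      simp at hj
    simpa [Finsupp.single_apply, this.symm] using hj'
  · intro h
    have h1 : (1 : MvPolynomial (Fin n) K) ∈ Ideal.span (Set.image MvPolynomial.X {i : Fin n | (i : ℕ) < n}) := by
      rw [← hof, List.take_of_length_le (by simp)]
      have := h ▸ (Submodule.mem_top : (1 : MvPolynomial (Fin n) K) ∈ (⊤ : Submodule _ _))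
      simpa using this
    rw [MvPolynomial.mem_ideal_span_X_image] at h1
    obtain ⟨i, _, hi⟩ := h1 0 (by simp)
    simp at hi

/-- vanishing Ext -/
def ExtZ (R : Type) [CommRing R] (j : ℕ) (M N : Type) [AddCommGroup M] [Module R M] [AddCommGroup N] [Module R N] : Prop :=
  Subsingleton (Ext (ModuleCat.of R M) (ModuleCat.of R N) j)

theorem extZ_torsion (K : Type) [Field K] (n : ℕ) (N : Type) [AddCommGroup N] [Module (MvPolynomial (Fin n) K) N]
    [Module.Finite (MvPolynomial (Fin n) K) N] (c : ℕ)
    (hc : ∀ r ∈ (Ideal.span (Set.range (MvPolynomial.X : Fin n → MvPolynomial (Fin n) K)))^c, ∀ a : N, r • a = 0)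
    (j : ℕ) (hj : j < n) : ExtZ (MvPolynomial (Fin n) K) j N (MvPolynomial (Fin n) K) := by
  have hreg := X_list_regular K n
  set I := Ideal.span (Set.range (MvPolynomial.X : Fin n → MvPolynomial (Fin n) K)) with hI
  have hfin : Module.Finite (MvPolynomial (Fin n) K) (ModuleCat.of (MvPolynomial (Fin n) K) N) := by assumption
  have hfin' : Module.Finite (MvPolynomial (Fin n) K) (ModuleCat.of (MvPolynomial (Fin n) K) (MvPolynomial (Fin n) K)) :=
    (inferInstance : Module.Finite (MvPolynomial (Fin n) K) (MvPolynomial (Fin n) K))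
  refine ModuleCat.subsingleton_ext_of_exists_isRegular I (ModuleCat.of _ N) ?_
    (ModuleCat.of _ (MvPolynomial (Fin n) K)) ?_ _ ?_ hreg j (by simpa using hj)
  · intro p hp
    rw [Module.mem_support_iff_exists_annihilator] at hp
    obtain ⟨m, hm⟩ := hp
    rw [PrimeSpectrum.mem_zeroLocus, SetLike.coe_subset_coe]
    rw [← p.2.pow_le_iff (n := c + 1) (by simp)]
    intro r hr
    refine hm ?_
    rw [Submodule.mem_annihilator_span_singleton]
    exact hc r (Ideal.pow_le_pow_right (by simp) hr) m
  · rw [lt_top_iff_ne_top]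
    intro h
    apply hreg.2
    refine h.symm.trans ?_
    congr 1
    rw [hI, Ideal.ofList]
    congr 1
    ext r
    simp
  · intro r hr
    simp at hr
    obtain ⟨i, rfl⟩ := hr
    exact Ideal.subset_span ⟨i, rfl⟩

theorem LC.ring (K : Type) [Field K] (n : ℕ) (i : ℕ) (hi : i < n) :
    LC (Ideal.span (Set.range (MvPolynomial.X : Fin n → MvPolynomial (Fin n) K))) i (MvPolynomial (Fin n) K) := by
  intro t α
  refine ⟨t, le_rfl, ?_⟩
  have := extZ_torsion K n (MvPolynomial (Fin n) K ⧸ (Ideal.span (Set.range (MvPolynomial.X : Fin n → MvPolynomial (Fin n) K)))^t)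
    t (by
      intro r hr a
      obtain ⟨a, rfl⟩ := Submodule.Quotient.mk_surjective _ a
      rw [← Submodule.Quotient.mk_smul, Submodule.Quotient.mk_eq_zero]
      exact Ideal.mul_mem_right _ _ hr) i hi
  have h2 : α = 0 := this.elim _ _
  rw [h2, pb_zero]
end rees
end partD3

section partD4
section gammaSec
open CategoryTheory.Abelian

variable {R : Type} [CommRing R] (I : Ideal R)

/-- every element is killed by a power of `I` -/
def PT (N : Type) [AddCommGroup N] [Module R N] : Prop := ∀ a : N, ∃ c : ℕ, ∀ r ∈ I ^ c, r • a = 0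

/-- power torsion submodule -/
def gam (N : Type) [AddCommGroup N] [Module R N] : Submodule R N where
  carrier := {a | ∃ c : ℕ, ∀ r ∈ I ^ c, r • a = 0}
  zero_mem' := ⟨0, by simp⟩
  add_mem' := by
    rintro a b ⟨c, hc⟩ ⟨d, hd⟩
    refine ⟨max c d, fun r hr => ?_⟩
    rw [smul_add, hc r (Ideal.pow_le_pow_right (le_max_left _ _) hr),
      hd r (Ideal.pow_le_pow_right (le_max_right _ _) hr), add_zero]
  smul_mem' := by
    rintro s a ⟨c, hc⟩
    exact ⟨c, fun r hr => by rw [smul_comm, hc r hr, smul_zero]⟩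

variable {I} in
lemma PT.uniform {N : Type} [AddCommGroup N] [Module R N] [Module.Finite R N] (h : PT I N) :
    ∃ c : ℕ, ∀ r ∈ I ^ c, ∀ a : N, r • a = 0 := by
  obtain ⟨s, hs⟩ := Module.Finite.fg_top (R := R) (M := N)
  choose c hc using h
  refine ⟨s.sup c, fun r hr a => ?_⟩
  have : a ∈ Submodule.span R (s : Set N) := hs ▸ Submodule.mem_top
  induction this using Submodule.span_induction with
  | mem x hx => exact hc x r (Ideal.pow_le_pow_right (Finset.le_sup hx) hr)
  | zero => simp
  | add x y _ _ hx hy => rw [smul_add, hx, hy, add_zero]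
  | smul t x _ hx => rw [smul_comm, hx, smul_zero]

lemma gam_injective [IsNoetherianRing R] (Q : Type) [AddCommGroup Q] [Module R Q] [hQ : Module.Injective R Q] :
    Module.Injective R (gam I Q) := by
  refine Module.Baer.injective ?_
  intro J g
  have hpt : PT I (LinearMap.range g) := by
    rintro ⟨a, ha⟩
    obtain ⟨c, hc⟩ := a.2
    exact ⟨c, fun r hr => Subtype.ext (Subtype.ext (hc r hr))⟩
  obtain ⟨c, hc⟩ := hpt.uniform
  obtain ⟨k, hk⟩ := Ideal.exists_pow_inf_eq_pow_smul I (M := R) J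
  have hk := hk (k + c) (by omega)
  have hle : ∀ x : J, (x : R) ∈ I ^ (k + c) → g x = 0 := by
    intro x hx
    have h1 : (x : R) ∈ I ^ c • J := by
      have : (x : R) ∈ I ^ (k + c) • (⊤ : Submodule R R) ⊓ J := ⟨by simpa using hx, x.2⟩
      rw [hk] at this
      rw [show k + c - k = c by omega] at this
      exact Submodule.smul_mono le_rfl inf_le_right this
    have h2 : x ∈ I ^ c • (⊤ : Submodule R J) := by
      rw [Submodule.mem_smul_top_iff]; exact h1
    have h3 : ∀ y ∈ I ^ c • (⊤ : Submodule R J), g y = 0 := by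
      intro y hy
      refine Submodule.smul_induction_on hy ?_ ?_
      · intro r hr n _
        rw [map_smul]
        exact congrArg Subtype.val (hc r hr ⟨g n, n, rfl⟩)
      · intro x y hx hy
        rw [map_add, hx, hy, add_zero]
    exact h3 x h2
  let kk : Submodule R J := Submodule.comap J.subtype (I ^ (k + c))
  let ι : (J ⧸ kk) →ₗ[R] (R ⧸ I ^ (k + c)) := Submodule.mapQ _ _ J.subtype le_rfl
  have hι : Function.Injective ι := by
    rw [← LinearMap.ker_eq_bot, LinearMap.ker_eq_bot']
    intro m hm
    obtain ⟨m, rfl⟩ := Submodule.Quotient.mk_surjective _ m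
    rw [Submodule.mapQ_apply, Submodule.Quotient.mk_eq_zero] at hm
    rw [Submodule.Quotient.mk_eq_zero]
    exact hm
  let gg : (J ⧸ kk) →ₗ[R] Q := Submodule.liftQ kk ((gam I Q).subtype ∘ₗ g) (by
    intro x hx
    rw [LinearMap.mem_ker, LinearMap.comp_apply, hle x hx, map_zero])
  obtain ⟨h, hh⟩ := hQ.out ι hι gg
  have hmem : ∀ r ∈ I ^ (k + c), r • h (Submodule.Quotient.mk 1) = 0 := by
    intro r hr
    rw [← map_smul, ← Submodule.Quotient.mk_smul]
    rw [(Submodule.Quotient.mk_eq_zero _).2 (by simpa using hr), map_zero]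
  let x : gam I Q := ⟨h (Submodule.Quotient.mk 1), k + c, hmem⟩
  refine ⟨LinearMap.toSpanSingleton R _ x, fun r hr => ?_⟩
  apply Subtype.ext
  have h1 := hh (Submodule.Quotient.mk ⟨r, hr⟩)
  have h2 : gg (Submodule.Quotient.mk ⟨r, hr⟩) = (g ⟨r, hr⟩ : Q) := rfl
  rw [← h2, ← h1]
  show r • h (Submodule.Quotient.mk 1) = _
  rw [← map_smul, ← Submodule.Quotient.mk_smul, smul_eq_mul, mul_one]
  rfl

lemma pt_embed [IsNoetherianRing R] (N : Type) [AddCommGroup N] [Module R N] (hN : PT I N) :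
    ∃ (G C : Type) (_ : AddCommGroup G) (_ : Module R G) (_ : AddCommGroup C) (_ : Module R C)
      (f : N →ₗ[R] G) (g : G →ₗ[R] C), SES f g ∧ PT I G ∧ PT I C ∧ Module.Injective R G := by
  let Q := Injective.under (ModuleCat.of R N)
  let j : N →ₗ[R] Q := (Injective.ι (ModuleCat.of R N)).hom
  have hj : Function.Injective j := (ModuleCat.mono_iff_injective _).1 inferInstance
  have hQ : Module.Injective R Q := by
    have h0 : Injective Q := Injective.injective_under _
    exact Module.injective_module_of_injective_object R Q (inj := h0)
  have hPG : PT I (gam I Q) := by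
    rintro ⟨a, c, hc⟩
    exact ⟨c, fun r hr => Subtype.ext (hc r hr)⟩
  let f : N →ₗ[R] gam I Q := LinearMap.codRestrict (gam I Q) j (by
    intro x
    obtain ⟨c, hc⟩ := hN x
    exact ⟨c, fun r hr => by rw [← map_smul, hc r hr, map_zero]⟩)
  refine ⟨gam I Q, gam I Q ⧸ LinearMap.range f, inferInstance, inferInstance, inferInstance, inferInstance, f,
    Submodule.mkQ _, ⟨?_, ?_, Submodule.mkQ_surjective _⟩, hPG, ?_, gam_injective I Q⟩
  · intro x y hxy
    exact hj (congrArg Subtype.val hxy)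
  · rw [LinearMap.exact_iff]; simp
  · intro a
    obtain ⟨a, rfl⟩ := Submodule.Quotient.mk_surjective _ a
    obtain ⟨c, hc⟩ := hPG a
    exact ⟨c, fun r hr => by rw [← Submodule.Quotient.mk_smul, hc r hr]; rfl⟩

lemma LC.of_injective (i : ℕ) (G : Type) [AddCommGroup G] [Module R G] [Module.Injective R G] :
    LC I (i+1) G := by
  intro t α
  have : Injective (ModuleCat.of R G) := Module.injective_object_of_injective_module R G
  exact ⟨t, le_rfl, by rw [Ext.eq_zero_of_injective α, pb_zero]⟩

theorem LC.of_pt [IsNoetherianRing R] (i : ℕ) : ∀ (N : Type) [AddCommGroup N] [Module R N], PT I N → LC I (i+1) N := by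
  induction i with
  | zero =>
    intro N _ _ hN t α
    obtain ⟨G, C, _, _, _, _, f, g, hS, hG, hC, hI⟩ := pt_embed I N hN
    obtain ⟨t', ht, h1⟩ := LC.of_injective I 0 G t (α.comp (Ext.mk₀ (ModuleCat.ofHom f)) (add_zero _))
    rw [pb_comp] at h1
    obtain ⟨γ, hγ⟩ := Ext.covariant_sequence_exact₁ _ hS.shortExact _ h1 rfl
    obtain ⟨φ, rfl⟩ := (Ext.mk₀_bijective _ _).2 γ
    obtain ⟨x, hx⟩ := hS.surj (φ.hom (Submodule.Quotient.mk 1))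
    obtain ⟨c, hc⟩ := hG x
    let ψ : (R ⧸ I ^ (max t' c)) →ₗ[R] G := Submodule.liftQ _ (LinearMap.toSpanSingleton R G x) (by
      intro r hr; simpa using hc r (Ideal.pow_le_pow_right (le_max_right _ _) hr))
    have hψ : ModuleCat.ofHom (qmap I (le_max_left t' c)) ≫ φ = ModuleCat.ofHom ψ ≫ ModuleCat.ofHom g := by
      refine ModuleCat.hom_ext (LinearMap.ext fun y => ?_)
      obtain ⟨y, rfl⟩ := Submodule.Quotient.mk_surjective _ y
      show φ.hom (Submodule.Quotient.mk y) = g (y • x)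
      rw [map_smul, hx, ← map_smul, ← Submodule.Quotient.mk_smul, smul_eq_mul, mul_one]
    refine ⟨max t' c, ht.trans (le_max_left _ _), ?_⟩
    rw [← pb_pb I ht (le_max_left t' c), ← hγ]
    refine (pb_comp I _ _ _ _).trans ?_
    have h5 : pb I (le_max_left t' c) (Ext.mk₀ φ) = (Ext.mk₀ (ModuleCat.ofHom ψ)).comp (Ext.mk₀ (ModuleCat.ofHom g)) (zero_add 0) := by
      unfold pb
      rw [Ext.mk₀_comp_mk₀, Ext.mk₀_comp_mk₀, hψ]
    refine (congrArg (fun w => w.comp hS.shortExact.extClass rfl) h5).trans ?_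
    refine (Ext.comp_assoc_of_second_deg_zero _ _ _ _).trans ?_
    have := hS.shortExact.comp_extClass
    refine (congrArg (fun w => (Ext.mk₀ (ModuleCat.ofHom ψ)).comp w (by omega)) this).trans ?_
    exact (Ext.mk₀ (ModuleCat.ofHom ψ)).comp_zero _ _ _ _
  | succ i ih =>
    intro N _ _ hN
    obtain ⟨G, C, _, _, _, _, f, g, hS, hG, hC, hI⟩ := pt_embed I N hN
    exact LC.left I hS (ih C hC) (LC.of_injective I _ G)
end gammaSec
end partD4

section partE1
section extSec
open CategoryTheory.Abelian

variable {R : Type} [CommRing R]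
variable {A B C N M : Type} [AddCommGroup A] [AddCommGroup B] [AddCommGroup C] [AddCommGroup N] [AddCommGroup M]
  [Module R A] [Module R B] [Module R C] [Module R N] [Module R M] {f : A →ₗ[R] B} {g : B →ₗ[R] C}

lemma extZ_def {j : ℕ} : ExtZ R j M N ↔ ∀ α : Ext (ModuleCat.of R M) (ModuleCat.of R N) j, α = 0 := by
  constructor
  · intro h α
    have := (show Subsingleton _ from h)
    exact Subsingleton.elim _ _
  · intro h
    exact ⟨fun a b => by rw [h a, h b]⟩

lemma ExtZ.left (h : SES f g) {j : ℕ} (hB : ExtZ R j B N) (hC : ExtZ R (j+1) C N) : ExtZ R j A N := by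
  rw [extZ_def] at *
  intro α
  have h1 := hC (h.shortExact.extClass.comp α (add_comm 1 j))
  obtain ⟨β, hβ⟩ := Ext.contravariant_sequence_exact₁ h.shortExact _ α (add_comm 1 j) h1
  rw [← hβ, hB β, Ext.comp_zero]

lemma ExtZ.right (h : SES f g) {j : ℕ} (hA : ExtZ R j A N) (hB : ExtZ R (j+1) B N) : ExtZ R (j+1) C N := by
  rw [extZ_def] at *
  intro α
  have h1 := hB ((Ext.mk₀ (ModuleCat.ofHom g)).comp α (zero_add _))
  obtain ⟨β, hβ⟩ := Ext.contravariant_sequence_exact₃ h.shortExact _ α h1 (add_comm 1 j)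
  rw [← hβ, hA β, Ext.comp_zero]

lemma ExtZ.mid (h : SES f g) {j : ℕ} (hA : ExtZ R j A N) (hC : ExtZ R j C N) : ExtZ R j B N := by
  rw [extZ_def] at *
  intro α
  have h1 := hA ((Ext.mk₀ (ModuleCat.ofHom f)).comp α (zero_add _))
  obtain ⟨β, hβ⟩ := Ext.contravariant_sequence_exact₂ h.shortExact _ α h1
  rw [← hβ, hC β, Ext.comp_zero]

lemma ExtZ.comid (h : SES f g) {j : ℕ} (hA : ExtZ R j N A) (hC : ExtZ R j N C) : ExtZ R j N B := by
  rw [extZ_def] at *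
  intro α
  have h1 := hC (α.comp (Ext.mk₀ (ModuleCat.ofHom g)) (add_zero _))
  obtain ⟨β, hβ⟩ := Ext.covariant_sequence_exact₂ _ h.shortExact α h1
  rw [← hβ, hA β, Ext.zero_comp]

lemma ExtZ.coretract {j : ℕ} (f : A →ₗ[R] B) (g : B →ₗ[R] A) (h : g.comp f = LinearMap.id) (hB : ExtZ R j N B) :
    ExtZ R j N A := by
  rw [extZ_def] at *
  intro α
  have h1 := hB (α.comp (Ext.mk₀ (ModuleCat.ofHom f)) (add_zero _))
  have : α = (α.comp (Ext.mk₀ (ModuleCat.ofHom f)) (add_zero _)).comp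
      (Ext.mk₀ (ModuleCat.ofHom g)) (add_zero _) := by
    rw [Ext.comp_assoc_of_second_deg_zero, Ext.mk₀_comp_mk₀, ← ModuleCat.ofHom_comp, h]
    exact (Ext.comp_mk₀_id _).symm
  rw [this, h1, Ext.zero_comp]

lemma ExtZ.iso {j : ℕ} (e : A ≃ₗ[R] B) (hB : ExtZ R j B N) : ExtZ R j A N := by
  rw [extZ_def] at *
  intro α
  have h1 := hB ((Ext.mk₀ (ModuleCat.ofHom e.symm.toLinearMap)).comp α (zero_add _))
  have : α = (Ext.mk₀ (ModuleCat.ofHom e.toLinearMap)).comp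
      ((Ext.mk₀ (ModuleCat.ofHom e.symm.toLinearMap)).comp α (zero_add _)) (zero_add _) := by
    rw [Ext.mk₀_comp_mk₀_assoc, ← ModuleCat.ofHom_comp]
    have : e.symm.toLinearMap.comp e.toLinearMap = LinearMap.id := by ext; simp
    rw [this]
    exact (Ext.mk₀_id_comp _).symm
  rw [this, h1, Ext.comp_zero]

lemma ExtZ.of_projective {j : ℕ} [Module.Projective R M] : ExtZ R (j+1) M N := by
  rw [extZ_def]
  intro α
  have : Projective (ModuleCat.of R M) := (IsProjective.iff_projective _).1 inferInstance
  exact Ext.eq_zero_of_projective α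

lemma ExtZ.extend (h : SES f g) (hC : ExtZ R 1 C N) (φ : A →ₗ[R] N) : ∃ ψ : B →ₗ[R] N, ψ ∘ₗ f = φ := by
  rw [extZ_def] at hC
  have h1 := hC (h.shortExact.extClass.comp (Ext.mk₀ (ModuleCat.ofHom φ)) (add_zero 1))
  obtain ⟨β, hβ⟩ := Ext.contravariant_sequence_exact₁ h.shortExact _ (Ext.mk₀ (ModuleCat.ofHom φ)) (add_zero 1) h1
  obtain ⟨ψ, rfl⟩ := (Ext.mk₀_bijective _ _).2 β
  rw [Ext.mk₀_comp_mk₀] at hβ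
  have := (Ext.mk₀_bijective _ _).1 hβ
  exact ⟨ψ.hom, congrArg ModuleCat.Hom.hom this⟩

lemma ExtZ.of_extend (h : SES f g) [Module.Projective R B] (hφ : ∀ φ : A →ₗ[R] N, ∃ ψ : B →ₗ[R] N, ψ ∘ₗ f = φ) :
    ExtZ R 1 C N := by
  rw [extZ_def]
  intro α
  have hB := extZ_def.1 (ExtZ.of_projective (R := R) (M := B) (N := N) (j := 0))
  have h1 := hB ((Ext.mk₀ (ModuleCat.ofHom g)).comp α (zero_add _))
  obtain ⟨β, hβ⟩ := Ext.contravariant_sequence_exact₃ h.shortExact _ α h1 (add_zero 1)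
  obtain ⟨φ, rfl⟩ := (Ext.mk₀_bijective _ _).2 β
  obtain ⟨ψ, hψ⟩ := hφ φ.hom
  rw [← hβ]
  have e1 : φ = ModuleCat.ofHom f ≫ ModuleCat.ofHom ψ := by
    rw [← ModuleCat.ofHom_comp, hψ]; rfl
  rw [e1, ← Ext.mk₀_comp_mk₀]
  have := h.shortExact.extClass_comp_assoc (Ext.mk₀ (ModuleCat.ofHom ψ)) (h := rfl)
  exact this

/-- peeling off a coordinate -/
lemma ses_fin (k : ℕ) : SES (LinearMap.single R (fun _ : Fin (k+1) => R) 0)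
    (LinearMap.funLeft R R (Fin.succ : Fin k → Fin (k+1))) := by
  refine ⟨?_, ?_, ?_⟩
  · intro x y hxy
    have := congrFun hxy 0
    simpa using this
  · intro x
    constructor
    · intro hx
      refine ⟨x 0, ?_⟩
      ext i
      refine Fin.cases ?_ ?_ i
      · simp
      · intro j
        have := congrFun hx j
        simp [LinearMap.funLeft] at this
        simp [this]
    · rintro ⟨y, rfl⟩
      ext i
      simp [LinearMap.funLeft]
  · intro y
    refine ⟨Fin.cons 0 y, ?_⟩
    ext i
    simp [LinearMap.funLeft]

lemma ExtZ.fin {j : ℕ} (h : ExtZ R j M R) (k : ℕ) : ExtZ R j M (Fin k → R) := by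
  induction k with
  | zero =>
    rw [extZ_def] at h ⊢
    intro α
    have : α = α.comp (Ext.mk₀ (𝟙 _)) (add_zero _) := (Ext.comp_mk₀_id _).symm
    rw [this]
    have h0 : (𝟙 (ModuleCat.of R (Fin 0 → R))) = 0 := by
      refine ModuleCat.hom_ext (LinearMap.ext fun y => Subsingleton.elim _ _)
    rw [h0, Ext.mk₀_zero, Ext.comp_zero]
  | succ k ih => exact ExtZ.comid (ses_fin k) h ih

lemma LC.fin (I : Ideal R) {j : ℕ} (h : LC I j R) (k : ℕ) : LC I j (Fin k → R) := by
  induction k with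
  | zero =>
    intro t α
    have : α = α.comp (Ext.mk₀ (𝟙 _)) (add_zero _) := (Ext.comp_mk₀_id _).symm
    refine ⟨t, le_rfl, ?_⟩
    have h0 : (𝟙 (ModuleCat.of R (Fin 0 → R))) = 0 := by
      refine ModuleCat.hom_ext (LinearMap.ext fun y => Subsingleton.elim _ _)
    rw [this, h0, Ext.mk₀_zero, Ext.comp_zero, pb_zero]
  | succ k ih => exact LC.mid I (ses_fin k) h ih

lemma exists_retract (P : Type) [AddCommGroup P] [Module R P] [Module.Finite R P] [Module.Projective R P] :
    ∃ (k : ℕ) (f : P →ₗ[R] (Fin k → R)) (g : (Fin k → R) →ₗ[R] P), g ∘ₗ f = LinearMap.id := by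
  obtain ⟨k, g, hg⟩ := Module.Finite.exists_fin' R P
  obtain ⟨f, hf⟩ := Module.projective_lifting_property g LinearMap.id hg
  exact ⟨k, f, g, hf⟩

lemma ExtZ.toProj {j : ℕ} (h : ExtZ R j M R) (P : Type) [AddCommGroup P] [Module R P] [Module.Finite R P]
    [Module.Projective R P] : ExtZ R j M P := by
  obtain ⟨k, f, g, hfg⟩ := exists_retract (R := R) P
  exact ExtZ.coretract f g hfg (h.fin k)

lemma LC.proj (I : Ideal R) {j : ℕ} (h : LC I j R) (P : Type) [AddCommGroup P] [Module R P] [Module.Finite R P]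
    [Module.Projective R P] : LC I j P := by
  obtain ⟨k, f, g, hfg⟩ := exists_retract (R := R) P
  exact LC.retract I f g hfg (h.fin I k)

/-- projective dimension less than n -/
def PD (R : Type) [CommRing R] (n : ℕ) (M : Type) [AddCommGroup M] [Module R M] : Prop :=
  HasProjectiveDimensionLT (ModuleCat.of R M) n

lemma PD.one_iff : PD R 1 M ↔ Module.Projective R M := by
  unfold PD
  rw [← projective_iff_hasProjectiveDimensionLT_one]
  exact (IsProjective.iff_projective _).symm

lemma PD.mono {n m : ℕ} (h : PD R n M) (hnm : n ≤ m) : PD R m M :=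
  have : HasProjectiveDimensionLT (ModuleCat.of R M) n := h
  hasProjectiveDimensionLT_of_ge _ n m hnm

lemma PD.left (h : SES f g) {n : ℕ} (hB : PD R n B) (hC : PD R (n+1) C) : PD R n A :=
  h.shortExact.hasProjectiveDimensionLT_X₁ n hB hC

lemma PD.right (h : SES f g) {n : ℕ} (hA : PD R n A) (hB : PD R (n+1) B) : PD R (n+1) C :=
  h.shortExact.hasProjectiveDimensionLT_X₃ n hA hB

lemma PD.proj {n : ℕ} [Module.Projective R M] : PD R (n+1) M :=
  PD.mono (PD.one_iff.2 inferInstance) (by omega)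

lemma PD.extZ {n j : ℕ} (h : PD R n M) (hj : n ≤ j) : ExtZ R j M N :=
  HasProjectiveDimensionLT.subsingleton (hX := h) _ n j hj _

lemma PD.of_FR (n : ℕ) : ∀ (M : Type) [AddCommGroup M] [Module R M], FR R n M → PD R (n+1) M := by
  induction n with
  | zero =>
    intro M _ _ h
    have : Module.Free R M := h.1
    exact PD.one_iff.2 inferInstance
  | succ n ih =>
    intro M _ _ h
    obtain ⟨L, F, _, _, _, _, i, p, hL, hF, hF', hi, hex, hp⟩ := h
    exact PD.right ⟨hi, hex, hp⟩ (ih L hL) PD.proj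

/-- finite free cover -/
lemma exists_cover [IsNoetherianRing R] (M : Type) [AddCommGroup M] [Module R M] [Module.Finite R M] :
    ∃ (k : ℕ) (g : (Fin k → R) →ₗ[R] M), SES (LinearMap.ker g).subtype g ∧ Module.Finite R (LinearMap.ker g) := by
  obtain ⟨k, g, hg⟩ := Module.Finite.exists_fin' R M
  exact ⟨k, g, ⟨Subtype.val_injective, LinearMap.exact_subtype_ker_map g, hg⟩, inferInstance⟩

lemma PD.drop [IsNoetherianRing R] (n : ℕ) : ∀ (M : Type) [AddCommGroup M] [Module R M] [Module.Finite R M],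
    PD R (n+2) M → ExtZ R (n+1) M R → PD R (n+1) M := by
  induction n with
  | zero =>
    intro M _ _ _ h h'
    obtain ⟨k, g, hS, hfin⟩ := exists_cover (R := R) M
    have hL : PD R 1 (LinearMap.ker g) := PD.left hS PD.proj h
    have := PD.one_iff.1 hL
    obtain ⟨r, hr⟩ := ExtZ.extend hS (h'.toProj (LinearMap.ker g)) LinearMap.id
    rw [PD.one_iff]
    have htf : (Function.Surjective g ∧ ∃ l, l ∘ₗ (LinearMap.ker g).subtype = LinearMap.id) →
        (Function.Injective (LinearMap.ker g).subtype ∧ ∃ l, g ∘ₗ l = LinearMap.id) :=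
      (hS.exact.split_tfae'.out 1 0).1
    obtain ⟨s, hs⟩ := (htf ⟨hS.surj, r, hr⟩).2
    exact Module.Projective.of_split s g hs
  | succ n ih =>
    intro M _ _ _ h h'
    obtain ⟨k, g, hS, hfin⟩ := exists_cover (R := R) M
    have hL : PD R (n+2) (LinearMap.ker g) := PD.left hS PD.proj h
    exact PD.right hS (ih _ hL (ExtZ.left hS ExtZ.of_projective h')) PD.proj
end extSec
end partE1

section partC1
section formSec
variable {R : Type} [CommRing R] [IsDomain R] {E : Type} [AddCommGroup E] [Module R E]

lemma loc_basis (p : Ideal R) [p.IsPrime] 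
    (hf : Module.Free (Localization.AtPrime p) (LocalizedModule p.primeCompl E))
    (hr : Module.rank (Localization.AtPrime p) (LocalizedModule p.primeCompl E) = 2) :
    ∃ e : Fin 2 → E, (∀ r : Fin 2 → R, ∑ i, r i • e i = 0 → r = 0) ∧
      ∀ a : E, ∃ s : R, s ∉ p ∧ ∃ r : Fin 2 → R, s • a = ∑ i, r i • e i := by
  let S := Localization.AtPrime p
  let V := LocalizedModule p.primeCompl E
  let mk : E →ₗ[R] V := LocalizedModule.mkLinearMap p.primeCompl E
  have hfin : Module.Finite S V := Module.finite_of_rank_eq_nat (n := 2) (by exact_mod_cast hr)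
  have hfr : Module.finrank S V = 2 := Module.finrank_eq_of_rank_eq (by exact_mod_cast hr)
  let b : Module.Basis (Fin 2) S V := Module.finBasisOfFinrankEq S V hfr
  have hsurj : ∀ v : V, ∃ (x : E × p.primeCompl), (x.2 : R) • v = mk x.1 := fun v => 
    IsLocalizedModule.surj p.primeCompl mk v
  choose x hx using fun i => hsurj (b i)
  refine ⟨fun i => (x i).1, ?_, ?_⟩
  · intro r hr0
    have h1 : ∑ i, (algebraMap R S (r i * (x i).2)) • b i = 0 := by
      have := congrArg mk hr0
      rw [map_sum, map_zero] at this
      rw [← this]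
      refine Finset.sum_congr rfl fun i _ => ?_
      rw [map_smul, ← hx i, smul_smul, algebraMap_smul]
    have h2 := Fintype.linearIndependent_iff.1 b.linearIndependent _ h1
    funext i
    have h3 := h2 i
    have hinj : Function.Injective (algebraMap R S) :=
      IsLocalization.injective S p.primeCompl_le_nonZeroDivisors
    rw [← map_zero (algebraMap R S)] at h3
    have h4 := hinj h3
    have h5 : ((x i).2 : R) ≠ 0 := by
      intro h; exact (x i).2.2 (h ▸ p.zero_mem)
    simpa [h5] using h4
  · intro a
    have h1 : mk a = ∑ i, b.repr (mk a) i • b i := (b.sum_repr _).symm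
    choose y hy using fun i => IsLocalization.surj p.primeCompl (b.repr (mk a) i)
    let sx : R := ((x 0).2 : R) * ((x 1).2 : R)
    let sy : R := ((y 0).2 : R) * ((y 1).2 : R)
    have hsx : sx ∉ p := fun h => ((‹p.IsPrime›).mem_or_mem h).elim (x 0).2.2 (x 1).2.2
    have hsy : sy ∉ p := fun h => ((‹p.IsPrime›).mem_or_mem h).elim (y 0).2.2 (y 1).2.2
    have key : mk ((sx * sy) • a) = mk ((((x 1).2 : R) * ((y 1).2 : R) * (y 0).1) • (x 0).1 + 
        (((x 0).2 : R) * ((y 0).2 : R) * (y 1).1) • (x 1).1) := by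
      rw [map_smul, h1, Fin.sum_univ_two, map_add, map_smul, map_smul, ← hx 0, ← hx 1]
      have e0 : ((y 0).2 : R) • ((b.repr (mk a)) 0) = algebraMap R S (y 0).1 := by
        rw [← hy 0, Algebra.smul_def, mul_comm]
      have e1 : ((y 1).2 : R) • ((b.repr (mk a)) 1) = algebraMap R S (y 1).1 := by
        rw [← hy 1, Algebra.smul_def, mul_comm]
      have f0 : (((x 1).2 : R) * ((y 1).2 : R) * (y 0).1) • ((x 0).2 : R) • b 0 = (sx * sy) • ((b.repr (mk a)) 0 • b 0) := by
        rw [← smul_assoc (sx * sy)]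
        have : (sx * sy) • ((b.repr (mk a)) 0) = algebraMap R S (((x 1).2 : R) * ((y 1).2 : R) * (y 0).1 * (x 0).2) := by
          rw [map_mul, map_mul, map_mul, ← e0]
          simp only [Algebra.smul_def, sx, sy, map_mul]
          ring
        rw [this, smul_smul, algebraMap_smul]
      have f1 : (((x 0).2 : R) * ((y 0).2 : R) * (y 1).1) • ((x 1).2 : R) • b 1 = (sx * sy) • ((b.repr (mk a)) 1 • b 1) := by
        rw [← smul_assoc (sx * sy)]
        have : (sx * sy) • ((b.repr (mk a)) 1) = algebraMap R S (((x 0).2 : R) * ((y 0).2 : R) * (y 1).1 * (x 1).2) := by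
          rw [map_mul, map_mul, map_mul, ← e1]
          simp only [Algebra.smul_def, sx, sy, map_mul]
          ring
        rw [this, smul_smul, algebraMap_smul]
      rw [f0, f1, smul_add]
    obtain ⟨c, hc⟩ := (IsLocalizedModule.eq_iff_exists p.primeCompl mk).1 key
    refine ⟨c * (sx * sy), ?_, ![c * (((x 1).2 : R) * ((y 1).2 : R) * (y 0).1), c * (((x 0).2 : R) * ((y 0).2 : R) * (y 1).1)], ?_⟩
    · intro h
      rcases (‹p.IsPrime›).mem_or_mem h with h | h
      · exact c.2 h
      · exact ((‹p.IsPrime›).mem_or_mem h).elim hsx hsy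
    · rw [Fin.sum_univ_two]
      simp only [Matrix.cons_val_zero, Matrix.cons_val_one, mul_smul]
      rw [← smul_add]
      have : (c : R) • ((sx * sy) • a) = (c : R) • ((((x 1).2 : R) * ((y 1).2 : R) * (y 0).1) • (x 0).1 + 
        (((x 0).2 : R) * ((y 0).2 : R) * (y 1).1) • (x 1).1) := hc
      simpa only [mul_smul] using this

end formSec
end partC1

section partC2
section formSec2
set_option linter.unusedSectionVars false
variable {R : Type} [CommRing R] [IsDomain R] {E : Type} [AddCommGroup E] [Module R E]

/-- local basis property at p -/
def LB (p : Ideal R) (E : Type) [AddCommGroup E] [Module R E] : Prop :=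
    ∃ e : Fin 2 → E, (∀ r : Fin 2 → R, ∑ i, r i • e i = 0 → r = 0) ∧
      ∀ a : E, ∃ s : R, s ∉ p ∧ ∃ r : Fin 2 → R, s • a = ∑ i, r i • e i

lemma le_radical_of {m J : Ideal R} (h : ∀ p : Ideal R, p.IsPrime → J ≤ p → p = m) : m ≤ J.radical := by
  rw [Ideal.radical_eq_sInf]
  refine le_sInf ?_
  rintro p ⟨h1, h2⟩
  rw [h p h2 h1]

lemma lb_torsionfree [IsNoetherianRing R] {m : Ideal R} (hE : ∀ p : Ideal R, p.IsPrime → p ≠ m → LB p E) (h0 : LC m 0 E)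
    (r : R) (hr : r ≠ 0) (a : E) (ha : r • a = 0) : a = 0 := by
  let J : Ideal R := LinearMap.ker (LinearMap.toSpanSingleton R E a)
  have h1 : m ≤ J.radical := by
    refine le_radical_of fun p hp hJ => ?_
    by_contra hpm
    obtain ⟨e, he, hs⟩ := hE p hp hpm
    obtain ⟨s, hsp, c, hc⟩ := hs a
    apply hsp
    apply hJ
    show s • a = 0
    have : ∑ i, (r • c) i • e i = 0 := by
      rw [← smul_zero s, ← ha, smul_comm, hc, Finset.smul_sum]
      refine Finset.sum_congr rfl fun i _ => ?_
      simp [mul_smul]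
    have h3 := he _ this
    have h4 : c = 0 := by
      rcases smul_eq_zero.1 h3 with h | h
      · exact absurd h hr
      · exact h
    rw [hc, h4]; simp
  obtain ⟨c, hc⟩ := Ideal.exists_pow_le_of_le_radical_of_fg h1 (IsNoetherian.noetherian m)
  exact (LC.zero_iff m).1 h0 c a fun r hr => hc hr

/-- embedding into rank two free module -/
lemma lb_embed [Module.Finite R E] (htf : ∀ (r : R) (_ : r ≠ 0) (a : E), r • a = 0 → a = 0) (hE : LB (⊥ : Ideal R) E) :
    ∃ (i : (Fin 2 → R) →ₗ[R] E) (φ : E →ₗ[R] (Fin 2 → R)), Function.Injective i ∧ Function.Injective φ := by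
  obtain ⟨e, he, hs⟩ := hE
  let i : (Fin 2 → R) →ₗ[R] E := Fintype.linearCombination R e
  have hi : Function.Injective i := by
    rw [← LinearMap.ker_eq_bot, LinearMap.ker_eq_bot']
    intro r hr
    exact he r (by simpa [i, Fintype.linearCombination_apply] using hr)
  obtain ⟨t, ht⟩ := Module.Finite.fg_top (R := R) (M := E)
  choose s hs0 c hc using hs
  have huni : ∃ s : R, s ≠ 0 ∧ ∀ a : E, s • a ∈ LinearMap.range i := by
    refine ⟨∏ a ∈ t, s a, ?_, fun a => ?_⟩
    · rw [Finset.prod_ne_zero_iff]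
      intro a _ h
      exact hs0 a (by simp [h])
    · have : a ∈ Submodule.span R (t : Set E) := ht ▸ Submodule.mem_top
      induction this using Submodule.span_induction with
      | mem x hx =>
        classical
        rw [← Finset.mul_prod_erase t s hx, mul_comm, mul_smul]
        refine Submodule.smul_mem _ _ ⟨c x, ?_⟩
        rw [hc x]; simp [i, Fintype.linearCombination_apply]
      | zero => simp
      | add x y _ _ hx hy => rw [smul_add]; exact Submodule.add_mem _ hx hy
      | smul t x _ hx => rw [smul_comm]; exact Submodule.smul_mem _ _ hx
  obtain ⟨s, hs0, hs⟩ := huni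
  let e' := LinearEquiv.ofInjective i hi
  refine ⟨i, e'.symm.toLinearMap ∘ₗ LinearMap.codRestrict (LinearMap.range i) (s • LinearMap.id) hs, hi, ?_⟩
  rw [LinearMap.coe_comp]
  refine (LinearEquiv.injective e'.symm).comp ?_
  rw [← LinearMap.ker_eq_bot, LinearMap.ker_eq_bot']
  intro a ha
  have : s • a = 0 := congrArg Subtype.val ha
  exact htf s hs0 a this

/-- Pluecker forms -/
structure PF (ω : E →ₗ[R] E →ₗ[R] R) : Prop where
  alt : ∀ a, ω a a = 0
  pl : ∀ a b c, ω a b • c + ω b c • a + ω c a • b = 0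

lemma PF.skew {ω : E →ₗ[R] E →ₗ[R] R} (h : PF ω) (a b : E) : ω a b = - ω b a := by
  have := h.alt (a + b)
  simp only [map_add, LinearMap.add_apply, h.alt] at this
  linear_combination this

lemma exists_pf (φ : E →ₗ[R] (Fin 2 → R)) (hφ : Function.Injective φ) : ∃ ω : E →ₗ[R] E →ₗ[R] R, PF ω ∧ 
    ∀ a b, ω a b = φ a 0 * φ b 1 - φ a 1 * φ b 0 := by
  let ω : E →ₗ[R] E →ₗ[R] R := LinearMap.mk₂ R (fun a b => φ a 0 * φ b 1 - φ a 1 * φ b 0)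
    (by intros; simp; ring) (by intros; simp; ring) (by intros; simp; ring) (by intros; simp; ring)
  have hω : ∀ a b, ω a b = φ a 0 * φ b 1 - φ a 1 * φ b 0 := fun a b => rfl
  refine ⟨ω, ⟨fun a => by rw [hω]; ring, fun a b c => ?_⟩, hω⟩
  apply hφ
  funext i
  simp only [map_add, map_smul, map_zero, Pi.add_apply, Pi.smul_apply, Pi.zero_apply, hω, smul_eq_mul]
  fin_cases i <;> simp <;> ring

lemma pf_divide (ω : E →ₗ[R] E →ₗ[R] R) (h : PF ω) (q : R) (hq : q ≠ 0) (hd : ∀ a b, q ∣ ω a b)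
    (htf : ∀ (r : R) (_ : r ≠ 0) (a : E), r • a = 0 → a = 0) :
    ∃ ω' : E →ₗ[R] E →ₗ[R] R, PF ω' ∧ ∀ a b, ω a b = q * ω' a b := by
  choose w hw using hd
  let ω' : E →ₗ[R] E →ₗ[R] R := LinearMap.mk₂ R w
    (by intro a b c; apply mul_left_cancel₀ hq; rw [mul_add, ← hw, ← hw, ← hw]; simp)
    (by intro r b c; apply mul_left_cancel₀ hq; rw [smul_eq_mul, mul_left_comm, ← hw, ← hw]; simp)
    (by intro a b c; apply mul_left_cancel₀ hq; rw [mul_add, ← hw, ← hw, ← hw]; simp)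
    (by intro r b c; apply mul_left_cancel₀ hq; rw [smul_eq_mul, mul_left_comm, ← hw, ← hw]; simp)
  have hω : ∀ a b, ω a b = q * ω' a b := hw
  refine ⟨ω', ⟨fun a => ?_, fun a b c => ?_⟩, hω⟩
  · apply mul_left_cancel₀ hq; rw [← hω, h.alt, mul_zero]
  · apply htf q hq
    have := h.pl a b c
    rw [hω, hω, hω] at this
    rw [smul_add, smul_add, smul_smul, smul_smul, smul_smul, this]

lemma pf_primitive [UniqueFactorizationMonoid R] (htf : ∀ (r : R) (_ : r ≠ 0) (a : E), r • a = 0 → a = 0) (c d : E) :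
    ∀ (δ : R) (ω : E →ₗ[R] E →ₗ[R] R) (_ : PF ω) (_ : ω c d = δ) (_ : δ ≠ 0),
    ∃ ω' : E →ₗ[R] E →ₗ[R] R, PF ω' ∧ ω' c d ≠ 0 ∧ ∀ q, Prime q → ∃ a b, ¬ q ∣ ω' a b := by
  intro δ
  induction δ using (IsWellFounded.wf (r := DvdNotUnit (α := R))).induction with
  | _ δ ih =>
    intro ω hω hcd hδ
    by_cases hq : ∀ q, Prime q → ∃ a b, ¬ q ∣ ω a b
    · exact ⟨ω, hω, by rw [hcd]; exact hδ, hq⟩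
    · push Not at hq
      obtain ⟨q, hq, hd⟩ := hq
      obtain ⟨ω', h', he⟩ := pf_divide ω hω q hq.ne_zero hd htf
      have h0 : ω' c d ≠ 0 := by
        intro h; rw [he, h, mul_zero] at hcd; exact hδ hcd.symm
      refine ih (ω' c d) ⟨h0, q, hq.not_unit, ?_⟩ ω' h' rfl h0
      rw [← hcd, he, mul_comm]

lemma pf_J [UniqueFactorizationMonoid R] {m : Ideal R} (hE : ∀ p : Ideal R, p.IsPrime → p ≠ m → LB p E)
    (ω : E →ₗ[R] E →ₗ[R] R) (hω : PF ω) (hp : ∀ q, Prime q → ∃ a b, ¬ q ∣ ω a b) (hne : ∃ a b, ω a b ≠ 0) :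
    m ≤ (Ideal.span {r | ∃ a b, ω a b = r}).radical := by
  refine le_radical_of fun p hpp hJ => ?_
  by_contra hpm
  obtain ⟨e, he, hs⟩ := hE p hpp hpm
  choose s hsp r hr using hs
  have key : ∀ a b, s a * s b * ω a b = (r a 0 * r b 1 - r a 1 * r b 0) * ω (e 0) (e 1) := by
    intro a b
    have h1 : ω (s a • a) (s b • b) = s a * s b * ω a b := by
      simp only [map_smul, LinearMap.smul_apply, smul_eq_mul]; ring
    rw [← h1, hr, hr]
    simp only [Fin.sum_univ_two, map_add, map_smul, LinearMap.add_apply, LinearMap.smul_apply, smul_eq_mul, hω.alt]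
    rw [hω.skew (e 1) (e 0)]; ring
  have hs0 : ∀ a, s a ≠ 0 := fun a h => hsp a (h ▸ p.zero_mem)
  have hδ : ω (e 0) (e 1) ≠ 0 := by
    intro h
    obtain ⟨a, b, hab⟩ := hne
    have := key a b
    rw [h, mul_zero] at this
    simp [hs0, hab] at this
  have hδp : ω (e 0) (e 1) ∈ p := hJ (Ideal.subset_span ⟨_, _, rfl⟩)
  obtain ⟨q, hqp, hqd, hqq⟩ : ∃ q, q ∈ p ∧ q ∣ ω (e 0) (e 1) ∧ Prime q := by
    obtain ⟨f, hf, u, hu⟩ := UniqueFactorizationMonoid.exists_prime_factors _ hδ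
    have h1 : f.prod ∈ p := by
      have : f.prod = ω (e 0) (e 1) * (↑u⁻¹ : R) := by rw [← hu]; simp
      rw [this]; exact Ideal.mul_mem_right _ _ hδp
    obtain ⟨q, hq, hqp⟩ := (hpp.multiset_prod_mem_iff_exists_mem f).1 h1
    exact ⟨q, hqp, (Multiset.dvd_prod hq).trans ⟨u, hu.symm⟩, hf q hq⟩
  obtain ⟨a, b, hab⟩ := hp q hqq
  apply hab
  have h1 : q ∣ s a * s b * ω a b := by rw [key]; exact hqd.mul_left _
  rcases hqq.dvd_or_dvd h1 with h | h
  · rcases hqq.dvd_or_dvd h with h | h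
    · exact absurd (p.mem_of_dvd h hqp) (hsp a)
    · exact absurd (p.mem_of_dvd h hqp) (hsp b)
  · exact h

lemma pf_unique (ω : E →ₗ[R] E →ₗ[R] R) (hω : PF ω) (hne : ∃ a b, ω a b ≠ 0) (x y : R) (hx : Prime x) (hxy : ¬ x ∣ y)
    (hxJ : x ∈ (Ideal.span {r | ∃ a b, ω a b = r}).radical) (hyJ : y ∈ (Ideal.span {r | ∃ a b, ω a b = r}).radical)
    (β : E →ₗ[R] E →ₗ[R] R) (hβ : ∀ a, β a a = 0) : ∃ s : R, β = s • ω := by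
  have hsk : ∀ a b, β a b = - β b a := by
    intro a b
    have := hβ (a + b)
    simp only [map_add, LinearMap.add_apply, hβ] at this
    linear_combination this
  have q1 : ∀ a b c d, ω c d ≠ 0 → ω c d * β a b = β c d * ω a b := by
    intro a b c d h
    have h1 : ∀ (γ : E →ₗ[R] E →ₗ[R] R) (_ : ∀ a, γ a a = 0) (_ : ∀ a b, γ a b = - γ b a),
        ω c d * ω c d * γ a b = (ω a c * ω b d - ω a d * ω b c) * γ c d := by
      intro γ g1 g2
      have e1 : ω c d • a = ω a d • c - ω a c • d := by
        have := hω.pl a c d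
        rw [hω.skew d a] at this
        linear_combination (norm := module) this
      have e2 : ω c d • b = ω b d • c - ω b c • d := by
        have := hω.pl b c d
        rw [hω.skew d b] at this
        linear_combination (norm := module) this
      have e3 : γ (ω c d • a) (ω c d • b) = ω c d * ω c d * γ a b := by
        simp only [map_smul, LinearMap.smul_apply, smul_eq_mul]; ring
      rw [← e3, e1, e2]
      simp only [map_sub, LinearMap.sub_apply, map_smul, LinearMap.smul_apply, smul_eq_mul, g1]
      rw [g2 d c]; ring
    have h2 := h1 β hβ hsk
    have h3 := h1 ω hω.alt hω.skew
    apply mul_left_cancel₀ h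
    have h4 : (ω a c * ω b d - ω a d * ω b c) = ω c d * ω a b := by
      apply mul_left_cancel₀ h
      linear_combination -h3
    rw [h4] at h2
    linear_combination h2
  obtain ⟨c, d, hcd⟩ := hne
  have q2 : ∀ z ∈ Ideal.span {r | ∃ a b, ω a b = r}, ω c d ∣ z * β c d := by
    intro z hz
    induction hz using Submodule.span_induction with
    | mem z hz =>
      obtain ⟨a, b, rfl⟩ := hz
      exact ⟨β a b, by rw [q1 a b c d hcd]; ring⟩
    | zero => simp
    | add z w _ _ hz hw => rw [add_mul]; exact dvd_add hz hw
    | smul t z _ hz => rw [smul_eq_mul, mul_assoc]; exact hz.mul_left _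
  obtain ⟨n, hn⟩ := hxJ
  obtain ⟨k, hk⟩ := hyJ
  obtain ⟨s, hs⟩ := q2 _ hn
  obtain ⟨t, ht⟩ := q2 _ hk
  have h5 : s * y ^ k = x ^ n * t := by
    apply mul_left_cancel₀ hcd
    linear_combination (-y^k) * hs + x^n * ht
  have h6 : x ^ n ∣ s := hx.pow_dvd_of_dvd_mul_right n (fun h => hxy (hx.dvd_of_dvd_pow h)) ⟨t, h5⟩
  obtain ⟨u, hu⟩ := h6
  have h7 : β c d = u * ω c d := by
    have hx0 : x ^ n ≠ 0 := pow_ne_zero _ hx.ne_zero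
    apply mul_left_cancel₀ hx0
    rw [hs, hu]; ring
  refine ⟨u, LinearMap.ext fun a => LinearMap.ext fun b => ?_⟩
  apply mul_left_cancel₀ hcd
  rw [q1 a b c d hcd, h7]
  simp only [LinearMap.smul_apply, smul_eq_mul]; ring

end formSec2
end partC2

section partF1
section goodSec
set_option linter.unusedSectionVars false
variable {R : Type} [CommRing R]

/-- abstract properties of the irrelevant ideal -/
structure Good (R : Type) [CommRing R] (I : Ideal R) : Prop where
  lc : ∀ i < 9, LC I i R
  ext : ∀ (N : Type) [AddCommGroup N] [Module R N] [Module.Finite R N], PT I N → ∀ j < 9, ExtZ R j N R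
  gld : ∀ (M : Type) [AddCommGroup M] [Module R M] [Module.Finite R M], PD R 10 M

variable {I : Ideal R} {A B C N : Type} [AddCommGroup A] [AddCommGroup B] [AddCommGroup C] [AddCommGroup N]
  [Module R A] [Module R B] [Module R C] [Module R N]

lemma pt_of_elem [IsNoetherianRing R] (a : N) (h : ∀ f ∈ I, ∃ n : ℕ, f ^ n • a = 0) : 
    ∃ c : ℕ, ∀ r ∈ I ^ c, r • a = 0 := by
  let J : Ideal R := LinearMap.ker (LinearMap.toSpanSingleton R N a)
  have h1 : I ≤ J.radical := by
    intro f hf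
    obtain ⟨n, hn⟩ := h f hf
    exact ⟨n, hn⟩
  obtain ⟨c, hc⟩ := Ideal.exists_pow_le_of_le_radical_of_fg h1 (IsNoetherian.noetherian I)
  exact ⟨c, fun r hr => hc hr⟩

lemma LC.elem [IsNoetherianRing R] (h : LC I 0 N) (a : N) (h' : ∀ f ∈ I, ∃ n : ℕ, f ^ n • a = 0) : a = 0 := by
  obtain ⟨c, hc⟩ := pt_of_elem a h'
  exact (LC.zero_iff I).1 h c a hc

lemma pt_of [IsNoetherianRing R] (h : ∀ f ∈ I, ∀ a : N, ∃ n : ℕ, f ^ n • a = 0) : PT I N :=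
  fun a => pt_of_elem a fun f hf => h f hf a

lemma LC.pt_subsingleton [IsNoetherianRing R] (h : LC I 0 N) (h' : PT I N) (a : N) : a = 0 := by
  obtain ⟨c, hc⟩ := h' a
  exact (LC.zero_iff I).1 h c a hc

lemma ses_coker (f : A →ₗ[R] B) (hf : Function.Injective f) : SES f (LinearMap.range f).mkQ :=
  ⟨hf, by rw [LinearMap.exact_iff]; simp, Submodule.mkQ_surjective _⟩

lemma ses_sub (S : Submodule R A) : SES S.subtype S.mkQ :=
  ⟨Subtype.val_injective, by rw [LinearMap.exact_iff]; simp, Submodule.mkQ_surjective _⟩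

lemma ses_ker (f : A →ₗ[R] B) : SES (LinearMap.ker f).subtype f.rangeRestrict := by
  refine ⟨Subtype.val_injective, ?_, f.surjective_rangeRestrict⟩
  rw [LinearMap.exact_iff]; simp

lemma pt_coker [IsNoetherianRing R] (f : A →ₗ[R] B) (h : ∀ r ∈ I, ∀ b, ∃ n : ℕ, r ^ n • b ∈ LinearMap.range f) :
    PT I (B ⧸ LinearMap.range f) := by
  refine pt_of fun r hr b => ?_
  obtain ⟨b, rfl⟩ := Submodule.Quotient.mk_surjective _ b
  obtain ⟨n, hn⟩ := h r hr b
  exact ⟨n, by rw [← Submodule.Quotient.mk_smul, Submodule.Quotient.mk_eq_zero]; exact hn⟩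

lemma surj_of_LC [IsNoetherianRing R] (f : A →ₗ[R] B) (hf : Function.Injective f) (hA : LC I 1 A) (hB : LC I 0 B)
    (h : ∀ r ∈ I, ∀ b, ∃ n : ℕ, r ^ n • b ∈ LinearMap.range f) : Function.Surjective f := by
  have h1 : LC I 0 (B ⧸ LinearMap.range f) := LC.right I (ses_coker f hf) hB hA
  intro b
  have := h1.pt_subsingleton (pt_coker f h) (Submodule.Quotient.mk b)
  rw [Submodule.Quotient.mk_eq_zero] at this
  exact this

lemma LC.dual [IsNoetherianRing R] (h : LC I 0 R) : LC I 0 (Module.Dual R A) := by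
  rw [LC.zero_iff] at h ⊢
  intro c φ hφ
  refine LinearMap.ext fun a => h c (φ a) fun r hr => ?_
  exact LinearMap.congr_fun (hφ r hr) a

/-- f-projective for all f in I -/
def FP (I : Ideal R) (M : Type) [AddCommGroup M] [Module R M] : Prop :=
  ∀ f ∈ I, ∃ (n : ℕ) (P : Type) (_ : AddCommGroup P) (_ : Module R P) (_ : Module.Finite R P) 
    (_ : Module.Projective R P) (u : M →ₗ[R] P) (v : P →ₗ[R] M), v ∘ₗ u = f ^ n • LinearMap.id

section step
variable {i : A →ₗ[R] B} {p : B →ₗ[R] C}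

lemma fp_retract (h : SES i p) [Module.Projective R B] (hC : FP I C) (f : R) (hf : f ∈ I) :
    ∃ (n : ℕ) (r : B →ₗ[R] A), r ∘ₗ i = f ^ n • LinearMap.id := by
  obtain ⟨n, P, _, _, _, _, u, v, huv⟩ := hC f hf
  obtain ⟨w, hw⟩ := Module.projective_lifting_property p v h.surj
  let ρ : B →ₗ[R] B := f ^ n • LinearMap.id - w ∘ₗ u ∘ₗ p
  have key : ∀ b, p (ρ b) = 0 := by
    intro b
    have h1 : p (w (u (p b))) = v (u (p b)) := LinearMap.congr_fun hw _
    have h2 : v (u (p b)) = f ^ n • p b := LinearMap.congr_fun huv _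
    simp [ρ, h1, h2]
  let e := LinearEquiv.ofInjective i h.inj
  have hr : ∀ b, ρ b ∈ LinearMap.range i := fun b => (h.exact _).1 (key b)
  refine ⟨n, e.symm.toLinearMap ∘ₗ LinearMap.codRestrict _ _ hr, LinearMap.ext fun a => ?_⟩
  have h3 : LinearMap.codRestrict _ _ hr (i a) = e (f ^ n • a) := by
    apply Subtype.ext
    have : p (i a) = 0 := (h.exact _).2 ⟨a, rfl⟩
    simp [e, ρ, this]
  simp only [LinearMap.comp_apply, LinearEquiv.coe_coe, h3]
  simp

lemma FP.syz (h : SES i p) [Module.Finite R B] [Module.Projective R B] (hC : FP I C) : FP I A := by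
  intro f hf
  obtain ⟨n, r, hr⟩ := fp_retract h hC f hf
  exact ⟨n, B, inferInstance, inferInstance, inferInstance, inferInstance, i, r, hr⟩

lemma dual_coker_tors (h : SES i p) [Module.Projective R B] (hC : FP I C) (f : R) (hf : f ∈ I) (φ : Module.Dual R A) :
    ∃ n : ℕ, f ^ n • φ ∈ LinearMap.range i.dualMap := by
  obtain ⟨n, r, hr⟩ := fp_retract h hC f hf
  refine ⟨n, φ ∘ₗ r, LinearMap.ext fun a => ?_⟩
  have := LinearMap.congr_fun hr a
  simp only [LinearMap.comp_apply] at this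
  simp [LinearMap.dualMap_apply, this]

lemma ses_dual (h : SES i p) : SES (A := Module.Dual R C) (B := Module.Dual R B) (C := LinearMap.range (M := Module.Dual R B) (M₂ := Module.Dual R A) i.dualMap) p.dualMap (LinearMap.rangeRestrict (M := Module.Dual R B) (M₂ := Module.Dual R A) i.dualMap) := by
  refine ⟨LinearMap.dualMap_injective_of_surjective h.surj, ?_, LinearMap.surjective_rangeRestrict _⟩
  intro φ
  constructor
  · intro hφ
    have h1 : i.dualMap φ = 0 := congrArg Subtype.val hφ
    have h2 : LinearMap.ker p ≤ LinearMap.ker φ := by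
      intro b hb
      obtain ⟨a, rfl⟩ := (h.exact b).1 hb
      exact LinearMap.congr_fun h1 a
    let e := p.quotKerEquivOfSurjective h.surj
    refine ⟨(Submodule.liftQ _ φ h2) ∘ₗ e.symm.toLinearMap, LinearMap.ext fun b => ?_⟩
    have : e.symm (p b) = Submodule.Quotient.mk b := by
      rw [LinearEquiv.symm_apply_eq]; rfl
    simp [LinearMap.dualMap_apply, this]
  · rintro ⟨ψ, rfl⟩
    apply Subtype.ext
    refine LinearMap.ext fun a => ?_
    have : p (i a) = 0 := (h.exact _).2 ⟨a, rfl⟩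
    simp [LinearMap.dualMap_apply, this]

variable [IsNoetherianRing R] [Module.Finite R B] [Module.Projective R B] 

lemma finite_dual [Module.Finite R A] : Module.Finite R (Module.Dual R A) := by
  infer_instance

lemma step_LC (hG : Good R I) (h : SES i p) (hC : FP I C) {j : ℕ} (hj : j + 1 < 9) (hl : LC I (j+2) (Module.Dual R C)) :
    LC I (j+1) (Module.Dual R A) := by
  have h1 : LC I (j+1) (LinearMap.range i.dualMap) := LC.right I (ses_dual h) (LC.proj I (hG.lc _ hj) _) hl
  have h2 : LC I (j+1) (Module.Dual R A ⧸ LinearMap.range i.dualMap) := 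
    LC.of_pt I j _ (pt_coker _ fun f hf φ => dual_coker_tors h hC f hf φ)
  have h3 := ses_sub (A := Module.Dual R A) (LinearMap.range (M := Module.Dual R B) (M₂ := Module.Dual R A) i.dualMap)
  exact LC.mid I h3 h1 h2

lemma step_surj (hG : Good R I) (h : SES i p) (hC : FP I C) (hl : LC I 2 (Module.Dual R C)) :
    Function.Surjective i.dualMap := by
  have h1 : LC I 1 (LinearMap.range i.dualMap) := LC.right I (ses_dual h) (LC.proj I (hG.lc _ (by omega)) _) hl
  have := surj_of_LC (LinearMap.range i.dualMap).subtype Subtype.val_injective h1 (LC.dual (hG.lc 0 (by omega))) (by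
    intro f hf φ
    rw [Submodule.range_subtype]
    exact dual_coker_tors h hC f hf φ)
  intro φ
  obtain ⟨⟨_, ψ, rfl⟩, rfl⟩ := this φ
  exact ⟨ψ, rfl⟩

lemma step_ext (hG : Good R I) (h : SES i p) (hC : FP I C) [Module.Finite R A] {j : ℕ} (hj : j + 1 < 9)
    (he : ExtZ R j (Module.Dual R C) R) : ExtZ R (j+1) (Module.Dual R A) R := by
  have h1 : ExtZ R (j+1) (LinearMap.range i.dualMap) R := ExtZ.right (ses_dual h) he ExtZ.of_projective
  have h2 : ExtZ R (j+1) (Module.Dual R A ⧸ LinearMap.range i.dualMap) R := 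
    hG.ext _ (pt_coker _ fun f hf φ => dual_coker_tors h hC f hf φ) _ hj
  have h3 := ses_sub (A := Module.Dual R A) (LinearMap.range (M := Module.Dual R B) (M₂ := Module.Dual R A) i.dualMap)
  exact ExtZ.mid h3 h1 h2

lemma extZ_of_dual_surj (h : SES i p) (hs : Function.Surjective i.dualMap) : ExtZ R 1 C R := by
  refine ExtZ.of_extend h fun φ => ?_
  obtain ⟨ψ, hψ⟩ := hs φ
  exact ⟨ψ, hψ⟩

end step

/-- properties of the form -/
structure FD (I : Ideal R) {E : Type} [AddCommGroup E] [Module R E] (ω : E →ₗ[R] E →ₗ[R] R) : Prop where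
  pf : PF ω
  gen : ∀ f ∈ I, ∃ (n k : ℕ) (c d : Fin k → E), f ^ n = ∑ i, ω (c i) (d i)
  uniq : ∀ β : E →ₗ[R] E →ₗ[R] R, (∀ a, β a a = 0) → ∃ s : R, β = s • ω

lemma span_form {E : Type} [AddCommGroup E] [Module R E] (ω : E →ₗ[R] E →ₗ[R] R) (z : R)
    (hz : z ∈ Ideal.span {r | ∃ a b, ω a b = r}) : ∃ (k : ℕ) (c d : Fin k → E), z = ∑ i, ω (c i) (d i) := by
  induction hz using Submodule.span_induction with
  | mem z hz =>
    obtain ⟨a, b, rfl⟩ := hz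
    exact ⟨1, fun _ => a, fun _ => b, by simp⟩
  | zero => exact ⟨0, Fin.elim0, Fin.elim0, by simp⟩
  | add z w _ _ hz hw =>
    obtain ⟨k, c, d, rfl⟩ := hz
    obtain ⟨k', c', d', rfl⟩ := hw
    exact ⟨k + k', Fin.append c c', Fin.append d d', by simp [Fin.sum_univ_add]⟩
  | smul t z _ hz =>
    obtain ⟨k, c, d, rfl⟩ := hz
    exact ⟨k, t • c, d, by simp [Finset.mul_sum]⟩

variable [IsDomain R] {E : Type} [AddCommGroup E] [Module R E] {ω : E →ₗ[R] E →ₗ[R] R}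

lemma PF.expand (h : PF ω) (a c d : E) : ω c d • a = ω a d • c - ω a c • d := by
  have := h.pl a c d
  rw [h.skew d a] at this
  linear_combination (norm := module) this

lemma FD.fp (h : FD I ω) : FP I E := by
  intro f hf
  obtain ⟨n, k, c, d, hcd⟩ := h.gen f hf
  let u : E →ₗ[R] (Fin k → R) × (Fin k → R) := 
    LinearMap.prod (LinearMap.pi fun i => ω.flip (d i)) (LinearMap.pi fun i => ω.flip (c i))
  let v : (Fin k → R) × (Fin k → R) →ₗ[R] E := 
    LinearMap.coprod (Fintype.linearCombination R c) (-(Fintype.linearCombination R d))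
  refine ⟨n, _, inferInstance, inferInstance, inferInstance, inferInstance, u, v, LinearMap.ext fun a => ?_⟩
  simp only [u, v, LinearMap.comp_apply, LinearMap.prod_apply, LinearMap.coprod_apply, 
    Fintype.linearCombination_apply, LinearMap.neg_apply, LinearMap.smul_apply, LinearMap.id_apply, hcd]
  rw [Finset.sum_smul, ← sub_eq_add_neg, ← Finset.sum_sub_distrib]
  exact Finset.sum_congr rfl fun i _ => (h.pf.expand _ _ _).symm

lemma FD.dual_eq (h : FD I ω) (f : R) (hf : f ∈ I) : ∃ n : ℕ, ∀ φ : Module.Dual R E, ∃ a, f ^ n • φ = ω a := by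
  obtain ⟨n, k, c, d, hcd⟩ := h.gen f hf
  refine ⟨n, fun φ => ⟨∑ i, (φ (d i) • c i - φ (c i) • d i), LinearMap.ext fun a => ?_⟩⟩
  rw [LinearMap.smul_apply, ← map_smul, hcd, Finset.sum_smul, map_sum, map_sum, LinearMap.sum_apply]
  refine Finset.sum_congr rfl fun i _ => ?_
  rw [h.pf.expand]
  simp only [map_sub, map_smul, LinearMap.sub_apply, LinearMap.smul_apply, smul_eq_mul]
  rw [h.pf.skew (d i) a, h.pf.skew (c i) a]; ring

lemma FD.inj [IsNoetherianRing R] (h : FD I ω) (h0 : LC I 0 E) : Function.Injective ω := by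
  rw [← LinearMap.ker_eq_bot, LinearMap.ker_eq_bot']
  intro a ha
  refine h0.elem a fun f hf => ?_
  obtain ⟨n, k, c, d, hcd⟩ := h.gen f hf
  refine ⟨n, ?_⟩
  rw [hcd, Finset.sum_smul]
  refine Finset.sum_eq_zero fun i _ => ?_
  rw [h.pf.expand, ha]; simp

lemma FD.surj [IsNoetherianRing R] (hG : Good R I) (h : FD I ω) (h0 : LC I 0 E) (h1 : LC I 1 E) : Function.Surjective ω := by
  refine surj_of_LC (B := Module.Dual R E) ω (h.inj h0) h1 (LC.dual (hG.lc 0 (by omega))) ?_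
  intro f hf φ
  obtain ⟨n, hn⟩ := h.dual_eq f hf
  obtain ⟨a, ha⟩ := hn φ
  exact ⟨n, a, ha.symm⟩
end goodSec
end partF1

section partF2
section coneSec
set_option linter.unusedSectionVars false
variable {R : Type} [CommRing R]

/-- graded complex given by a differential and idempotents -/
structure GC {T : Type} [AddCommGroup T] [Module R T] (d : T →ₗ[R] T) (π : ℤ → T →ₗ[R] T) (a b : ℤ) : Prop where
  dd : ∀ t, d (d t) = 0
  comm : ∀ i t, π (i+1) (d t) = d (π i t)
  idem : ∀ i t, π i (π i t) = π i t
  orth : ∀ i j t, i ≠ j → π i (π j t) = 0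
  sum : ∀ t, ∑ i ∈ Finset.Icc a b, π i t = t

/-- the properties of the complex T -/
structure TP (I : Ideal R) {T F E : Type} [AddCommGroup T] [Module R T] [AddCommGroup F] [Module R F]
    [AddCommGroup E] [Module R E] (d : T →ₗ[R] T) (π : ℤ → T →ₗ[R] T) (q : F →ₗ[R] E)
    (P : F →ₗ[R] Module.Dual R T) : Prop where
  gc : GC d π (-2) 2
  neg : ∀ i < 0, ∀ z, π i z = z → d z = 0 → ∃ y, d y = z
  pos : ∀ f ∈ I, ∀ i > 0, ∀ z, π i z = z → d z = 0 → ∃ (n : ℕ) (y : T), d y = f ^ n • z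
  Pd : ∀ x t, P x (d t) = 0
  Pπ : ∀ x t, P x (π 0 t) = P x t
  Pker : ∀ x, q x = 0 → ∃ l : Module.Dual R T, ∀ t, P x t = l (d t)
  Pzero : ∀ z, π 0 z = z → d z = 0 → (∀ x, P x z = 0) → ∃ y, d y = z
  Plift : ∀ φ : Module.Dual R E, ∃ z, π 0 z = z ∧ d z = 0 ∧ ∀ x, P x z = φ (q x)

lemma lift_range {A B C : Type} [AddCommGroup A] [Module R A] [AddCommGroup B] [Module R B] [AddCommGroup C] [Module R C]
    [Module.Projective R A] (g : A →ₗ[R] C) (d : B →ₗ[R] C) (h : ∀ a, ∃ b, d b = g a) : ∃ s : A →ₗ[R] B, ∀ a, d (s a) = g a := by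
  obtain ⟨s, hs⟩ := Module.projective_lifting_property d.rangeRestrict (LinearMap.codRestrict (LinearMap.range d) g h) d.surjective_rangeRestrict
  exact ⟨s, fun a => congrArg Subtype.val (LinearMap.congr_fun hs a)⟩

variable {L5 L4 L3 L2 L1 F0 F1 X E : Type} [AddCommGroup L5] [Module R L5] [AddCommGroup L4] [Module R L4]
  [AddCommGroup L3] [Module R L3] [AddCommGroup L2] [Module R L2] [AddCommGroup L1] [Module R L1]
  [AddCommGroup F0] [Module R F0] [AddCommGroup F1] [Module R F1] [AddCommGroup X] [Module R X]
  [AddCommGroup E] [Module R E]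
  [Module.Finite R L5] [Module.Projective R L5] [Module.Finite R L4] [Module.Projective R L4]
  [Module.Finite R L3] [Module.Projective R L3] [Module.Finite R L2] [Module.Projective R L2]
  [Module.Finite R L1] [Module.Projective R L1] [Module.Finite R F0] [Module.Projective R F0]
  [Module.Finite R F1] [Module.Projective R F1] 

/-- the cone differential -/
def coneD {G0 G1 : Type} [AddCommGroup G0] [Module R G0] [AddCommGroup G1] [Module R G1]
    (d5 : L5 →ₗ[R] L4) (d4 : L4 →ₗ[R] L3) (d3 : L3 →ₗ[R] L2) (d2 : L2 →ₗ[R] L1) (dF : G0 →ₗ[R] G1) 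
    (α0 : G0 →ₗ[R] L2) (α1 : G1 →ₗ[R] L1) : 
    (L5 × L4 × L3 × G0 × L2 × G1 × L1) →ₗ[R] (L5 × L4 × L3 × G0 × L2 × G1 × L1) where
  toFun := fun t => (0, d5 t.1, d4 t.2.1, 0, d3 t.2.2.1 - α0 t.2.2.2.1, dF t.2.2.2.1, d2 t.2.2.2.2.1 + α1 t.2.2.2.2.2.1)
  map_add' := by
    rintro ⟨a1, a2, a3, a4, a5, a6, a7⟩ ⟨b1, b2, b3, b4, b5, b6, b7⟩
    simp only [Prod.mk_add_mk, map_add, add_zero, Prod.mk.injEq, true_and]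
    exact ⟨by abel, by abel⟩
  map_smul' := by
    rintro r ⟨a1, a2, a3, a4, a5, a6, a7⟩
    simp only [Prod.smul_mk, map_smul, smul_zero, smul_add, smul_sub, RingHom.id_apply]

/-- the cone projections -/
def conePi {G0 G1 : Type} [AddCommGroup G0] [Module R G0] [AddCommGroup G1] [Module R G1] (c : ℤ → ℤ → R) (i : ℤ) : 
    (L5 × L4 × L3 × G0 × L2 × G1 × L1) →ₗ[R] (L5 × L4 × L3 × G0 × L2 × G1 × L1) where
  toFun := fun t => (c i (-2) • t.1, c i (-1) • t.2.1, c i 0 • t.2.2.1, c i 0 • t.2.2.2.1, c i 1 • t.2.2.2.2.1, 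
        c i 1 • t.2.2.2.2.2.1, c i 2 • t.2.2.2.2.2.2)
  map_add' := by
    rintro ⟨a1, a2, a3, a4, a5, a6, a7⟩ ⟨b1, b2, b3, b4, b5, b6, b7⟩
    simp only [Prod.mk_add_mk, smul_add]
  map_smul' := by
    rintro r ⟨a1, a2, a3, a4, a5, a6, a7⟩
    simp only [Prod.smul_mk, RingHom.id_apply, smul_comm r]

lemma cone (I : Ideal R) (d5 : L5 →ₗ[R] L4) (d4 : L4 →ₗ[R] L3) (d3 : L3 →ₗ[R] L2) (d2 : L2 →ₗ[R] L1) (b : L1 →ₗ[R] X)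
    (h5 : Function.Injective d5) (h4 : Function.Exact d5 d4) (h3 : Function.Exact d4 d3) (h2 : Function.Exact d3 d2)
    (h1 : Function.Exact d2 b) (h0 : Function.Surjective b) (q : F0 →ₗ[R] E) (u : F1 →ₗ[R] F0)
    (hq : Function.Surjective q) (hu : Function.Exact u q) (e : Module.Dual R F1 →ₗ[R] X)
    (heu : ∀ x, e (u.dualMap x) = 0)
    (t1 : ∀ f ∈ I, ∀ y, e y = 0 → ∃ (n : ℕ) (x : Module.Dual R F0), u.dualMap x = f ^ n • y)
    (t2 : ∀ f ∈ I, ∀ y, ∃ (n : ℕ) (x : Module.Dual R F1), e x = f ^ n • y) :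
    ∃ (T : Type) (_ : AddCommGroup T) (_ : Module R T) (_ : Module.Finite R T) (_ : Module.Projective R T)
      (d : T →ₗ[R] T) (π : ℤ → T →ₗ[R] T) (P : F0 →ₗ[R] Module.Dual R T), TP I d π q P ∧
      ((∀ z, π 1 z = z → d z = 0 → ∃ y, d y = z) → ∀ y, e y = 0 → ∃ x, u.dualMap x = y) ∧
      ((∀ z, π 2 z = z → ∃ y, d y = z) → Function.Surjective e) := by
  obtain ⟨α1, hα1⟩ := Module.projective_lifting_property b e h0
  replace hα1 : ∀ y, b (α1 y) = e y := fun y => LinearMap.congr_fun hα1 y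
  obtain ⟨α0, hα0⟩ := lift_range (α1 ∘ₗ u.dualMap) d2 (by
    intro a
    refine (h1 _).1 ?_
    simp only [LinearMap.comp_apply]
    rw [hα1, heu])
  simp only [LinearMap.comp_apply] at hα0
  have hd4 : ∀ x, d4 (d5 x) = 0 := fun x => (h4 _).2 ⟨x, rfl⟩
  have hd3 : ∀ x, d3 (d4 x) = 0 := fun x => (h3 _).2 ⟨x, rfl⟩
  have hd2 : ∀ x, d2 (d3 x) = 0 := fun x => (h2 _).2 ⟨x, rfl⟩
  let dF : Module.Dual R F0 →ₗ[R] Module.Dual R F1 := u.dualMap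
  let c : ℤ → ℤ → R := fun i j => if i = j then 1 else 0
  let d := coneD d5 d4 d3 d2 dF α0 α1
  let π := conePi (L5 := L5) (L4 := L4) (L3 := L3) (L2 := L2) (L1 := L1) (G0 := Module.Dual R F0) (G1 := Module.Dual R F1) c
  let P : F0 →ₗ[R] Module.Dual R (L5 × L4 × L3 × Module.Dual R F0 × L2 × Module.Dual R F1 × L1) := LinearMap.mk₂ R (fun x t => t.2.2.2.1 x) 
    (by intros; simp) (by intros; simp) (by intros; simp) (by intros; simp)
  have hd : ∀ a1 a2 a3 a4 a5 a6 a7, d (a1, a2, a3, a4, a5, a6, a7) = 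
    (0, d5 a1, d4 a2, 0, d3 a3 - α0 a4, dF a4, d2 a5 + α1 a6) := fun _ _ _ _ _ _ _ => rfl
  have hπ : ∀ i a1 a2 a3 a4 a5 a6 a7, π i (a1, a2, a3, a4, a5, a6, a7) = 
    (c i (-2) • a1, c i (-1) • a2, c i 0 • a3, c i 0 • a4, c i 1 • a5, c i 1 • a6, c i 2 • a7) := fun _ _ _ _ _ _ _ _ => rfl
  have hP : ∀ x a1 a2 a3 a4 a5 a6 a7, P x (a1, a2, a3, a4, a5, a6, a7) = a4 x := fun _ _ _ _ _ _ _ _ => rfl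
  have hc : ∀ i j, c i j = if i = j then 1 else 0 := fun _ _ => rfl
  have hcc : ∀ i j, c i j * c i j = c i j := by intro i j; rw [hc]; split_ifs <;> simp
  have hcc' : ∀ i i' j, i ≠ i' → c i j * c i' j = 0 := by
    intro i i' j h; rw [hc, hc]; split_ifs <;> simp; omega
  have hc1 : ∀ i j k, k = j + 1 → c (i+1) k = c i j := by
    intro i j k h; rw [hc, hc]; split_ifs <;> first | rfl | omega
  have hdF : ∀ x, dF x = u.dualMap x := fun _ => rfl
  have duz : ∀ x : Module.Dual R F0, dF x = 0 → ∃ φ : Module.Dual R E, ∀ y, x y = φ (q y) := by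
    intro x hx
    have h2 : LinearMap.ker q ≤ LinearMap.ker (x : F0 →ₗ[R] R) := by
      intro y hy
      obtain ⟨a, rfl⟩ := (hu y).1 hy
      exact LinearMap.congr_fun hx a
    let ee := q.quotKerEquivOfSurjective hq
    refine ⟨(Submodule.liftQ _ x h2) ∘ₗ ee.symm.toLinearMap, fun y => ?_⟩
    have : ee.symm (q y) = Submodule.Quotient.mk y := by
      rw [LinearEquiv.symm_apply_eq]; rfl
    simp [this]
  have gc : GC d π (-2) 2 := by
    refine ⟨?_, ?_, ?_, ?_, ?_⟩
    · rintro ⟨a1, a2, a3, a4, a5, a6, a7⟩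
      simp only [hd, map_zero, hd4, hd3, map_sub, hd2, hα0, hdF]
      simp
    · rintro i ⟨a1, a2, a3, a4, a5, a6, a7⟩
      simp only [hd, hπ, hc1 i (-2) (-1) rfl, hc1 i (-1) 0 rfl, hc1 i 0 1 rfl, hc1 i 1 2 rfl, map_smul, smul_zero, smul_sub, smul_add]
    · rintro i ⟨a1, a2, a3, a4, a5, a6, a7⟩
      simp only [hπ, smul_smul, hcc]
    · rintro i j ⟨a1, a2, a3, a4, a5, a6, a7⟩ hij
      simp only [hπ, smul_smul, hcc' i j _ hij, zero_smul]; rfl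
    · rintro ⟨a1, a2, a3, a4, a5, a6, a7⟩
      have : Finset.Icc (-2 : ℤ) 2 = {-2, -1, 0, 1, 2} := by decide
      rw [this]
      simp [hπ, hc]
  refine ⟨(L5 × L4 × L3 × Module.Dual R F0 × L2 × Module.Dual R F1 × L1), inferInstance, inferInstance, inferInstance, inferInstance, d, π, P, ⟨gc, ?_, ?_, ?_, ?_, ?_, ?_, ?_⟩, ?_, ?_⟩
  · rintro i hi ⟨a1, a2, a3, a4, a5, a6, a7⟩ hz hdz
    rw [hπ, hc, hc, hc, hc, hc, if_neg (show i ≠ 0 by omega), if_neg (show i ≠ 1 by omega), if_neg (show i ≠ 2 by omega)] at hz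
    simp only [zero_smul, Prod.mk.injEq] at hz
    obtain ⟨hz1, hz2, rfl, rfl, rfl, rfl, rfl⟩ := hz
    rw [hd] at hdz
    simp only [Prod.mk_eq_zero] at hdz
    have e1 : a1 = 0 := h5 (by rw [hdz.2.1, map_zero])
    obtain ⟨y, rfl⟩ := (h4 a2).1 hdz.2.2.1
    refine ⟨(y, 0, 0, 0, 0, 0, 0), ?_⟩
    rw [hd, e1]; simp
  · rintro f hf i hi ⟨a1, a2, a3, a4, a5, a6, a7⟩ hz hdz
    rw [hπ, hc, hc, hc, hc, hc, if_neg (show i ≠ 0 by omega), if_neg (show i ≠ -1 by omega), if_neg (show i ≠ -2 by omega)] at hz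
    simp only [zero_smul, Prod.mk.injEq] at hz
    obtain ⟨rfl, rfl, rfl, rfl, hz5, hz6, hz7⟩ := hz
    by_cases h12 : i = 1
    · rw [if_neg (by omega), zero_smul] at hz7
      subst hz7
      rw [hd] at hdz
      simp only [Prod.mk_eq_zero] at hdz
      have k1 := hdz.2.2.2.2.2.2
      have k2 : e a6 = 0 := by
        rw [← hα1, eq_neg_of_add_eq_zero_right k1, map_neg, (h1 _).2 ⟨a5, rfl⟩, neg_zero]
      obtain ⟨n, x, hx⟩ := t1 f hf a6 k2
      have k3 : d2 (f ^ n • a5 + α0 x) = 0 := by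
        rw [map_add, hα0, hx, map_smul, map_smul, ← smul_add, k1, smul_zero]
      obtain ⟨l, hl⟩ := (h2 _).1 k3
      refine ⟨n, (0, 0, l, x, 0, 0, 0), ?_⟩
      rw [hd, hl, hdF, hx]; simp
    · rw [if_neg h12, zero_smul] at hz5 hz6
      subst hz5 hz6
      obtain ⟨n, y, hy⟩ := t2 f hf (b a7)
      have k3 : b (f ^ n • a7 - α1 y) = 0 := by
        rw [map_sub, hα1, hy, map_smul, sub_self]
      obtain ⟨l, hl⟩ := (h1 _).1 k3
      refine ⟨n, (0, 0, 0, 0, l, y, 0), ?_⟩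
      rw [hd, hl]; simp
  · rintro x ⟨a1, a2, a3, a4, a5, a6, a7⟩
    rw [hd, hP]; rfl
  · rintro x ⟨a1, a2, a3, a4, a5, a6, a7⟩
    rw [hπ, hP, hP]; simp [hc]
  · intro x hx
    obtain ⟨y, rfl⟩ := (hu x).1 hx
    let l : Module.Dual R (L5 × L4 × L3 × Module.Dual R F0 × L2 × Module.Dual R F1 × L1) := 
      { toFun := fun t => t.2.2.2.2.2.1 y
        map_add' := by intros; simp
        map_smul' := by intros; simp }
    exact ⟨l, fun t => rfl⟩
  · rintro ⟨a1, a2, a3, a4, a5, a6, a7⟩ hz hdz hp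
    rw [hπ] at hz
    simp [hc] at hz
    obtain ⟨h01, h02, h03, h04, h05⟩ := hz
    rw [hd] at hdz
    simp only [Prod.mk_eq_zero] at hdz
    have : a4 = 0 := LinearMap.ext fun x => hp x
    have k := hdz.2.2.2.2.1
    rw [this, map_zero, sub_zero] at k
    obtain ⟨y, rfl⟩ := (h3 a3).1 k
    refine ⟨(0, y, 0, 0, 0, 0, 0), ?_⟩
    rw [hd, this, ← h01, ← h02, ← h03, ← h04, ← h05]; simp
  · intro φ
    let x : Module.Dual R F0 := φ ∘ₗ q
    have hx : dF x = 0 := LinearMap.ext fun y => by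
      show φ (q (u y)) = 0
      rw [(hu _).2 ⟨y, rfl⟩, map_zero]
    obtain ⟨l, hl⟩ := (h2 (α0 x)).1 (by rw [hα0, ← hdF, hx, map_zero])
    refine ⟨(0, 0, l, x, 0, 0, 0), ?_, ?_, fun y => rfl⟩
    · rw [hπ]; simp [hc]
    · rw [hd, hl, hx]; simp
  · intro hex y hy
    obtain ⟨l, hl⟩ := (h1 (- α1 y)).1 (by rw [map_neg, hα1, hy, neg_zero])
    obtain ⟨⟨a1, a2, a3, a4, a5, a6, a7⟩, hz⟩ := hex (0, 0, 0, 0, l, y, 0) (by rw [hπ]; simp [hc]) (by rw [hd, hl]; simp)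
    rw [hd] at hz
    simp only [Prod.mk.injEq] at hz
    exact ⟨a4, hz.2.2.2.2.2.1⟩
  · intro hex x
    obtain ⟨l, rfl⟩ := h0 x
    obtain ⟨⟨a1, a2, a3, a4, a5, a6, a7⟩, hz⟩ := hex (0, 0, 0, 0, 0, 0, l) (by rw [hπ]; simp [hc])
    rw [hd] at hz
    simp only [Prod.mk.injEq] at hz
    refine ⟨a6, ?_⟩
    rw [← hz.2.2.2.2.2.2, map_add, hα1, (h1 _).2 ⟨a5, rfl⟩, zero_add]
end coneSec
end partF2

section partF3
section f3Sec
set_option linter.unusedSectionVars false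
variable {R : Type} [CommRing R] 

lemma exists_cover' [IsNoetherianRing R] (M : Type) [AddCommGroup M] [Module R M] [Module.Finite R M] :
    ∃ (k : ℕ) (A : Type) (_ : AddCommGroup A) (_ : Module R A) (_ : Module.Finite R A) (i : A →ₗ[R] (Fin k → R))
      (g : (Fin k → R) →ₗ[R] M), SES i g := by
  obtain ⟨k, g, h, hf⟩ := exists_cover (R := R) M
  exact ⟨k, _, inferInstance, inferInstance, hf, _, g, h⟩

lemma SES.comp_exact {A B C D : Type} [AddCommGroup A] [AddCommGroup B] [AddCommGroup C] [AddCommGroup D]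
    [Module R A] [Module R B] [Module R C] [Module R D] {i : A →ₗ[R] B} {p : B →ₗ[R] C} (h : SES i p) 
    (g : D →ₗ[R] A) (hg : Function.Surjective g) : Function.Exact (i ∘ₗ g) p := by
  intro b
  rw [h.exact b]
  constructor
  · rintro ⟨a, rfl⟩
    obtain ⟨d, rfl⟩ := hg a
    exact ⟨d, rfl⟩
  · rintro ⟨d, rfl⟩
    exact ⟨g d, rfl⟩

lemma SES.exact_comp {A B C D : Type} [AddCommGroup A] [AddCommGroup B] [AddCommGroup C] [AddCommGroup D]
    [Module R A] [Module R B] [Module R C] [Module R D] {p : B →ₗ[R] C} (j : D →ₗ[R] B)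
    (h : Function.Exact j p) (i : C →ₗ[R] A) (hi : Function.Injective i) : Function.Exact j (i ∘ₗ p) := by
  intro b
  rw [← h b, LinearMap.comp_apply, map_eq_zero_iff _ hi]

lemma ses_dual_surj {A B C : Type} [AddCommGroup A] [AddCommGroup B] [AddCommGroup C] 
    [Module R A] [Module R B] [Module R C] {i : A →ₗ[R] B} {p : B →ₗ[R] C} (h : SES i p) 
    (hs : Function.Surjective i.dualMap) : SES p.dualMap i.dualMap := by
  refine ⟨(ses_dual h).inj, ?_, hs⟩
  intro φ
  rw [← (ses_dual h).exact φ]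
  exact ⟨fun h => Subtype.ext h, fun h => congrArg Subtype.val h⟩

theorem exists_TP [IsNoetherianRing R] [IsDomain R] (I : Ideal R) (hG : Good R I) (E : Type) [AddCommGroup E] [Module R E] [Module.Finite R E]
    (ω : E →ₗ[R] E →ₗ[R] R) (hω : FD I ω) (l0 : LC I 0 E) (l1 : LC I 1 E) (l4 : LC I 4 E) (l5 : LC I 5 E) :
    ∃ (F : Type) (_ : AddCommGroup F) (_ : Module R F) (T : Type) (_ : AddCommGroup T) (_ : Module R T) 
      (_ : Module.Finite R T) (_ : Module.Projective R T)
      (d : T →ₗ[R] T) (π : ℤ → T →ₗ[R] T) (q : F →ₗ[R] E) (P : F →ₗ[R] Module.Dual R T), 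
      Function.Surjective q ∧ TP I d π q P ∧
      ((∀ z, π 1 z = z → d z = 0 → ∃ y, d y = z) → (∀ z, π 2 z = z → ∃ y, d y = z) → Module.Projective R E) := by
  let e : E ≃ₗ[R] Module.Dual R E := LinearEquiv.ofBijective ω ⟨hω.inj l0, hω.surj hG l0 l1⟩
  have l4' : LC I 4 (Module.Dual R E) := LC.iso I e.symm l4
  have l5' : LC I 5 (Module.Dual R E) := LC.iso I e.symm l5
  obtain ⟨k0, A1, _, _, _, i1, g0, h0⟩ := exists_cover' (R := R) E
  obtain ⟨k1, A2, _, _, _, i2, g1, h1⟩ := exists_cover' (R := R) A1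
  obtain ⟨k2, A3, _, _, _, i3, g2, h2⟩ := exists_cover' (R := R) A2
  obtain ⟨k3, A4, _, _, _, i4, g3, h3⟩ := exists_cover' (R := R) A3
  obtain ⟨k4, A5, _, _, _, i5, g4, h4⟩ := exists_cover' (R := R) A4
  obtain ⟨k5, A6, _, _, _, i6, g5, h5⟩ := exists_cover' (R := R) A5
  have p0 : FP I E := hω.fp
  have p1 : FP I A1 := p0.syz h0
  have p2 : FP I A2 := p1.syz h1
  have p3 : FP I A3 := p2.syz h2
  have s3 : Function.Surjective i3.dualMap := 
    step_surj hG h2 p2 (step_LC hG h1 p1 (j := 1) (by omega) (step_LC hG h0 p0 (j := 2) (by omega) l4'))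
  have s4 : Function.Surjective i4.dualMap := 
    step_surj hG h3 p3 (step_LC hG h2 p2 (j := 1) (by omega) (step_LC hG h1 p1 (j := 2) (by omega) 
      (step_LC hG h0 p0 (j := 3) (by omega) l5')))
  have x1 : ExtZ R 1 A2 R := extZ_of_dual_surj h2 s3
  have x2 : ExtZ R 2 A1 R := ExtZ.right h1 x1 ExtZ.of_projective
  have x3 : ExtZ R 3 E R := ExtZ.right h0 x2 ExtZ.of_projective
  have y3 : ExtZ R 3 (Module.Dual R E) R := ExtZ.iso e.symm x3
  have y6 : ExtZ R 6 (Module.Dual R A3) R := step_ext hG h2 p2 (by omega) (step_ext hG h1 p1 (by omega) 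
    (step_ext hG h0 p0 (by omega) y3))
  have b5 : PD R 9 (LinearMap.range (M := Module.Dual R (Fin k4 → R)) (M₂ := Module.Dual R A5) i5.dualMap) := by
    let m : LinearMap.range (M := Module.Dual R (Fin k4 → R)) (M₂ := Module.Dual R A5) i5.dualMap →ₗ[R] 
      Module.Dual R (Fin k5 → R) := g5.dualMap ∘ₗ (Submodule.subtype _)
    have hm : Function.Injective m := (ses_dual h5).inj.comp Subtype.val_injective
    exact PD.left (ses_coker m hm) PD.proj (hG.gld _)
  have d4 : PD R 8 (Module.Dual R A4) := PD.left (ses_dual h4) PD.proj b5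
  have d3 : PD R 7 (Module.Dual R A3) := PD.left (ses_dual_surj h3 s4) PD.proj d4
  have d3' : PD R 6 (Module.Dual R A3) := PD.drop 5 _ d3 y6
  have d2 : PD R 5 (Module.Dual R A2) := PD.left (ses_dual_surj h2 s3) PD.proj d3'
  obtain ⟨m1, K1, _, _, _, j1, c1, w1⟩ := exists_cover' (R := R) (Module.Dual R A2)
  obtain ⟨m2, K2, _, _, _, j2, c2, w2⟩ := exists_cover' (R := R) K1
  obtain ⟨m3, K3, _, _, _, j3, c3, w3⟩ := exists_cover' (R := R) K2
  obtain ⟨m4, K4, _, _, _, j4, c4, w4⟩ := exists_cover' (R := R) K3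
  have e1 : PD R 4 K1 := PD.left w1 PD.proj d2
  have e2 : PD R 3 K2 := PD.left w2 PD.proj e1
  have e3 : PD R 2 K3 := PD.left w3 PD.proj e2
  have e4 : PD R 1 K4 := PD.left w4 PD.proj e3
  have : Module.Projective R K4 := PD.one_iff.1 e4
  have kerr : ∀ y : Module.Dual R (Fin k1 → R), i2.dualMap y = 0 → ∃ ψ : Module.Dual R A1, g1.dualMap ψ = y := by
    intro y hy
    obtain ⟨ψ, hψ⟩ := ((ses_dual h1).exact y).1 (Subtype.ext hy)
    exact ⟨ψ, hψ⟩
  have hcomp : ∀ x : Module.Dual R (Fin k0 → R), (i1 ∘ₗ g1).dualMap x = g1.dualMap (i1.dualMap x) := fun x => rfl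
  obtain ⟨T, _, _, _, _, d, π, P, hT, hr1, hr2⟩ := cone I j4 (j3 ∘ₗ c4) (j2 ∘ₗ c3) (j1 ∘ₗ c2) c1 w4.inj
    (SES.exact_comp _ w4.exact _ w3.inj) 
    (SES.exact_comp _ (w3.comp_exact _ w4.surj) _ w2.inj) 
    (SES.exact_comp _ (w2.comp_exact _ w3.surj) _ w1.inj) 
    (w1.comp_exact _ w2.surj) w1.surj g0 (i1 ∘ₗ g1) h0.surj (h0.comp_exact _ h1.surj) i2.dualMap 
    (fun x => LinearMap.ext fun a => by
      show x (i1 (g1 (i2 a))) = 0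
      rw [(h1.exact _).2 ⟨a, rfl⟩, map_zero, map_zero])
    (by
      intro f hf y hy
      obtain ⟨ψ, rfl⟩ := kerr y hy
      obtain ⟨n, x, hx⟩ := dual_coker_tors h0 p0 f hf ψ
      exact ⟨n, x, by rw [hcomp, hx, map_smul]⟩)
    (by
      intro f hf y
      obtain ⟨n, x, hx⟩ := dual_coker_tors h1 p1 f hf y
      exact ⟨n, x, hx⟩)
  refine ⟨_, _, _, T, _, _, inferInstance, inferInstance, d, π, g0, P, h0.surj, hT, fun ex1 ex2 => ?_⟩
  have s2 : Function.Surjective i2.dualMap := hr2 ex2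
  have s1 : Function.Surjective i1.dualMap := by
    intro ψ
    obtain ⟨x, hx⟩ := hr1 ex1 (g1.dualMap ψ) (LinearMap.ext fun a => by
      show ψ (g1 (i2 a)) = 0
      rw [(h1.exact _).2 ⟨a, rfl⟩, map_zero])
    refine ⟨x, (ses_dual h1).inj ?_⟩
    rw [← hx, hcomp]
  have d1 : PD R 4 (Module.Dual R A1) := PD.left (ses_dual_surj h1 s2) PD.proj d2
  have d0 : PD R 3 (Module.Dual R E) := PD.left (ses_dual_surj h0 s1) PD.proj d1
  have z1 : ExtZ R 1 E R := extZ_of_dual_surj h0 s1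
  have z2 : ExtZ R 2 E R := ExtZ.right h0 (extZ_of_dual_surj h1 s2) ExtZ.of_projective
  have d0' : PD R 2 (Module.Dual R E) := PD.drop 1 _ d0 (ExtZ.iso e.symm z2)
  have d0'' : PD R 1 (Module.Dual R E) := PD.drop 0 _ d0' (ExtZ.iso e.symm z1)
  have := PD.one_iff.1 d0''
  exact Module.Projective.of_equiv e.symm
end f3Sec
end partF3

section partG1
section g1Sec
set_option linter.unusedSectionVars false
variable {R : Type} [CommRing R] [IsNoetherianRing R] {I : Ideal R} {C : Type} [AddCommGroup C] [Module R C]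

/-- graded piece -/
def Cs (π : ℤ → C →ₗ[R] C) (k : ℤ) : Submodule R C where
  carrier := {z | π k z = z}
  add_mem' := by intro a b ha hb; simp only [Set.mem_setOf_eq] at *; rw [map_add, ha, hb]
  zero_mem' := by simp
  smul_mem' := by intro r a ha; simp only [Set.mem_setOf_eq] at *; rw [map_smul, ha]

/-- cycles -/
def Zs (d : C →ₗ[R] C) (π : ℤ → C →ₗ[R] C) (k : ℤ) : Submodule R C where
  carrier := {z | π k z = z ∧ d z = 0}
  add_mem' := by
    rintro a b ⟨h1, h2⟩ ⟨h3, h4⟩; exact ⟨by rw [map_add, h1, h3], by rw [map_add, h2, h4, add_zero]⟩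
  zero_mem' := by simp
  smul_mem' := by rintro r a ⟨h1, h2⟩; exact ⟨by rw [map_smul, h1], by rw [map_smul, h2, smul_zero]⟩

/-- boundaries -/
def Bs (d : C →ₗ[R] C) (π : ℤ → C →ₗ[R] C) (k : ℤ) : Submodule R C where
  carrier := {z | π k z = z ∧ ∃ y, d y = z}
  add_mem' := by
    rintro a b ⟨h1, y, rfl⟩ ⟨h3, z, rfl⟩; exact ⟨by rw [map_add, h1, h3], y + z, map_add _ _ _⟩
  zero_mem' := ⟨map_zero _, 0, map_zero _⟩
  smul_mem' := by rintro r a ⟨h1, y, rfl⟩; exact ⟨by rw [map_smul, h1], r • y, map_smul _ _ _⟩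

variable {d : C →ₗ[R] C} {π : ℤ → C →ₗ[R] C} {a b : ℤ} 

lemma GC.Bs_le_Zs (gc : GC d π a b) (k : ℤ) : Bs d π k ≤ Zs d π k := by
  rintro z ⟨h, y, rfl⟩
  exact ⟨h, gc.dd y⟩

lemma GC.zero (gc : GC d π a b) (k : ℤ) (hk : k < a ∨ b < k) (t : C) : π k t = 0 := by
  rw [← gc.sum t, map_sum]
  refine Finset.sum_eq_zero fun i hi => gc.orth _ _ _ ?_
  rw [Finset.mem_Icc] at hi
  omega

lemma GC.proj_Cs (gc : GC d π a b) (k : ℤ) [Module.Projective R C] : Module.Projective R (Cs π k) := by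
  refine Module.Projective.of_split (Cs π k).subtype (LinearMap.codRestrict (Cs π k) (π k) fun t => gc.idem k t) ?_
  refine LinearMap.ext fun t => Subtype.ext ?_
  exact t.2

/-- the short exact sequence -/
lemma GC.ses (gc : GC d π a b) (k : ℤ) : ∃ (i : Zs d π k →ₗ[R] Cs π k) (p : Cs π k →ₗ[R] Bs d π (k+1)), SES i p := by
  let i : Zs d π k →ₗ[R] Cs π k := Submodule.inclusion fun z hz => hz.1
  let p : Cs π k →ₗ[R] Bs d π (k+1) := LinearMap.codRestrict (Bs d π (k+1)) (d ∘ₗ (Cs π k).subtype) (fun t => by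
    have := t.2
    refine ⟨?_, t.1, rfl⟩
    simp only [LinearMap.comp_apply, Submodule.subtype_apply]
    rw [gc.comm, show π k t = t from this])
  refine ⟨i, p, Submodule.inclusion_injective _, ?_, ?_⟩
  · intro t
    constructor
    · intro h
      exact ⟨⟨t.1, t.2, congrArg Subtype.val h⟩, rfl⟩
    · rintro ⟨z, rfl⟩
      exact Subtype.ext z.2.2
  · rintro ⟨z, h, y, rfl⟩
    refine ⟨⟨π k y, gc.idem k y⟩, Subtype.ext ?_⟩
    show d (π k y) = d y
    rw [← gc.comm, h]

variable [Module.Finite R C] [Module.Projective R C] (hG : Good R I)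

lemma GC.lcC (hG : Good R I) (gc : GC d π a b) (k : ℤ) (i : ℕ) (hi : i < 9) : LC I i (Cs π k) := by
  have := gc.proj_Cs k
  exact LC.proj I (hG.lc i hi) _

lemma GC.lcSub (hG : Good R I) (gc : GC d π a b) (S : Submodule R C) : LC I 0 S := 
  LC.zero_of_inj I S.subtype Subtype.val_injective (LC.proj I (hG.lc 0 (by omega)) C)

lemma GC.lcB (hG : Good R I) (gc : GC d π a b) (k : ℤ) (m : ℕ) (hm : m ≤ 9) (hZ : ∀ i < m + 1, LC I i (Zs d π k)) : 
    ∀ i < m, LC I i (Bs d π (k+1)) := by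
  intro i hi
  obtain ⟨_, _, h⟩ := gc.ses k
  exact LC.right I h (gc.lcC hG k i (by omega)) (hZ _ (by omega))

lemma GC.ZB (hG : Good R I) (gc : GC d π a b) (k : ℤ) (hB : LC I 1 (Bs d π k))
    (tor : ∀ f ∈ I, ∀ z, π k z = z → d z = 0 → ∃ (n : ℕ) (y : C), d y = f ^ n • z) : Zs d π k = Bs d π k := by
  refine le_antisymm ?_ (gc.Bs_le_Zs k)
  have := surj_of_LC (Submodule.inclusion (gc.Bs_le_Zs k)) (Submodule.inclusion_injective _) hB (gc.lcSub hG _) (by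
    rintro f hf ⟨z, h1, h2⟩
    obtain ⟨n, y, hy⟩ := tor f hf z h1 h2
    exact ⟨n, ⟨f ^ n • z, by rw [map_smul, h1], y, hy⟩, rfl⟩)
  intro z hz
  obtain ⟨w, hw⟩ := this ⟨z, hz⟩
  have : (w : C) = z := congrArg Subtype.val hw
  rw [← this]; exact w.2

lemma GC.step (hG : Good R I) (gc : GC d π a b) (k k' : ℤ) (hk : k' = k + 1) (m : ℕ) (hm : m ≤ 9) (hm1 : 1 ≤ m) 
    (tor : ∀ f ∈ I, ∀ z, π k z = z → d z = 0 → ∃ (n : ℕ) (y : C), d y = f ^ n • z)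
    (hB : ∀ i < m + 1, LC I i (Bs d π k)) : ∀ i < m, LC I i (Bs d π k') := by
  subst hk
  have h := gc.ZB hG k (hB 1 (by omega)) tor
  exact gc.lcB hG k m hm (by rw [h]; exact hB)

theorem GC.chase (hG : Good R I) (gc : GC d π (-4) 4) 
    (tor : ∀ f ∈ I, ∀ k ≠ 0, ∀ z, π k z = z → d z = 0 → ∃ (n : ℕ) (y : C), d y = f ^ n • z)
    (Φ : Zs d π 0 →ₗ[R] R) (Φ0 : ∀ z : Zs d π 0, (∃ y, d y = z) → Φ z = 0)
    (Φ1 : ∀ z : Zs d π 0, Φ z = 0 → ∀ f ∈ I, ∃ (n : ℕ) (y : C), d y = f ^ n • z)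
    (Φ2 : ∀ f ∈ I, ∃ (n : ℕ) (z : Zs d π 0), Φ z = f ^ n) :
    ∀ k > 0, ∀ z, π k z = z → d z = 0 → ∃ y, d y = z := by
  have b4 : ∀ i < 10, LC I i (Bs d π (-4)) := by
    have h0 : ∀ z : Bs d π (-4), z = 0 := by
      rintro ⟨z, h, y, hy⟩
      apply Subtype.ext
      show z = 0
      have h1 := gc.comm (-5) y
      rw [gc.zero (-5) (by omega), map_zero, hy] at h1
      rw [← h]; exact h1
    intro i _
    rcases i with _ | i
    · exact gc.lcSub hG _
    · exact LC.of_pt I i _ fun z => ⟨0, fun r _ => by rw [h0 z, smul_zero]⟩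
  have t := fun (k : ℤ) (hk : k ≠ 0) f hf => tor f hf k hk
  have b3 := gc.step hG (-4) (-3) rfl 9 (by omega) (by omega) (t _ (by omega)) b4
  have b2 := gc.step hG (-3) (-2) rfl 8 (by omega) (by omega) (t _ (by omega)) b3
  have b1 := gc.step hG (-2) (-1) rfl 7 (by omega) (by omega) (t _ (by omega)) b2
  have b0 := gc.step hG (-1) (0) rfl 6 (by omega) (by omega) (t _ (by omega)) b1
  have z1 : LC I 1 (Zs d π 0) := by
    obtain ⟨_, _, h⟩ := gc.ses 0
    exact LC.left I h (gc.lcSub hG _) (gc.lcC hG 0 1 (by omega))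
  let ι : Bs d π 0 →ₗ[R] LinearMap.ker Φ := LinearMap.codRestrict _ (Submodule.inclusion (gc.Bs_le_Zs 0)) (by
    rintro ⟨z, h, y, rfl⟩
    exact Φ0 _ ⟨y, rfl⟩)
  have ιinj : Function.Injective ι := by
    intro x y h
    have := congrArg (fun z : LinearMap.ker Φ => (z.1.1 : C)) h
    exact Subtype.ext this
  have ιsurj : Function.Surjective ι := by
    refine surj_of_LC ι ιinj (b0 1 (by omega)) 
      (LC.zero_of_inj I (LinearMap.ker Φ).subtype Subtype.val_injective (gc.lcSub hG _)) ?_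
    rintro f hf ⟨z, hz⟩
    obtain ⟨n, y, hy⟩ := Φ1 z hz f hf
    refine ⟨n, ⟨f ^ n • z, ?_, y, hy⟩, rfl⟩
    rw [map_smul, z.2.1]
  let ε : Bs d π 0 ≃ₗ[R] LinearMap.ker Φ := LinearEquiv.ofBijective ι ⟨ιinj, ιsurj⟩
  have kk : ∀ i < 6, LC I i (LinearMap.ker Φ) := fun i hi => LC.iso I ε.symm (b0 i hi)
  have hsΦ : Function.Surjective Φ := by
    have j1 : LC I 1 (LinearMap.range Φ) := LC.right I (ses_ker Φ) z1 (kk 2 (by omega))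
    have := surj_of_LC (LinearMap.range Φ).subtype Subtype.val_injective j1 (hG.lc 0 (by omega)) (by
      intro f hf r
      obtain ⟨n, z, hz⟩ := Φ2 f hf
      rw [Submodule.range_subtype]
      exact ⟨n, r • z, by rw [map_smul, hz, smul_eq_mul, smul_eq_mul, mul_comm]⟩)
    intro r
    obtain ⟨⟨_, z, rfl⟩, rfl⟩ := this r
    exact ⟨z, rfl⟩
  have sesΦ : SES (LinearMap.ker Φ).subtype Φ := ⟨Subtype.val_injective, LinearMap.exact_subtype_ker_map Φ, hsΦ⟩
  have z0 : ∀ i < 6, LC I i (Zs d π 0) := fun i hi => LC.mid I sesΦ (kk i hi) (hG.lc i (by omega))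
  have c1 : ∀ i < 5, LC I i (Bs d π 1) := gc.lcB hG 0 5 (by omega) z0
  have c2 := gc.step hG 1 2 rfl 4 (by omega) (by omega) (t _ (by omega)) c1
  have c3 := gc.step hG 2 3 rfl 3 (by omega) (by omega) (t _ (by omega)) c2
  have c4 := gc.step hG 3 4 rfl 2 (by omega) (by omega) (t _ (by omega)) c3
  intro k hk z hz hdz
  have key : LC I 1 (Bs d π k) ∨ 4 < k := by
    by_cases h : 4 < k
    · exact Or.inr h
    · have : k = 1 ∨ k = 2 ∨ k = 3 ∨ k = 4 := by omega
      rcases this with rfl | rfl | rfl | rfl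
      · exact Or.inl (c1 1 (by omega))
      · exact Or.inl (c2 1 (by omega))
      · exact Or.inl (c3 1 (by omega))
      · exact Or.inl (c4 1 (by omega))
  rcases key with h | h
  · have := gc.ZB hG k h (t k (by omega))
    have hz' : z ∈ Zs d π k := ⟨hz, hdz⟩
    rw [this] at hz'
    exact hz'.2
  · rw [gc.zero k (by omega)] at hz
    exact ⟨0, by rw [← hz, map_zero]⟩
end g1Sec
end partG1

section partG2
section g2Sec
set_option linter.unusedSectionVars false
variable {R : Type} [CommRing R] {I : Ideal R} {T : Type} [AddCommGroup T] [Module R T]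

lemma unif_pow {A C : Type} [AddCommGroup A] [Module R A] [AddCommGroup C] [Module R C] [Module.Finite R A] (g : A →ₗ[R] C)
    (S : Submodule R C) (f : R) (h : ∀ t, ∃ n : ℕ, f ^ n • g t ∈ S) : ∃ n : ℕ, ∀ t, f ^ n • g t ∈ S := by
  obtain ⟨s, hs⟩ := Module.Finite.fg_top (R := R) (M := A)
  choose n hn using h
  refine ⟨∑ a ∈ s, n a, fun t => ?_⟩
  have : t ∈ Submodule.span R (s : Set A) := hs ▸ Submodule.mem_top
  induction this using Submodule.span_induction with
  | mem x hx =>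
    have : n x ≤ ∑ a ∈ s, n a := Finset.single_le_sum (f := n) (fun _ _ => Nat.zero_le _) hx
    obtain ⟨m, hm⟩ := Nat.exists_eq_add_of_le this
    rw [hm, pow_add, mul_comm, mul_smul]
    exact S.smul_mem _ (hn x)
  | zero => simp
  | add x y _ _ hx hy => rw [map_add, smul_add]; exact S.add_mem hx hy
  | smul t x _ hx => rw [map_smul, smul_comm]; exact S.smul_mem _ hx

/-- partial homotopies -/
structure HP (d : T →ₗ[R] T) (π : ℤ → T →ₗ[R] T) (f : R) (k : ℤ) (n : ℕ) (e h : T →ₗ[R] T) : Prop where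
  de : ∀ t, d (e t) = 0
  ed : ∀ t, e (d t) = 0
  ehom : ∀ i t, π i (e t) = e (π i t)
  hom : ∀ i t, π i (h t) = h (π (i+1) t)
  low : ∀ i t, i < k → h (π i t) = 0
  eq : ∀ i t, k ≤ i → d (h (π i t)) + h (d (π i t)) = f ^ n • π i t - e (π i t)

variable {d : T →ₗ[R] T} {π : ℤ → T →ₗ[R] T} {a b : ℤ} {f : R} {k : ℤ} {n : ℕ} {e h : T →ₗ[R] T}

lemma HP.ext (gc : GC d π a b) (hp : HP d π f (k+1) n e h) 
    (hs : ∃ s : T →ₗ[R] T, ∀ t, d (s t) = f ^ n • π k t - e (π k t) - h (d (π k t))) : ∃ h', HP d π f k n e h' := by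
  obtain ⟨s, hs⟩ := hs
  have hor : ∀ i j t, i ≠ j → π i (d (π (j-1) t)) = 0 := by
    intro i j t hij
    rw [← gc.comm, gc.orth _ _ _ (by omega)]
  refine ⟨h + π (k-1) ∘ₗ s ∘ₗ π k, hp.de, hp.ed, hp.ehom, ?_, ?_, ?_⟩
  · intro i t
    simp only [LinearMap.add_apply, LinearMap.comp_apply, map_add, hp.hom]
    by_cases hi : i = k - 1
    · rw [hi, gc.idem, sub_add_cancel, gc.idem]
    · rw [gc.orth _ _ _ hi, gc.orth k (i+1) _ (by omega)]; simp
  · intro i t hi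
    simp only [LinearMap.add_apply, LinearMap.comp_apply]
    rw [gc.orth k i _ (by omega), hp.low _ _ (by omega)]; simp
  · intro i t hi
    simp only [LinearMap.add_apply, LinearMap.comp_apply]
    rw [← gc.comm i, gc.orth k (i+1) _ (by omega)]
    by_cases hik : i = k
    · subst hik
      rw [hp.low _ _ (by omega), gc.idem]
      have h1 : d (π (i-1) (s (π i t))) = π i (d (s (π i t))) := by
        rw [← gc.comm, sub_add_cancel]
      rw [zero_add, h1, hs, gc.idem, map_sub, map_sub, map_smul, hp.ehom, gc.idem, hp.hom, ← gc.comm, gc.idem]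
      simp
    · rw [gc.orth k i _ (by omega), gc.comm]
      simp only [map_zero, add_zero]
      exact hp.eq i t (by omega)

lemma HP.smul (hp : HP d π f k n e h) (N : ℕ) : HP d π f k (N + n) (f ^ N • e) (f ^ N • h) where
  de t := by rw [LinearMap.smul_apply, map_smul, hp.de, smul_zero]
  ed t := by rw [LinearMap.smul_apply, hp.ed, smul_zero]
  ehom i t := by rw [LinearMap.smul_apply, map_smul, hp.ehom, LinearMap.smul_apply]
  hom i t := by rw [LinearMap.smul_apply, map_smul, hp.hom, LinearMap.smul_apply]
  low i t hi := by rw [LinearMap.smul_apply, hp.low i t hi, smul_zero]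
  eq i t hi := by
    rw [LinearMap.smul_apply, map_smul, LinearMap.smul_apply, ← smul_add, hp.eq i t hi, smul_sub, smul_smul, pow_add]; rfl

lemma HP.cyc (gc : GC d π a b) (hp : HP d π f (k+1) n e h) (t : T) : 
    π k (f ^ n • π k t - e (π k t) - h (d (π k t))) = f ^ n • π k t - e (π k t) - h (d (π k t)) ∧ 
    d (f ^ n • π k t - e (π k t) - h (d (π k t))) = 0 := by
  constructor
  · rw [map_sub, map_sub, map_smul, hp.ehom, gc.idem, hp.hom, gc.comm, gc.idem]
  · have := hp.eq (k+1) (d t) le_rfl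
    rw [gc.comm, gc.dd, map_zero, add_zero, hp.ed, sub_zero] at this
    rw [map_sub, map_sub, map_smul, hp.de, this, sub_zero, sub_self]

variable [Module.Finite R T] [Module.Projective R T]

lemma HP.tor (gc : GC d π a b) (hp : HP d π f (k+1) n e h) 
    (tor : ∀ z, π k z = z → d z = 0 → ∃ (n : ℕ) (y : T), d y = f ^ n • z) : 
    ∃ N h', HP d π f k (N + n) (f ^ N • e) h' := by
  let g : T →ₗ[R] T := f ^ n • π k - e ∘ₗ π k - h ∘ₗ d ∘ₗ π k
  obtain ⟨N, hN⟩ := unif_pow g (LinearMap.range d) f (by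
    intro t
    obtain ⟨h1, h2⟩ := hp.cyc gc t
    obtain ⟨m, y, hy⟩ := tor _ h1 h2
    exact ⟨m, y, hy⟩)
  obtain ⟨s, hs⟩ := lift_range (f ^ N • g) d hN
  refine ⟨N, HP.ext gc (hp.smul N) ⟨s, fun t => ?_⟩⟩
  rw [hs]
  simp only [g, LinearMap.smul_apply, LinearMap.sub_apply, LinearMap.comp_apply, smul_sub, smul_smul, pow_add]

variable {F E : Type} [AddCommGroup F] [Module R F] [AddCommGroup E] [Module R E] {q : F →ₗ[R] E}
    {P : F →ₗ[R] Module.Dual R T} [IsDomain R] {ω : E →ₗ[R] E →ₗ[R] R}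

lemma TP.e0 (hT : TP I d π q P) (hq : Function.Surjective q) (hω : FD I ω) (hf : f ∈ I) : 
    ∃ (M : ℕ) (ι : Type) (_ : Fintype ι) (x : ι → F) (w : ι → T), (∀ j, π 0 (w j) = w j) ∧ (∀ j, d (w j) = 0) ∧ 
      ∀ z, d z = 0 → ∀ y, f ^ M * P y z = P y (∑ j, P (x j) z • w j) := by
  obtain ⟨M, k, c, c', hM⟩ := hω.gen f hf
  choose C hC using fun i => hq (c i)
  choose C' hC' using fun i => hq (c' i)
  choose W hW0 hW1 hW using fun i => hT.Plift (ω (c i))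
  choose W' hW0' hW1' hW' using fun i => hT.Plift (ω (c' i))
  refine ⟨M, Fin k ⊕ Fin k, inferInstance, Sum.elim C' C, Sum.elim W (-W'), ?_, ?_, ?_⟩
  · rintro (j | j)
    · exact hW0 j
    · simp [hW0']
  · rintro (j | j)
    · exact hW1 j
    · simp [hW1']
  · intro z hz y
    have hk : ∀ x, q x = 0 → P x z = 0 := by
      intro x hx
      obtain ⟨l, hl⟩ := hT.Pker x hx
      rw [hl, hz, map_zero]
    rw [Fintype.sum_sum_type, map_add, map_sum, map_sum, hM, Finset.sum_mul, ← Finset.sum_add_distrib]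
    refine Finset.sum_congr rfl fun i _ => ?_
    have h1 := hk (ω (c i) (c' i) • y - (ω (q y) (c' i) • C i - ω (q y) (c i) • C' i)) (by
      rw [map_sub, map_sub, map_smul, map_smul, map_smul, hC, hC', hω.pf.expand (q y), sub_self])
    simp only [map_sub, map_smul, LinearMap.sub_apply, LinearMap.smul_apply, smul_eq_mul] at h1
    simp only [Sum.elim_inl, Sum.elim_inr, Pi.neg_apply, smul_neg, map_neg, map_smul, hW, hW', smul_eq_mul]
    rw [hω.pf.skew (q y) (c' i), hω.pf.skew (q y) (c i)] at h1
    linear_combination h1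

theorem TP.homotopy [IsNoetherianRing R] (hT : TP I d π q P) (hq : Function.Surjective q) (hω : FD I ω) (hf : f ∈ I) : 
    ∃ (N : ℕ) (e h : T →ₗ[R] T), HP d π f (-2) N e h ∧ 
      ∃ (ι : Type) (_ : Fintype ι) (x : ι → F) (w : ι → T), (∀ j, π 0 (w j) = w j) ∧ 
      ∀ t, e t = ∑ j, P (x j) t • w j := by
  have gc := hT.gc
  have hp3 : HP d π f (2+1) 0 0 0 := by
    refine ⟨by simp, by simp, by simp, by simp, by simp, fun i t hi => ?_⟩
    rw [gc.zero i (by omega)]; simp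
  obtain ⟨N2, h2, hp2⟩ := HP.tor gc hp3 (hT.pos f hf 2 (by omega))
  rw [smul_zero] at hp2
  obtain ⟨N1, h1, hp1⟩ := HP.tor (k := 1) gc hp2 (hT.pos f hf 1 (by omega))
  rw [smul_zero] at hp1
  generalize N1 + (N2 + 0) = n at hp1
  obtain ⟨M, ι, _, x, w, hw0, hw1, hw⟩ := hT.e0 hq hω hf
  let e0 : T →ₗ[R] T := ∑ j, (P (x j)).smulRight (w j)
  have he0 : ∀ t, e0 t = ∑ j, P (x j) t • w j := by intro t; simp [e0]
  have de0 : ∀ t, d (e0 t) = 0 := by intro t; rw [he0, map_sum]; simp [hw1]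
  have ed0 : ∀ t, e0 (d t) = 0 := by intro t; rw [he0]; simp [hT.Pd]
  have e00 : ∀ t, e0 (π 0 t) = e0 t := by intro t; rw [he0, he0]; simp [hT.Pπ]
  have pe0 : ∀ t, π 0 (e0 t) = e0 t := by intro t; rw [he0]; simp [hw0]
  have e0z : ∀ i t, i ≠ 0 → e0 (π i t) = 0 := by intro i t hi; rw [← e00, gc.orth _ _ _ (Ne.symm hi), map_zero]
  have ehom0 : ∀ i t, π i (e0 t) = e0 (π i t) := by
    intro i t
    by_cases hi : i = 0
    · subst hi; rw [pe0, e00]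
    · rw [e0z i t hi, ← pe0, gc.orth _ _ _ hi]
  have hp1' : HP d π f (0+1) (M + n) (f ^ n • e0) (f ^ M • h1 - e0 ∘ₗ h1) := by
    refine ⟨?_, ?_, ?_, ?_, ?_, ?_⟩
    · intro t; simp [de0]
    · intro t; simp [ed0]
    · intro i t; simp [ehom0]
    · intro i t
      simp only [LinearMap.sub_apply, LinearMap.comp_apply, LinearMap.smul_apply, map_sub, map_smul, ehom0, hp1.hom]
    · intro i t hi
      simp only [LinearMap.sub_apply, LinearMap.comp_apply, LinearMap.smul_apply, hp1.low i t (by omega), map_zero, smul_zero, sub_zero]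
    · intro i t hi
      have k1 := hp1.eq i t (by omega)
      have k2 : e0 (h1 (d (π i t))) = 0 := by
        rw [← e00, hp1.hom, ← gc.comm, gc.orth _ _ _ (by omega), map_zero, map_zero]
      simp only [LinearMap.sub_apply, LinearMap.comp_apply, LinearMap.smul_apply, map_sub, map_smul, de0, k2, sub_zero, e0z i t (by omega : i ≠ 0)]
      rw [← smul_add, k1]; simp [smul_smul, pow_add]
  have hp0 : ∃ h0, HP d π f 0 (M + n) (f ^ n • e0) h0 := by
    refine HP.ext gc hp1' ?_
    refine (lift_range (f ^ (M+n) • π 0 - (f ^ n • e0) ∘ₗ π 0 - (f ^ M • h1 - e0 ∘ₗ h1) ∘ₗ d ∘ₗ π 0) d ?_)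
    intro t
    obtain ⟨c1, c2⟩ := hp1'.cyc gc t
    obtain ⟨c3, c4⟩ := HP.cyc (k := 0) gc hp1 t
    refine hT.Pzero _ c1 c2 fun y => ?_
    have := hw _ c4 y
    rw [← he0] at this
    simp only [LinearMap.zero_apply, sub_zero, map_sub, map_smul, smul_eq_mul] at this
    simp only [LinearMap.sub_apply, LinearMap.comp_apply, LinearMap.smul_apply, map_sub, map_smul, smul_eq_mul]
    rw [pow_add]
    linear_combination this
  obtain ⟨h0, hp0⟩ := hp0
  have neg : ∀ i < 0, ∀ z, π i z = z → d z = 0 → ∃ (n : ℕ) (y : T), d y = f ^ n • z := by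
    intro i hi z h1 h2
    obtain ⟨y, hy⟩ := hT.neg i hi z h1 h2
    exact ⟨0, y, by simpa using hy⟩
  obtain ⟨m1, g1, hp1⟩ := HP.tor (k := -1) gc hp0 (neg _ (by omega))
  obtain ⟨m2, g2, hp2⟩ := HP.tor (k := -2) gc hp1 (neg _ (by omega))
  refine ⟨_, _, g2, hp2, ι, inferInstance, x, fun j => f ^ m2 • f ^ m1 • f ^ n • w j, ?_, ?_⟩
  · intro j; simp [hw0]
  · intro t
    simp only [LinearMap.smul_apply, he0, Finset.smul_sum]
    refine Finset.sum_congr rfl fun j _ => ?_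
    module
end g2Sec
end partG2

section partG3
section g3Sec
set_option linter.unusedSectionVars false
variable {R : Type} [CommRing R] [IsNoetherianRing R] {I : Ideal R} {T : Type} [AddCommGroup T] [Module R T]

/-- sign -/
def sg (R : Type) [CommRing R] (i : ℤ) : R := if Even i then 1 else -1

lemma sg_add (i j : ℤ) : sg R (i + j) = sg R i * sg R j := by
  by_cases h : Even i <;> by_cases h' : Even j <;> simp [sg, Int.even_add, h, h']

lemma sg_one : sg R 1 = -1 := by unfold sg; rw [if_neg (by decide)]
lemma sg_zero : sg R 0 = 1 := by unfold sg; simp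
lemma sg_two : sg R 2 = 1 := by unfold sg; simp

lemma sg_sq (i : ℤ) : sg R i * sg R i = 1 := by unfold sg; split_ifs <;> simp

/-- tensor differential -/
noncomputable def tD (d : T →ₗ[R] T) (π : ℤ → T →ₗ[R] T) : T ⊗[R] T →ₗ[R] T ⊗[R] T :=
  TensorProduct.map d LinearMap.id + ∑ i ∈ Finset.Icc (-2 : ℤ) 2, sg R i • TensorProduct.map (π i) d

/-- tensor grading -/
noncomputable def tPi (π : ℤ → T →ₗ[R] T) (k : ℤ) : T ⊗[R] T →ₗ[R] T ⊗[R] T :=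
  ∑ i ∈ Finset.Icc (-2 : ℤ) 2, TensorProduct.map (π i) (π (k - i))

/-- signed swap -/
noncomputable def tS (π : ℤ → T →ₗ[R] T) : T ⊗[R] T →ₗ[R] T ⊗[R] T :=
  ∑ i ∈ Finset.Icc (-2 : ℤ) 2, ∑ j ∈ Finset.Icc (-2 : ℤ) 2, 
    sg R (i * j) • ((TensorProduct.comm R T T).toLinearMap ∘ₗ TensorProduct.map (π i) (π j))

variable {d : T →ₗ[R] T} {π : ℤ → T →ₗ[R] T}

lemma GC.hom_sum (gc : GC d π (-2) 2) {M : Type} [AddCommGroup M] [Module R M] (G : ℤ → T →ₗ[R] M) {i : ℤ} {t : T} (h : π i t = t) : 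
    ∑ j ∈ Finset.Icc (-2 : ℤ) 2, G j (π j t) = G i t := by
  by_cases hi : i ∈ Finset.Icc (-2 : ℤ) 2
  · rw [Finset.sum_eq_single i]
    · rw [h]
    · intro j _ hj
      rw [← h, gc.orth _ _ _ hj, map_zero]
    · exact fun h => absurd hi h
  · rw [Finset.mem_Icc] at hi
    have : t = 0 := by rw [← h, gc.zero i (by omega)]
    subst this; simp

lemma GC.off (gc : GC d π (-2) 2) {i j : ℤ} {t : T} (h : π i t = t) (hij : j ≠ i) : π j t = 0 := by
  rw [← h, gc.orth _ _ _ hij]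

lemma GC.dh (gc : GC d π (-2) 2) {i : ℤ} {t : T} (h : π i t = t) : π (i+1) (d t) = d t := by rw [gc.comm, h]

lemma GC.tD_apply (gc : GC d π (-2) 2) {i : ℤ} {a : T} (b : T) (h : π i a = a) : tD d π (a ⊗ₜ b) = d a ⊗ₜ b + sg R i • (a ⊗ₜ[R] d b) := by
  unfold tD
  simp only [LinearMap.add_apply, LinearMap.sum_apply, LinearMap.smul_apply, TensorProduct.map_tmul, LinearMap.id_apply]
  congr 1
  exact gc.hom_sum (fun j => sg R j • (TensorProduct.mk R T T).flip (d b)) h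

lemma GC.tPi_apply (gc : GC d π (-2) 2) (k : ℤ) {i j : ℤ} {a b : T} (h : π i a = a) (h' : π j b = b) : 
    tPi π k (a ⊗ₜ b) = if k = i + j then a ⊗ₜ[R] b else 0 := by
  unfold tPi
  simp only [LinearMap.sum_apply, TensorProduct.map_tmul]
  refine (gc.hom_sum (fun i' => (TensorProduct.mk R T T).flip (π (k - i') b)) h).trans ?_
  simp only [LinearMap.flip_apply, TensorProduct.mk_apply]
  split_ifs with hk
  · subst hk; rw [add_sub_cancel_left, h']
  · rw [gc.off h' (by omega), tmul_zero]

lemma GC.tS_apply (gc : GC d π (-2) 2) {i j : ℤ} {a b : T} (h : π i a = a) (h' : π j b = b) : 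
    tS π (a ⊗ₜ b) = sg R (i * j) • (b ⊗ₜ[R] a) := by
  unfold tS
  simp only [LinearMap.sum_apply, LinearMap.smul_apply, LinearMap.comp_apply, TensorProduct.map_tmul, LinearEquiv.coe_coe, 
    TensorProduct.comm_tmul]
  refine Eq.trans (Finset.sum_congr rfl fun i' _ => ?_) (gc.hom_sum (fun i' => sg R (i' * j) • (TensorProduct.mk R T T) b) h)
  exact gc.hom_sum (fun j' => sg R (i' * j') • (TensorProduct.mk R T T).flip (π i' a)) h'

lemma GC.ext2 (gc : GC d π (-2) 2) {M : Type} [AddCommGroup M] [Module R M] {f g : T ⊗[R] T →ₗ[R] M} 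
    (h : ∀ i j a b, π i a = a → π j b = b → f (a ⊗ₜ b) = g (a ⊗ₜ b)) (z : T ⊗[R] T) : f z = g z := by
  have : f = g := by
    refine TensorProduct.ext' fun a b => ?_
    rw [← gc.sum a, ← gc.sum b]
    simp only [TensorProduct.sum_tmul, TensorProduct.tmul_sum, map_sum]
    refine Finset.sum_congr rfl fun i _ => Finset.sum_congr rfl fun j _ => ?_
    exact h _ _ _ _ (gc.idem _ _) (gc.idem _ _)
  rw [this]

lemma GC.tDD (gc : GC d π (-2) 2) (z : T ⊗[R] T) : tD d π (tD d π z) = 0 := by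
  refine gc.ext2 (f := tD d π ∘ₗ tD d π) (g := 0) (fun i j a b ha hb => ?_) z
  simp only [LinearMap.comp_apply, gc.tD_apply b ha, map_add, map_smul, gc.tD_apply _ (gc.dh ha), gc.tD_apply _ ha, gc.dd, 
    TensorProduct.zero_tmul, TensorProduct.tmul_zero, sg_add, sg_one, LinearMap.zero_apply]
  simp

lemma GC.tDPi (gc : GC d π (-2) 2) (k : ℤ) (z : T ⊗[R] T) : tPi π (k+1) (tD d π z) = tD d π (tPi π k z) := by
  have := gc.ext2 (f := tPi π (k+1) ∘ₗ tD d π) (g := tD d π ∘ₗ tPi π k) (fun i j a b ha hb => ?_) z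
  · simpa only [LinearMap.comp_apply] using this
  simp only [LinearMap.comp_apply, gc.tD_apply b ha, map_add, map_smul, gc.tPi_apply _ (gc.dh ha) hb, 
    gc.tPi_apply _ ha (gc.dh hb), gc.tPi_apply _ ha hb]
  by_cases h : k = i + j
  · rw [if_pos (by omega), if_pos (by omega), if_pos h, gc.tD_apply b ha]
  · rw [if_neg (by omega), if_neg (by omega), if_neg h]; simp

lemma GC.tSD (gc : GC d π (-2) 2) (z : T ⊗[R] T) : tS π (tD d π z) = tD d π (tS π z) := by
  refine gc.ext2 (f := tS π ∘ₗ tD d π) (g := tD d π ∘ₗ tS π) (fun i j a b ha hb => ?_) z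
  simp only [LinearMap.comp_apply, gc.tD_apply b ha, map_add, map_smul, gc.tS_apply (gc.dh ha) hb, 
    gc.tS_apply ha (gc.dh hb), gc.tS_apply ha hb, gc.tD_apply _ hb]
  rw [add_mul, mul_add, sg_add, sg_add, one_mul, mul_one]
  rw [smul_add, smul_smul, smul_smul, mul_comm (sg R (i * j)) (sg R i), ← mul_assoc, sg_sq, one_mul, add_comm]

lemma GC.tSS (gc : GC d π (-2) 2) (z : T ⊗[R] T) : tS π (tS π z) = z := by
  refine gc.ext2 (f := tS π ∘ₗ tS π) (g := LinearMap.id) (fun i j a b ha hb => ?_) z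
  simp only [LinearMap.comp_apply, map_smul, gc.tS_apply ha hb, gc.tS_apply hb ha, LinearMap.id_apply, smul_smul]
  rw [mul_comm j i, sg_sq, one_smul]

lemma GC.tSPi (gc : GC d π (-2) 2) (k : ℤ) (z : T ⊗[R] T) : tS π (tPi π k z) = tPi π k (tS π z) := by
  refine gc.ext2 (f := tS π ∘ₗ tPi π k) (g := tPi π k ∘ₗ tS π) (fun i j a b ha hb => ?_) z
  simp only [LinearMap.comp_apply, map_smul, gc.tPi_apply k ha hb, gc.tS_apply ha hb, gc.tPi_apply k hb ha]
  by_cases h : k = i + j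
  · rw [if_pos h, if_pos (by omega), gc.tS_apply ha hb]
  · rw [if_neg h, if_neg (by omega)]; simp

lemma GC.tensor (gc : GC d π (-2) 2) : GC (tD d π) (tPi π) (-4) 4 := by
  refine ⟨gc.tDD, gc.tDPi, ?_, ?_, ?_⟩
  · intro k z
    refine gc.ext2 (f := tPi π k ∘ₗ tPi π k) (g := tPi π k) (fun i j a b ha hb => ?_) z
    simp only [LinearMap.comp_apply, gc.tPi_apply k ha hb]
    split_ifs with h
    · rw [gc.tPi_apply k ha hb, if_pos h]
    · simp
  · intro k l z hkl
    refine gc.ext2 (f := tPi π k ∘ₗ tPi π l) (g := 0) (fun i j a b ha hb => ?_) z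
    simp only [LinearMap.comp_apply, gc.tPi_apply l ha hb]
    split_ifs with h
    · rw [gc.tPi_apply k ha hb, if_neg (by omega)]; rfl
    · simp
  · intro z
    have := gc.ext2 (f := ∑ k ∈ Finset.Icc (-4 : ℤ) 4, tPi π k) (g := LinearMap.id) (fun i j a b ha hb => ?_) z
    · simpa using this
    · simp only [LinearMap.sum_apply, LinearMap.id_apply, gc.tPi_apply _ ha hb]
      by_cases hi : -2 ≤ i ∧ i ≤ 2
      · by_cases hj : -2 ≤ j ∧ j ≤ 2
        · rw [Finset.sum_ite_eq', if_pos]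
          rw [Finset.mem_Icc]; omega
        · have : b = 0 := by rw [← hb, gc.zero j (by omega)]
          subst this; simp
      · have : a = 0 := by rw [← ha, gc.zero i (by omega)]
        subst this; simp

lemma GC.tH (gc : GC d π (-2) 2) {f : R} {n : ℕ} {e h : T →ₗ[R] T} (hp : HP d π f (-2) n e h) (he : ∀ i t, i ≠ 0 → e (π i t) = 0) :
    ∃ H : T ⊗[R] T →ₗ[R] T ⊗[R] T, ∀ z, tD d π (H z) + H (tD d π z) = f ^ (n + n) • z - TensorProduct.map e e z := by
  have eq : ∀ t, d (h t) + h (d t) = f ^ n • t - e t := by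
    intro t
    rw [← gc.sum t]
    simp only [map_sum, Finset.smul_sum]
    rw [← Finset.sum_add_distrib, ← Finset.sum_sub_distrib]
    refine Finset.sum_congr rfl fun i hi => ?_
    rw [Finset.mem_Icc] at hi
    exact hp.eq i t hi.1
  refine ⟨f ^ n • TensorProduct.map h LinearMap.id + TensorProduct.map e h, fun z => ?_⟩
  have := gc.ext2 (f := tD d π ∘ₗ (f ^ n • TensorProduct.map h LinearMap.id + TensorProduct.map e h) + 
    (f ^ n • TensorProduct.map h LinearMap.id + TensorProduct.map e h) ∘ₗ tD d π) 
    (g := f ^ (n + n) • LinearMap.id - TensorProduct.map e e) (fun i j a b ha hb => ?_) z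
  · simpa using this
  · have ha1 : π (i - 1) (h a) = h a := by rw [hp.hom, sub_add_cancel, ha]
    have ha2 : π i (e a) = e a := by rw [hp.ehom, ha]
    have hs : ∀ c : T, sg R i • (e a ⊗ₜ[R] c) = e a ⊗ₜ[R] c := by
      intro c
      by_cases hi : i = 0
      · subst hi; rw [sg_zero, one_smul]
      · rw [← ha, he i a hi, TensorProduct.zero_tmul, smul_zero]
    have hs1 : sg R i = - sg R (i - 1) := by
      rw [show i = (i - 1) + 1 by ring, sg_add, sg_one]; simp
    simp only [LinearMap.add_apply, LinearMap.comp_apply, LinearMap.smul_apply, LinearMap.sub_apply, LinearMap.id_apply,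
      map_add, map_smul, TensorProduct.map_tmul, gc.tD_apply b ha, gc.tD_apply _ ha1, gc.tD_apply _ ha2, hp.de, hp.ed, 
      TensorProduct.zero_tmul, zero_add, add_zero]
    rw [smul_add (sg R i), hs, hs]
    have k1 : d (h a) ⊗ₜ[R] b = f ^ n • a ⊗ₜ[R] b - e a ⊗ₜ[R] b - h (d a) ⊗ₜ[R] b := by
      rw [eq_sub_iff_add_eq, ← TensorProduct.add_tmul, eq, TensorProduct.sub_tmul]; rfl
    have k2 : e a ⊗ₜ[R] d (h b) = f ^ n • (e a ⊗ₜ[R] b) - e a ⊗ₜ[R] e b - e a ⊗ₜ[R] h (d b) := by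
      rw [eq_sub_iff_add_eq, ← TensorProduct.tmul_add, eq, TensorProduct.tmul_sub, TensorProduct.tmul_smul]
    rw [k1, k2, hs1, pow_add]
    generalize h (d a) ⊗ₜ[R] b = t1
    generalize h a ⊗ₜ[R] d b = t2
    generalize e a ⊗ₜ[R] h (d b) = t3
    generalize e a ⊗ₜ[R] e b = t4
    generalize e a ⊗ₜ[R] b = t5
    generalize a ⊗ₜ[R] b = t6
    module
end g3Sec
end partG3

section partG4
section g4Sec
set_option linter.unusedSectionVars false
variable {R : Type} [CommRing R] [IsNoetherianRing R] [IsDomain R] {I : Ideal R} {T F E : Type} [AddCommGroup T] [Module R T]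
  [AddCommGroup F] [Module R F] [AddCommGroup E] [Module R E]

/-- pairing -/
noncomputable def bB (P : F →ₗ[R] Module.Dual R T) (x y : F) : T ⊗[R] T →ₗ[R] R :=
  (TensorProduct.lid R R).toLinearMap ∘ₗ TensorProduct.map (P x) (P y)

variable {d : T →ₗ[R] T} {π : ℤ → T →ₗ[R] T} {q : F →ₗ[R] E} {P : F →ₗ[R] Module.Dual R T}

lemma bB_tmul (x y : F) (a b : T) : bB P x y (a ⊗ₜ b) = P x a * P y b := by simp [bB]

lemma bB_add_left (x x' y : F) (z : T ⊗[R] T) : bB P (x + x') y z = bB P x y z + bB P x' y z := by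
  simp [bB, TensorProduct.map_add_left]
lemma bB_add_right (x y y' : F) (z : T ⊗[R] T) : bB P x (y + y') z = bB P x y z + bB P x y' z := by
  simp [bB, TensorProduct.map_add_right]
lemma bB_smul_left (r : R) (x y : F) (z : T ⊗[R] T) : bB P (r • x) y z = r * bB P x y z := by
  simp [bB, TensorProduct.map_smul_left]
lemma bB_smul_right (r : R) (x y : F) (z : T ⊗[R] T) : bB P x (r • y) z = r * bB P x y z := by
  simp [bB, TensorProduct.map_smul_right]

lemma TP.bB_D (hT : TP I d π q P) (x y : F) (z : T ⊗[R] T) : bB P x y (tD d π z) = 0 := by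
  have : bB P x y ∘ₗ tD d π = 0 := by
    refine TensorProduct.ext' fun a b => ?_
    simp [tD, bB_tmul, hT.Pd]
  exact LinearMap.congr_fun this z

lemma TP.bB_S (hT : TP I d π q P) (x y : F) (z : T ⊗[R] T) : bB P x y (tS π z) = bB P y x z := by
  have gc := hT.gc
  have := gc.ext2 (f := bB P x y ∘ₗ tS π) (g := bB P y x) (fun i j a b ha hb => ?_) z
  · simpa only [LinearMap.comp_apply] using this
  · rw [LinearMap.comp_apply, gc.tS_apply ha hb, map_smul, bB_tmul, bB_tmul]
    by_cases hi : i = 0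
    · subst hi; rw [zero_mul, sg_zero, one_smul, mul_comm]
    · rw [← hT.Pπ y a, gc.off ha (Ne.symm hi)]; simp

lemma TP.bB_Pi (hT : TP I d π q P) (x y : F) (k : ℤ) (hk : k ≠ 0) (z : T ⊗[R] T) : bB P x y (tPi π k z) = 0 := by
  have gc := hT.gc
  have := gc.ext2 (f := bB P x y ∘ₗ tPi π k) (g := 0) (fun i j a b ha hb => ?_) z
  · simpa only [LinearMap.comp_apply, LinearMap.zero_apply] using this
  · rw [LinearMap.comp_apply, gc.tPi_apply k ha hb, LinearMap.zero_apply]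
    split_ifs with h
    · rw [bB_tmul]
      by_cases hi : i = 0
      · rw [← hT.Pπ y b, gc.off hb (by omega)]; simp
      · rw [← hT.Pπ x a, gc.off ha (Ne.symm hi)]; simp
    · simp

lemma TP.bB_ker (hT : TP I d π q P) (x y : F) (hx : q x = 0) (z : T ⊗[R] T) (hz : tD d π z = 0) : bB P x y z = 0 := by
  obtain ⟨l, hl⟩ := hT.Pker x hx
  have : bB P x y = (TensorProduct.lid R R).toLinearMap ∘ₗ TensorProduct.map l (P y) ∘ₗ tD d π := by
    refine TensorProduct.ext' fun a b => ?_
    simp [tD, bB_tmul, hT.Pd, hl]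
  rw [this, LinearMap.comp_apply, LinearMap.comp_apply, hz]; simp

lemma TP.bB_q (hT : TP I d π q P) (x x' y y' : F) (hx : q x = q x') (hy : q y = q y') (z : T ⊗[R] T) (hz : tD d π z = 0) :
    bB P x y z = bB P x' y' z := by
  have h1 := hT.bB_ker (x - x') y (by rw [map_sub, hx, sub_self]) z hz
  have h2 : bB P x' (y - y') z = 0 := by
    rw [← hT.bB_S]
    exact hT.bB_ker (y - y') x' (by rw [map_sub, hy, sub_self]) _ (by rw [← hT.gc.tSD, hz, map_zero])
  have h3 := bB_add_left (P := P) (x - x') x' y z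
  have h4 := bB_add_right (P := P) x' (y - y') y' z
  rw [sub_add_cancel] at h3 h4
  rw [h3, h4, h1, h2]; ring

lemma FD.ne (hI : I ≠ ⊥) {ω : E →ₗ[R] E →ₗ[R] R} (hω : FD I ω) : ∃ a b, ω a b ≠ 0 := by
  by_contra h
  push Not at h
  obtain ⟨f, hf, hf0⟩ := Submodule.exists_mem_ne_zero_of_ne_bot hI
  obtain ⟨n, k, c, c', e⟩ := hω.gen f hf
  simp only [h, Finset.sum_const_zero] at e
  exact pow_ne_zero n hf0 e

lemma TP.form (hT : TP I d π q P) (hq : Function.Surjective q) {ω : E →ₗ[R] E →ₗ[R] R} (hω : FD I ω) {c : R} (hc : 2 * c = 1) 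
    (z : T ⊗[R] T) (hz : tD d π z = 0) (hs : tS π z + z = 0) : ∃ s : R, ∀ x y, bB P x y z = s * ω (q x) (q y) := by
  let s := Function.surjInv hq
  have hs' : ∀ a, q (s a) = a := Function.surjInv_eq hq
  let β : E →ₗ[R] E →ₗ[R] R := LinearMap.mk₂ R (fun a b => bB P (s a) (s b) z)
    (fun a a' b => by
      rw [← bB_add_left]; exact hT.bB_q _ _ _ _ (by simp [hs']) rfl z hz)
    (fun r a b => by
      rw [smul_eq_mul, ← bB_smul_left]; exact hT.bB_q _ _ _ _ (by simp [hs']) rfl z hz)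
    (fun a b b' => by
      rw [← bB_add_right]; exact hT.bB_q _ _ _ _ rfl (by simp [hs']) z hz)
    (fun r a b => by
      rw [smul_eq_mul, ← bB_smul_right]; exact hT.bB_q _ _ _ _ rfl (by simp [hs']) z hz)
  obtain ⟨r, hr⟩ := hω.uniq β (fun a => by
    change bB P (s a) (s a) z = 0
    have h1 := hT.bB_S (s a) (s a) z
    rw [eq_neg_of_add_eq_zero_left hs, map_neg] at h1
    linear_combination (-c) * h1 - bB P (s a) (s a) z * hc)
  refine ⟨r, fun x y => ?_⟩
  have : β (q x) (q y) = r * ω (q x) (q y) := by rw [hr]; rfl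
  rw [← this]
  exact hT.bB_q _ _ _ _ (hs' _).symm (hs' _).symm z hz

/-- antisymmetric tensors -/
noncomputable def As (π : ℤ → T →ₗ[R] T) : Submodule R (T ⊗[R] T) := LinearMap.ker (tS π + LinearMap.id)

lemma mem_As {z : T ⊗[R] T} : z ∈ As π ↔ tS π z + z = 0 := Iff.rfl

theorem TP.anti [Module.Finite R T] [Module.Projective R T] (hG : Good R I) (hI : I ≠ ⊥) (hT : TP I d π q P) 
    (hq : Function.Surjective q) {ω : E →ₗ[R] E →ₗ[R] R} (hω : FD I ω) {c : R} (hc : 2 * c = 1) 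
    (k : ℤ) (hk : k > 0) (z : T ⊗[R] T) (hπ : tPi π k z = z) (hS : tS π z + z = 0) (hD : tD d π z = 0) : 
    ∃ y, tD d π y = z := by
  have gc := hT.gc
  have gt := gc.tensor
  have hDA : ∀ z ∈ As π, tD d π z ∈ As π := fun z hz => by
    rw [mem_As] at *; rw [gc.tSD, ← map_add, hz, map_zero]
  have hPA : ∀ k, ∀ z ∈ As π, tPi π k z ∈ As π := fun k z hz => by
    rw [mem_As] at *; rw [gc.tSPi, ← map_add, hz, map_zero]
  let dA : As π →ₗ[R] As π := (tD d π).restrict hDA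
  let πA : ℤ → As π →ₗ[R] As π := fun k => (tPi π k).restrict (hPA k)
  have hdA : ∀ z, (dA z : T ⊗[R] T) = tD d π z := fun z => rfl
  have hπA : ∀ k z, (πA k z : T ⊗[R] T) = tPi π k z := fun k z => rfl
  have gA : GC dA πA (-4) 4 := by
    refine ⟨fun t => Subtype.ext (gt.dd t), fun i t => Subtype.ext (gt.comm i t), fun i t => Subtype.ext (gt.idem i t), 
      fun i j t h => Subtype.ext (gt.orth i j t h), fun t => Subtype.ext ?_⟩
    rw [AddSubmonoidClass.coe_finsetSum]
    exact gt.sum t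
  let Q : T ⊗[R] T →ₗ[R] As π := LinearMap.codRestrict (As π) (c • (LinearMap.id - tS π)) (fun z => by
    rw [mem_As]
    simp only [LinearMap.smul_apply, LinearMap.sub_apply, LinearMap.id_apply, map_smul, map_sub, gc.tSS]
    module)
  have hQv : ∀ z, (Q z : T ⊗[R] T) = c • (z - tS π z) := fun z => rfl
  have hQ : ∀ z : As π, Q z = z := by
    rintro ⟨z, hz⟩
    rw [mem_As] at hz
    refine Subtype.ext ?_
    rw [hQv]
    change c • (z - tS π z) = z
    rw [eq_neg_of_add_eq_zero_left hz, sub_neg_eq_add, ← two_smul R z, smul_smul, mul_comm c, hc, one_smul]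
  have hQD : ∀ z, dA (Q z) = Q (tD d π z) := fun z => Subtype.ext (by
    rw [hdA, hQv, hQv, map_smul, map_sub, gc.tSD])
  have hpr : Module.Projective R (As π) := Module.Projective.of_split (As π).subtype Q (LinearMap.ext hQ)
  have hfin : Module.Finite R (As π) := inferInstance
  -- homotopy
  have key : ∀ f ∈ I, ∃ n : ℕ, ∀ z : As π, dA z = 0 → (∀ x y, bB P x y z = 0) → ∃ y, dA y = f ^ n • z := by
    intro f hf
    obtain ⟨N, e, h, hp, ι, _, x, w, hw, he⟩ := hT.homotopy hq hω hf
    obtain ⟨H, hH⟩ := gc.tH hp (fun i t hi => by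
      rw [he]; refine Finset.sum_eq_zero fun j _ => ?_
      rw [← hT.Pπ, gc.orth _ _ _ (Ne.symm hi), map_zero, zero_smul])
    have hee : ∀ z, TensorProduct.map e e z = ∑ j, ∑ l, bB P (x j) (x l) z • (w j ⊗ₜ[R] w l) := by
      intro z
      induction z using TensorProduct.induction_on with
      | zero => simp
      | tmul a b =>
        rw [TensorProduct.map_tmul, he, he, TensorProduct.sum_tmul]
        refine Finset.sum_congr rfl fun j _ => ?_
        rw [TensorProduct.tmul_sum]
        refine Finset.sum_congr rfl fun l _ => ?_
        rw [bB_tmul, TensorProduct.smul_tmul_smul]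
      | add a b ha hb => simp only [map_add, ha, hb, add_smul, Finset.sum_add_distrib]
    refine ⟨N + N, fun z hz hB => ⟨Q (H z), ?_⟩⟩
    have hz' : tD d π (z : T ⊗[R] T) = 0 := congrArg Subtype.val hz
    have h1 := hH z
    rw [hz', map_zero, add_zero, hee] at h1
    simp only [hB, zero_smul, Finset.sum_const_zero, sub_zero] at h1
    rw [hQD, h1, map_smul, hQ]
  have hZ : ∀ z : Zs dA πA 0, tD d π (z.1 : T ⊗[R] T) = 0 := fun z => congrArg Subtype.val z.2.2
  have hex : ∀ z : Zs dA πA 0, ∃ s : R, ∀ x y, bB P x y (z.1 : T ⊗[R] T) = s * ω (q x) (q y) := fun z => 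
    hT.form hq hω hc _ (hZ z) z.1.2
  choose φ hφ using hex
  obtain ⟨a0, b0, hab⟩ := hω.ne hI
  obtain ⟨x0, rfl⟩ := hq a0
  obtain ⟨y0, rfl⟩ := hq b0
  let Φ : Zs dA πA 0 →ₗ[R] R := 
    { toFun := φ
      map_add' := fun z z' => by
        apply mul_right_cancel₀ hab
        rw [← hφ, add_mul, ← hφ, ← hφ, ← map_add]; rfl
      map_smul' := fun r z => by
        apply mul_right_cancel₀ hab
        rw [← hφ, RingHom.id_apply, smul_eq_mul, mul_assoc, ← hφ, ← smul_eq_mul, ← map_smul]; rfl }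
  have hΦ : ∀ (z : Zs dA πA 0) x y, bB P x y (z.1 : T ⊗[R] T) = Φ z * ω (q x) (q y) := hφ
  have main := gA.chase hG ?_ Φ ?_ ?_ ?_ k hk ⟨z, hS⟩ (Subtype.ext hπ) (Subtype.ext hD)
  · obtain ⟨y, hy⟩ := main
    exact ⟨y, congrArg Subtype.val hy⟩
  · intro f hf k hk z hz hz'
    obtain ⟨n, hn⟩ := key f hf
    refine ⟨n, hn z hz' fun x y => ?_⟩
    rw [← hz, hπA]; exact hT.bB_Pi x y k hk _
  · rintro z ⟨y, hy⟩
    apply mul_right_cancel₀ hab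
    rw [← hΦ, ← hy, hdA, hT.bB_D, zero_mul]
  · intro z hz f hf
    obtain ⟨n, hn⟩ := key f hf
    refine ⟨n, hn z.1 z.2.2 fun x y => ?_⟩
    rw [hΦ, hz, zero_mul]
  · intro f hf
    obtain ⟨n, m, a, b, hab'⟩ := hω.gen f hf
    choose za ha0 hda hPa using fun i => hT.Plift (ω (a i))
    choose zb hb0 hdb hPb using fun i => hT.Plift (ω (b i))
    have h1 : tS π (∑ i, (za i ⊗ₜ[R] zb i - zb i ⊗ₜ[R] za i)) + ∑ i, (za i ⊗ₜ[R] zb i - zb i ⊗ₜ[R] za i) = 0 := by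
      rw [map_sum, ← Finset.sum_add_distrib]
      refine Finset.sum_eq_zero fun i _ => ?_
      rw [map_sub, gc.tS_apply (ha0 i) (hb0 i), gc.tS_apply (hb0 i) (ha0 i), zero_mul, sg_zero, one_smul, one_smul]
      abel
    have h2 : tPi π 0 (∑ i, (za i ⊗ₜ[R] zb i - zb i ⊗ₜ[R] za i)) = ∑ i, (za i ⊗ₜ[R] zb i - zb i ⊗ₜ[R] za i) := by
      rw [map_sum]
      refine Finset.sum_congr rfl fun i _ => ?_
      rw [map_sub, gc.tPi_apply 0 (ha0 i) (hb0 i), gc.tPi_apply 0 (hb0 i) (ha0 i), if_pos (by simp), if_pos (by simp)]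
    have h3 : tD d π (∑ i, (za i ⊗ₜ[R] zb i - zb i ⊗ₜ[R] za i)) = 0 := by
      rw [map_sum]
      refine Finset.sum_eq_zero fun i _ => ?_
      rw [map_sub, gc.tD_apply _ (ha0 i), gc.tD_apply _ (hb0 i), hda, hdb]; simp
    refine ⟨n, ⟨⟨_, h1⟩, Subtype.ext h2, Subtype.ext h3⟩, ?_⟩
    apply mul_right_cancel₀ hab
    rw [← hΦ, hab', Finset.sum_mul]
    change bB P x0 y0 (∑ i, (za i ⊗ₜ[R] zb i - zb i ⊗ₜ[R] za i)) = _
    rw [map_sum]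
    refine Finset.sum_congr rfl fun i _ => ?_
    rw [map_sub, bB_tmul, bB_tmul, hPa, hPa, hPb, hPb]
    have h := congrArg (fun t => ω t (q y0)) (hω.pf.pl (a i) (b i) (q x0))
    simp only [map_add, map_smul, LinearMap.add_apply, LinearMap.smul_apply, map_zero, LinearMap.zero_apply, smul_eq_mul] at h
    rw [hω.pf.skew (q x0) (a i)] at h
    linear_combination -h
end g4Sec
end partG4

section partH1
section h1Sec
set_option linter.unusedSectionVars false
variable {R : Type} [CommRing R] [IsNoetherianRing R] [IsDomain R] {I : Ideal R} {T : Type} [AddCommGroup T] [Module R T]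

lemma exists_nu (hI : I.IsMaximal) (N : Submodule R T) (hN : I • (⊤ : Submodule R T) ≤ N) (x : T) (hx : x ∉ N) : 
    ∃ ν : T →ₗ[R] R ⧸ I, (∀ n ∈ N, ν n = 0) ∧ ν x = 1 := by
  have ht : Module.IsTorsionBySet R (T ⧸ N) I := by
    rintro a ⟨r, hr⟩
    obtain ⟨a, rfl⟩ := N.mkQ_surjective a
    change r • N.mkQ a = 0
    rw [← map_smul]
    exact (Submodule.Quotient.mk_eq_zero N).2 (hN (Submodule.smul_mem_smul hr trivial))
  let _ : Field (R ⧸ I) := Ideal.Quotient.field I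
  let _ : Module (R ⧸ I) (T ⧸ N) := ht.module
  have : IsScalarTower R (R ⧸ I) (T ⧸ N) := ht.isScalarTower
  have hx' : N.mkQ x ≠ 0 := fun h => hx ((Submodule.Quotient.mk_eq_zero N).1 h)
  have := mt (Module.forall_dual_apply_eq_zero_iff (R ⧸ I) (N.mkQ x)).1 hx'
  push Not at this
  obtain ⟨φ, hφ⟩ := this
  refine ⟨(((φ (N.mkQ x))⁻¹ • φ).restrictScalars R) ∘ₗ N.mkQ, fun n hn => ?_, ?_⟩
  · rw [LinearMap.comp_apply, show N.mkQ n = 0 from (Submodule.Quotient.mk_eq_zero N).2 hn, map_zero]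
  · change (φ (N.mkQ x))⁻¹ * φ (N.mkQ x) = 1
    exact inv_mul_cancel₀ hφ

lemma nak {N : Type} [AddCommGroup N] [Module R N] [Module.Finite R N] (hN : PT I N) (h : (⊤ : Submodule R N) ≤ I • ⊤) (x : N) : x = 0 := by
  obtain ⟨c, hc⟩ := PT.uniform hN
  have : ∀ k : ℕ, (⊤ : Submodule R N) ≤ I ^ k • ⊤ := by
    intro k
    induction k with
    | zero => simp
    | succ k ih =>
      rw [pow_succ, Submodule.mul_smul]
      exact ih.trans (Submodule.smul_mono le_rfl h)
  have h2 : I ^ c • (⊤ : Submodule R N) ≤ ⊥ := by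
    rw [Submodule.smul_le]
    intro r hr n _
    rw [Submodule.mem_bot]; exact hc r hr n
  simpa using h2 (this c trivial : x ∈ I ^ c • (⊤ : Submodule R N))

lemma nak' [Module.Finite R T] (V W : Submodule R T) (tor : ∀ f ∈ I, ∀ v ∈ V, ∃ n : ℕ, f ^ n • v ∈ W) 
    (h : (⊤ : Submodule R V) ≤ W.comap V.subtype ⊔ I • ⊤) (v : T) (hv : v ∈ V) : v ∈ W := by
  have hpt : PT I (V ⧸ W.comap V.subtype) := by
    refine pt_of fun f hf a => ?_
    obtain ⟨a, rfl⟩ := Submodule.mkQ_surjective _ a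
    obtain ⟨n, hn⟩ := tor f hf a.1 a.2
    refine ⟨n, ?_⟩
    rw [← map_smul]
    exact (Submodule.Quotient.mk_eq_zero _).2 hn
  refine (Submodule.Quotient.mk_eq_zero (W.comap V.subtype)).1 (nak hpt ?_ (Submodule.Quotient.mk ⟨v, hv⟩))
  have := Submodule.map_mono (f := (W.comap V.subtype).mkQ) h
  rw [Submodule.map_sup, Submodule.map_smul'', Submodule.mkQ_map_self, bot_sup_eq, Submodule.map_top, Submodule.range_mkQ] at this
  exact this

variable {d : T →ₗ[R] T} {π : ℤ → T →ₗ[R] T}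

lemma kill_D (ν μ : T →ₗ[R] R ⧸ I) (hν : ∀ t, ν (d t) = 0) (hμ : ∀ t, μ (d t) = 0) (y : T ⊗[R] T) : 
    LinearMap.mul' R (R ⧸ I) (TensorProduct.map ν μ (tD d π y)) = 0 := by
  have : (LinearMap.mul' R (R ⧸ I) ∘ₗ TensorProduct.map ν μ) ∘ₗ tD d π = 0 := by
    refine TensorProduct.ext' fun a b => ?_
    simp [tD, hν, hμ]
  exact LinearMap.congr_fun this y

/-- the conclusion about antisymmetric cycles -/
def Anti (d : T →ₗ[R] T) (π : ℤ → T →ₗ[R] T) : Prop := ∀ k : ℤ, k > 0 → ∀ z : T ⊗[R] T, tPi π k z = z → tS π z + z = 0 → tD d π z = 0 →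
    ∃ y, tD d π y = z

lemma GC.d2 (gc : GC d π (-2) 2) {a : T} (ha : π 2 a = a) : d a = 0 := by
  rw [← gc.dh ha, gc.zero _ (by omega)]

lemma step4 [Module.Finite R T] (hI : I.IsMaximal) (gc : GC d π (-2) 2) (hA : Anti d π) 
    (tor : ∀ f ∈ I, ∀ z, π 2 z = z → ∃ (n : ℕ) (y : T), d y = f ^ n • z) : 
    ∃ t, π 2 t = t ∧ ∀ a, π 2 a = a → ∃ (r : R) (y : T), r • t + d y = a := by
  let τ : T →ₗ[R] Cs π 2 := LinearMap.codRestrict (Cs π 2) (π 2) (fun x => gc.idem 2 x)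
  have hτ : ∀ a : Cs π 2, τ a = a := fun a => Subtype.ext a.2
  let N0 : Submodule R (Cs π 2) := (LinearMap.range d).comap (Cs π 2).subtype ⊔ I • ⊤
  have hd : ∀ ν : Cs π 2 →ₗ[R] R ⧸ I, (∀ n ∈ N0, ν n = 0) → ∀ x, (ν ∘ₗ τ) (d x) = 0 := by
    intro ν hν x
    refine hν _ (Submodule.mem_sup_left ⟨π 1 x, ?_⟩)
    rw [← gc.comm]; rfl
  have key : ∃ t : Cs π 2, ∀ a : Cs π 2, a ∈ Submodule.span R {t} ⊔ N0 := by
    by_cases h : ∀ a : Cs π 2, a ∈ N0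
    · exact ⟨0, fun a => Submodule.mem_sup_right (h a)⟩
    push Not at h
    obtain ⟨t, ht⟩ := h
    refine ⟨t, fun a => ?_⟩
    by_contra ha
    obtain ⟨ν, hν, hν1⟩ := exists_nu hI N0 le_sup_right t ht
    obtain ⟨μ, hμ, hμ1⟩ := exists_nu hI (Submodule.span R {t} ⊔ N0) (le_sup_right.trans le_sup_right) a ha
    have ht2 : π 2 (t : T) = t := t.2
    have ha2 : π 2 (a : T) = a := a.2
    obtain ⟨y, hy⟩ := hA 4 (by norm_num) ((t : T) ⊗ₜ[R] (a : T) - (a : T) ⊗ₜ[R] (t : T)) (by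
        rw [map_sub, gc.tPi_apply 4 ht2 ha2, gc.tPi_apply 4 ha2 ht2, if_pos (by norm_num), if_pos (by norm_num)]) (by
        rw [map_sub, gc.tS_apply ht2 ha2, gc.tS_apply ha2 ht2, sg, if_pos (by decide), one_smul, one_smul]; abel) (by
        rw [map_sub, gc.tD_apply _ ht2, gc.tD_apply _ ha2, gc.d2 ht2, gc.d2 ha2]; simp)
    have h1 := kill_D (π := π) (ν ∘ₗ τ) (μ ∘ₗ τ) (hd ν hν) (hd μ fun n hn => hμ n (Submodule.mem_sup_right hn)) y
    have h3 : μ t = 0 := hμ t (Submodule.mem_sup_left (Submodule.mem_span_singleton_self t))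
    rw [hy, map_sub, TensorProduct.map_tmul, TensorProduct.map_tmul, map_sub, LinearMap.mul'_apply, LinearMap.mul'_apply] at h1
    simp only [LinearMap.comp_apply, hτ, hν1, hμ1, h3] at h1
    have : Nontrivial (R ⧸ I) := Ideal.Quotient.nontrivial_iff.2 hI.ne_top
    simp at h1
  obtain ⟨t, ht⟩ := key
  have := nak' (I := I) (Cs π 2) (Submodule.span R {(t : T)} ⊔ LinearMap.range d) (fun f hf v hv => by
    obtain ⟨n, y, hy⟩ := tor f hf v hv
    exact ⟨n, Submodule.mem_sup_right ⟨y, hy⟩⟩) (by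
    rintro a -
    refine (sup_le ?_ (sup_le_sup_right ?_ _) : Submodule.span R {t} ⊔ N0 ≤ _) (ht a)
    · refine le_sup_of_le_left ?_
      rw [Submodule.span_singleton_le_iff_mem]
      exact Submodule.mem_sup_left (Submodule.mem_span_singleton_self _)
    · exact fun x hx => Submodule.mem_sup_right hx)
  refine ⟨t, t.2, fun a ha => ?_⟩
  obtain ⟨w, hw, v, ⟨y, rfl⟩, e⟩ := Submodule.mem_sup.1 (this a ha)
  obtain ⟨r, rfl⟩ := Submodule.mem_span_singleton.1 hw
  exact ⟨r, y, e⟩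

lemma step3 [Module.Finite R T] [Module.Projective R T] (hI0 : I ≠ ⊥) (gc : GC d π (-2) 2) (hA : Anti d π) 
    (tor : ∀ f ∈ I, ∀ z, π 2 z = z → ∃ (n : ℕ) (y : T), d y = f ^ n • z) (t : T) (ht : π 2 t = t) 
    (hg : ∀ a, π 2 a = a → ∃ (r : R) (y : T), r • t + d y = a) : ∃ y, d y = t := by
  let 𝔞 : Ideal R := (LinearMap.range d).comap (LinearMap.toSpanSingleton R T t)
  have hm : ∀ s, s ∈ 𝔞 ↔ ∃ y, d y = s • t := fun s => Iff.rfl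
  obtain ⟨l, hl⟩ := lift_range ((LinearMap.range d).mkQ ∘ₗ π 2) ((LinearMap.range d).mkQ ∘ₗ LinearMap.toSpanSingleton R T t) (fun a => by
    obtain ⟨r, y, e⟩ := hg (π 2 a) (gc.idem 2 a)
    refine ⟨r, ?_⟩
    rw [LinearMap.comp_apply, LinearMap.comp_apply, ← e, map_add, show (LinearMap.range d).mkQ (d y) = 0 from 
      (Submodule.Quotient.mk_eq_zero _).2 ⟨y, rfl⟩, add_zero]; rfl)
  have hl' : ∀ x, ∃ y, d y = l x • t - π 2 x := fun x => (Submodule.Quotient.eq _).1 (hl x)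
  have l1 : l t - 1 ∈ 𝔞 := by
    obtain ⟨y, hy⟩ := hl' t
    exact (hm _).2 ⟨y, by rw [hy, ht, sub_smul, one_smul]⟩
  have l2 : ∀ x, l (d x) ∈ 𝔞 := by
    intro x
    obtain ⟨y, hy⟩ := hl' (d x)
    refine (hm _).2 ⟨y + π 1 x, ?_⟩
    rw [map_add, hy, ← gc.comm]; exact sub_add_cancel _ _
  have hsq : 𝔞 ≤ 𝔞 * 𝔞 := by
    intro s hs
    obtain ⟨u', hu'⟩ := (hm s).1 hs
    obtain ⟨u, hu1, hu⟩ : ∃ u, π 1 u = u ∧ d u = s • t := 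
      ⟨π 1 u', gc.idem _ _, by rw [← gc.comm, hu', map_smul]; exact congrArg (s • ·) ht⟩
    obtain ⟨y, hy⟩ := hA 3 (by norm_num) (u ⊗ₜ[R] t - t ⊗ₜ[R] u) (by
        rw [map_sub, gc.tPi_apply 3 hu1 ht, gc.tPi_apply 3 ht hu1, if_pos (by norm_num), if_pos (by norm_num)]) (by
        rw [map_sub, gc.tS_apply hu1 ht, gc.tS_apply ht hu1, sg, if_pos (by decide), sg, if_pos (by decide), one_smul, one_smul]; abel) (by
        rw [map_sub, gc.tD_apply _ hu1, gc.tD_apply _ ht, gc.d2 ht, hu, sg_two, TensorProduct.tmul_smul]; simp [TensorProduct.smul_tmul'])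
    have hK : ∀ z, LinearMap.mul' R R (TensorProduct.map (l ∘ₗ d) l (tD d π z)) ∈ 𝔞 * 𝔞 := by
      intro z
      induction z using TensorProduct.induction_on with
      | zero => simp
      | tmul a b =>
        simp only [tD, LinearMap.add_apply, LinearMap.sum_apply, LinearMap.smul_apply, TensorProduct.map_tmul, map_add, map_sum, 
          map_smul, LinearMap.mul'_apply, LinearMap.comp_apply, gc.dd, map_zero, zero_mul, zero_add]
        exact Ideal.sum_mem _ fun i _ => Ideal.mul_mem_left _ _ (Ideal.mul_mem_mul (l2 _) (l2 _))
      | add a b ha hb => simp only [map_add]; exact Ideal.add_mem _ ha hb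
    have h1 := hK y
    rw [hy, map_sub, TensorProduct.map_tmul, TensorProduct.map_tmul, map_sub, LinearMap.mul'_apply, LinearMap.mul'_apply, 
      LinearMap.comp_apply, LinearMap.comp_apply, gc.d2 ht, map_zero, zero_mul, sub_zero, hu, map_smul, smul_eq_mul] at h1
    have h2 : s * ((l t - 1) * (l t + 1)) ∈ 𝔞 * 𝔞 := Ideal.mul_mem_mul hs (Ideal.mul_mem_right _ _ l1)
    have := Ideal.sub_mem _ h1 h2
    rwa [show s * l t * l t - s * ((l t - 1) * (l t + 1)) = s by ring] at this
  have hid : IsIdempotentElem 𝔞 := le_antisymm Ideal.mul_le_left hsq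
  rcases (Ideal.isIdempotentElem_iff_eq_bot_or_top 𝔞 (IsNoetherian.noetherian 𝔞)).1 hid with h | h
  · exfalso
    obtain ⟨f, hf, hf0⟩ := Submodule.exists_mem_ne_zero_of_ne_bot hI0
    obtain ⟨n, y, hy⟩ := tor f hf t ht
    have : f ^ n ∈ 𝔞 := (hm _).2 ⟨y, hy⟩
    rw [h, Submodule.mem_bot] at this
    exact pow_ne_zero n hf0 this
  · obtain ⟨y, hy⟩ := (hm 1).1 (h ▸ trivial)
    exact ⟨y, by rw [hy, one_smul]⟩

lemma step2 [Module.Finite R T] [Module.Projective R T] (hI : I.IsMaximal) (gc : GC d π (-2) 2) (hA : Anti d π) 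
    (tor : ∀ f ∈ I, ∀ z, π 1 z = z → d z = 0 → ∃ (n : ℕ) (y : T), d y = f ^ n • z) 
    (h2 : ∀ z, π 2 z = z → ∃ y, d y = z) : ∀ z, π 1 z = z → d z = 0 → ∃ y, d y = z := by
  obtain ⟨s, hs⟩ := lift_range (π 2) d (fun a => h2 _ (gc.idem 2 a))
  let τ : T →ₗ[R] Zs d π 1 := LinearMap.codRestrict (Zs d π 1) (π 1 ∘ₗ (LinearMap.id - s ∘ₗ d ∘ₗ π 1)) (fun x => by
    refine ⟨gc.idem _ _, ?_⟩
    simp only [LinearMap.comp_apply, LinearMap.sub_apply, LinearMap.id_apply, map_sub]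
    rw [← gc.comm 1 (s _), hs, show (1 : ℤ) + 1 = 2 from rfl, gc.idem, show (2 : ℤ) = 1 + 1 from rfl, gc.comm, gc.idem, sub_self])
  have hτv : ∀ x, (τ x : T) = π 1 (x - s (d (π 1 x))) := fun x => rfl
  have hτ : ∀ a : Zs d π 1, τ a = a := fun a => Subtype.ext (by
    rw [hτv, a.2.1, a.2.2, map_zero, sub_zero, a.2.1])
  let N0 : Submodule R (Zs d π 1) := (LinearMap.range d).comap (Zs d π 1).subtype ⊔ I • ⊤
  have hd : ∀ ν : Zs d π 1 →ₗ[R] R ⧸ I, (∀ n ∈ N0, ν n = 0) → ∀ x, (ν ∘ₗ τ) (d x) = 0 := by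
    intro ν hν x
    refine hν _ (Submodule.mem_sup_left ⟨π 0 x, ?_⟩)
    change _ = (τ (d x) : T)
    rw [hτv, show π 1 (d x) = d (π 0 x) from gc.comm 0 x, gc.dd, map_zero, sub_zero]
    exact (gc.comm 0 x).symm
  have key : ∀ a : Zs d π 1, a ∈ N0 := by
    intro a
    by_contra ha
    obtain ⟨ν, hν, hν1⟩ := exists_nu hI N0 le_sup_right a ha
    have ha1 : π 1 (a : T) = a := a.2.1
    have ha2 : d (a : T) = 0 := a.2.2
    obtain ⟨y, hy⟩ := hA 2 (by norm_num) ((a : T) ⊗ₜ[R] (a : T)) (by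
        rw [gc.tPi_apply 2 ha1 ha1, if_pos (by norm_num)]) (by
        rw [gc.tS_apply ha1 ha1, mul_one, sg_one]; simp) (by
        rw [gc.tD_apply _ ha1, ha2]; simp)
    have h1 := kill_D (π := π) (ν ∘ₗ τ) (ν ∘ₗ τ) (hd ν hν) (hd ν hν) y
    rw [hy, TensorProduct.map_tmul, LinearMap.mul'_apply] at h1
    simp only [LinearMap.comp_apply, hτ, hν1] at h1
    have : Nontrivial (R ⧸ I) := Ideal.Quotient.nontrivial_iff.2 hI.ne_top
    simp at h1
  intro z hz hz'
  exact nak' (I := I) (Zs d π 1) (LinearMap.range d) (fun f hf v hv => by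
    obtain ⟨n, y, hy⟩ := tor f hf v hv.1 hv.2
    exact ⟨n, ⟨y, hy⟩⟩) (fun a _ => key a) z ⟨hz, hz'⟩

theorem projective_of_lc (hG : Good R I) (hI : I.IsMaximal) (hI0 : I ≠ ⊥) {c : R} (hc : 2 * c = 1) (E : Type) [AddCommGroup E] 
    [Module R E] [Module.Finite R E] (ω : E →ₗ[R] E →ₗ[R] R) (hω : FD I ω) 
    (l0 : LC I 0 E) (l1 : LC I 1 E) (l4 : LC I 4 E) (l5 : LC I 5 E) : Module.Projective R E := by
  obtain ⟨F, _, _, T, _, _, _, _, d, π, q, P, hq, hT, h⟩ := exists_TP I hG E ω hω l0 l1 l4 l5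
  have gc := hT.gc
  have hA : Anti d π := fun k hk z h1 h2 h3 => hT.anti hG hI0 hq hω hc k hk z h1 h2 h3
  have tor : ∀ f ∈ I, ∀ z, π 2 z = z → ∃ (n : ℕ) (y : T), d y = f ^ n • z := fun f hf z hz => 
    hT.pos f hf 2 (by norm_num) z hz (gc.d2 hz)
  obtain ⟨t, ht, hg⟩ := step4 hI gc hA tor
  obtain ⟨y0, hy0⟩ := step3 hI0 gc hA tor t ht hg
  have h2 : ∀ z, π 2 z = z → ∃ y, d y = z := by
    intro z hz
    obtain ⟨r, y, e⟩ := hg z hz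
    exact ⟨r • y0 + y, by rw [map_add, map_smul, hy0, e]⟩
  exact h (step2 hI gc hA (fun f hf => hT.pos f hf 1 (by norm_num)) h2) h2
end h1Sec
end partH1

section partH2
lemma irrel_max_aux (K : Type) [Field K] (n : ℕ) : 
    (Ideal.span (Set.range (MvPolynomial.X : Fin n → MvPolynomial (Fin n) K))).IsMaximal := by
  have h : RingHom.ker (MvPolynomial.constantCoeff : MvPolynomial (Fin n) K →+* K) = Ideal.span (Set.range MvPolynomial.X) := by
    apply le_antisymm
    · intro p hp
      rw [RingHom.mem_ker] at hp
      have : p = p - MvPolynomial.C (MvPolynomial.constantCoeff p) := by rw [hp]; simp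
      rw [this]
      clear this hp
      induction p using MvPolynomial.induction_on with
      | C a => simp
      | add p q hp hq => 
        rw [map_add, map_add, add_sub_add_comm]; exact Ideal.add_mem _ hp hq
      | mul_X p i hp => 
        simp only [map_mul, MvPolynomial.constantCoeff_X, mul_zero, map_zero, sub_zero]
        exact Ideal.mul_mem_left _ _ (Ideal.subset_span ⟨i, rfl⟩)
    · rw [Ideal.span_le]
      rintro _ ⟨i, rfl⟩
      simp [RingHom.mem_ker]
  rw [← h]
  exact RingHom.ker_isMaximal_of_surjective _ (fun c => ⟨MvPolynomial.C c, by simp⟩)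

lemma good_poly (K : Type) [Field K] : Good (MvPolynomial (Fin 9) K) (Ideal.span (Set.range MvPolynomial.X)) := by
  refine ⟨fun i hi => LC.ring K 9 i hi, ?_, ?_⟩
  · intro N _ _ _ hN j hj
    obtain ⟨c, hc⟩ := PT.uniform hN
    exact extZ_torsion K 9 N c hc j hj
  · intro M _ _ hM
    exact PD.of_FR 9 M (GLD.mvPolynomial K 9 M hM)

theorem split_poly (K : Type) [Field K] [CharZero K] (E : Type) [AddCommGroup E] [Module (MvPolynomial (Fin 9) K) E] 
    (I : Ideal (MvPolynomial (Fin 9) K)) (hIs : I = Ideal.span (Set.range MvPolynomial.X))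
    [Module.Finite (MvPolynomial (Fin 9) K) E] (hE : ∀ p : Ideal (MvPolynomial (Fin 9) K), p.IsPrime → p ≠ I → LB p E)
    (l0 : LC I 0 E) (l1 : LC I 1 E) (l4 : LC I 4 E) (l5 : LC I 5 E) : 
    Module.Free (MvPolynomial (Fin 9) K) E ∧ Module.rank (MvPolynomial (Fin 9) K) E = 2 := by
  have hG : Good (MvPolynomial (Fin 9) K) I := hIs ▸ good_poly K
  have hI : I.IsMaximal := hIs ▸ irrel_max_aux K 9
  have hX : ∀ i, (MvPolynomial.X i : MvPolynomial (Fin 9) K) ∈ I := fun i => hIs ▸ Ideal.subset_span ⟨i, rfl⟩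
  have hI0 : I ≠ ⊥ := fun h => MvPolynomial.X_ne_zero (R := K) (0 : Fin 9) (by simpa [h] using hX 0)
  have hc : (2 : MvPolynomial (Fin 9) K) * MvPolynomial.C (2⁻¹ : K) = 1 := by
    rw [show (2 : MvPolynomial (Fin 9) K) = MvPolynomial.C 2 from rfl, ← map_mul, mul_inv_cancel₀ two_ne_zero, map_one]
  have htf : ∀ (r : MvPolynomial (Fin 9) K) (_ : r ≠ 0) (a : E), r • a = 0 → a = 0 := lb_torsionfree hE l0
  obtain ⟨i, φ, hi, hφ⟩ := lb_embed htf (hE ⊥ inferInstance (Ne.symm hI0))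
  have hrank : Module.rank (MvPolynomial (Fin 9) K) E = 2 := by
    apply le_antisymm
    · simpa using LinearMap.rank_le_of_injective φ hφ
    · simpa using LinearMap.rank_le_of_injective i hi
  obtain ⟨ω0, hω0, hω0v⟩ := exists_pf φ hφ
  have hne0 : ∃ c d, ω0 c d ≠ 0 := by
    by_contra h
    push Not at h
    have key : ∀ a b : E, ω0 a b = 0 := h
    have h1 := hω0v (i (Pi.single 0 1)) (i (Pi.single 1 1))
    rw [key] at h1
    -- linear dependence
    have h2 : φ (i ((φ (i (Pi.single 1 1)) 1) • Pi.single 0 1 - (φ (i (Pi.single 0 1)) 1) • Pi.single 1 1)) = 0 := by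
      funext j
      fin_cases j
      · simp only [map_sub, map_smul, Pi.sub_apply, Pi.smul_apply, smul_eq_mul, Pi.zero_apply]
        simp only [Fin.zero_eta]
        linear_combination -h1
      · simp only [map_sub, map_smul, Pi.sub_apply, Pi.smul_apply, smul_eq_mul, Pi.zero_apply]
        simp only [Fin.mk_one]
        ring
    have h2' : φ (i ((φ (i (Pi.single 1 1)) 0) • Pi.single 0 1 - (φ (i (Pi.single 0 1)) 0) • Pi.single 1 1)) = 0 := by
      funext j
      fin_cases j
      · simp only [map_sub, map_smul, Pi.sub_apply, Pi.smul_apply, smul_eq_mul, Pi.zero_apply]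
        simp only [Fin.zero_eta]
        ring
      · simp only [map_sub, map_smul, Pi.sub_apply, Pi.smul_apply, smul_eq_mul, Pi.zero_apply]
        simp only [Fin.mk_one]
        linear_combination h1
    have h3 := hi (hφ (h2.trans (by simp : φ (i 0) = 0).symm))
    have h3' := hi (hφ (h2'.trans (by simp : φ (i 0) = 0).symm))
    have h4 := congrFun h3 0
    have h5 := congrFun h3' 0
    simp at h4 h5
    have h6 : φ (i (Pi.single 1 1)) = 0 := by
      funext j
      fin_cases j
      · exact h5
      · exact h4
    have h7 := hi (hφ (h6.trans (by simp : φ (i 0) = 0).symm))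
    simpa using congrFun h7 1
  obtain ⟨c, d, hcd⟩ := hne0
  obtain ⟨ω, hω, hωcd, hprim⟩ := pf_primitive htf c d _ ω0 hω0 rfl hcd
  have hJ := pf_J hE ω hω hprim ⟨c, d, hωcd⟩
  have hFD : FD I ω := by
    refine ⟨hω, fun f hf => ?_, fun β hβ => ?_⟩
    · obtain ⟨n, hn⟩ := hJ hf
      obtain ⟨k, a, b, e⟩ := span_form ω _ hn
      exact ⟨n, k, a, b, e⟩
    · refine pf_unique ω hω ⟨c, d, hωcd⟩ (MvPolynomial.X 0) (MvPolynomial.X 1) MvPolynomial.X_prime ?_ (hJ (hX 0)) (hJ (hX 1)) β hβ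
      rw [MvPolynomial.X_dvd_X]; decide
  have := projective_of_lc hG hI hI0 hc E ω hFD l0 l1 l4 l5
  exact ⟨free_of_projective_rank_two K 9 E i hi, hrank⟩
end partH2

end helperLemmas

/-- main splitting theorem.  Let `E` be a rank two vector bundle on
`ℙ⁸` (over an algebraically closed field of characteristic zero) with
`H³_*(E) = H⁴_*(E) = 0`.  Then `E` is a direct sum of two line bundles. -/
theorem splitting_on_P8
    (K : Type) [Field K] [IsAlgClosed K] [CharZero K]
    (E : Type) [AddCommGroup E] [Module (PolyS K 8) E]
    (hE : IsRankTwoBundleModule K 8 E)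
    (h3 : Subsingleton (Hstar K 8 3 E))
    (h4 : Subsingleton (Hstar K 8 4 E)) :
    Module.Free (PolyS K 8) E ∧ Module.rank (PolyS K 8) E = 2 := by
  have hfin := hE.finite
  refine split_poly K E (irrel K 8) rfl (fun p hp hpm => ?_) (LC.of_localCohomology _ 0 E hE.h0) (LC.of_localCohomology _ 1 E hE.h1)
    (LC.of_localCohomology _ 4 E h3) (LC.of_localCohomology _ 5 E h4)
  exact loc_basis p (hE.locFree ⟨p, hp⟩ hpm) (hE.rank2 ⟨p, hp⟩ hpm)
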